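/- Let k ≥ 2 be an integer, n ≥ 3, 0 ≤ a < (n-2)/2, 0 < b, a ≤ b < a+1, p = 2n/(n-2+2(b-a)), and for all 1 ≤ i, j ≤ k let κ_{ij} > 0 and α_{ij}, β_{ij} > 1 with α_{ij} + β_{ij} = p. Let (u₁, …, u_k) be a positive finite-energy solution of the k-coupled Hénon–Sobolev system (S_k). Then for every 1 ≤ i ≤ k: (1) u_i is radially symmetric about the origin; (2) the limits lim_{x→0} u_i(x) and lim_{|x|→∞} |x|^{n-2-2a} u_i(x) exist and are positive; (3) there exists τ_i > 0 such that, setting ũ_i(x) = τ_i^{(n-2-2a)/2} u_i(τ_i x), for any fixed unit vector e ∈ ℝⁿ the function t ↦ e^{-((n-2-2a)/2)t} ũ_i(e^{-t} e) is even on ℝ and strictly decreasing on (0, ∞). -/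

import Mathlib

open MeasureTheory Real Filter Topology

noncomputable section

/-- Coordinate Laplacian on Euclidean space. -/
def lapl {n : ℕ} (w : EuclideanSpace ℝ (Fin n) → ℝ) (x : EuclideanSpace ℝ (Fin n)) : ℝ :=
  ∑ i : Fin n, fderiv ℝ (fun y => fderiv ℝ w y (EuclideanSpace.single i 1)) x
    (EuclideanSpace.single i 1)

/-- The weighted divergence `div(|x|^(-2a) ∇w)(x) = |x|^(-2a) (Δw(x) - 2a⟨x,∇w(x)⟩/|x|²)`. -/
def wdiv {n : ℕ} (a : ℝ) (w : EuclideanSpace ℝ (Fin n) → ℝ) (x : EuclideanSpace ℝ (Fin n)) : ℝ :=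
  ‖x‖ ^ (-(2*a)) * (lapl w x - 2*a * (@inner ℝ _ _ x (gradient w x)) / ‖x‖^2)

/-- Finiteness of the weighted Dirichlet energy `∫ |x|^(-2a) |∇w|² < ∞`. -/
def finiteEnergy {n : ℕ} (a : ℝ) (w : EuclideanSpace ℝ (Fin n) → ℝ) : Prop :=
  Integrable (fun x : EuclideanSpace ℝ (Fin n) => ‖x‖ ^ (-(2*a)) * ‖gradient w x‖^2)

section Toolkit

open InnerProductSpace Laplacian

variable {n : ℕ}

local notation "E" n => EuclideanSpace ℝ (Fin n)

theorem laplacian_eq_sum_fderiv_fderiv {ι : Type*} [Fintype ι] (b : OrthonormalBasis ι ℝ (E n))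
    (f : (E n) → ℝ) (x : E n) :
    Δ f x = ∑ i, fderiv ℝ (fderiv ℝ f) x (b i) (b i) := by
  rw [congrFun (laplacian_eq_iteratedFDeriv_orthonormalBasis f b) x]
  refine Finset.sum_congr rfl fun i _ => ?_
  rw [iteratedFDeriv_two_apply]
  simp

theorem laplacian_eq_of_hasFDerivAt {ι : Type*} [Fintype ι] (b : OrthonormalBasis ι ℝ (E n))
    {f : (E n) → ℝ} {f' : (E n) → (E n) →L[ℝ] ℝ} {f'' : (E n) →L[ℝ] (E n) →L[ℝ] ℝ} {x : E n}
    (h1 : ∀ᶠ y in 𝓝 x, HasFDerivAt f (f' y) y) (h2 : HasFDerivAt f' f'' x) :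
    Δ f x = ∑ i, f'' (b i) (b i) := by
  have h : fderiv ℝ f =ᶠ[𝓝 x] f' := by
    filter_upwards [h1] with y hy using hy.fderiv
  rw [laplacian_eq_sum_fderiv_fderiv b, h.fderiv_eq, h2.fderiv]

theorem ContDiffAt.eventually_hasFDerivAt {f : (E n) → ℝ} {x : E n} (hf : ContDiffAt ℝ 2 f x) :
    ∀ᶠ y in 𝓝 x, HasFDerivAt f (fderiv ℝ f y) y := by
  filter_upwards [hf.eventually (by simp)] with y hy
  exact (hy.differentiableAt (by simp)).hasFDerivAt

theorem ContDiffAt.hasFDerivAt_fderiv_two {f : (E n) → ℝ} {x : E n} (hf : ContDiffAt ℝ 2 f x) :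
    HasFDerivAt (fderiv ℝ f) (fderiv ℝ (fderiv ℝ f) x) x :=
  ((hf.fderiv_right (m := 1) (by norm_num)).differentiableAt (by simp)).hasFDerivAt

theorem lapl_eq_laplacian {f : (E n) → ℝ} {x : E n} (hf : ContDiffAt ℝ 2 f x) :
    lapl f x = Δ f x := by
  rw [laplacian_eq_sum_fderiv_fderiv (EuclideanSpace.basisFun (Fin n) ℝ), lapl]
  refine Finset.sum_congr rfl fun i _ => ?_
  have := hf.hasFDerivAt_fderiv_two.clm_apply
    (hasFDerivAt_const (EuclideanSpace.single i (1 : ℝ)) x)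
  rw [this.fderiv]
  simp

/-- The Laplacian under a similarity `y ↦ c + r • A y`. -/
theorem laplacian_comp_similarity (A : (E n) ≃ₗᵢ[ℝ] (E n)) (r : ℝ) (c : E n) {f : (E n) → ℝ}
    {x : E n}
    (hf : ContDiffAt ℝ 2 f (c + r • A x)) :
    Δ (fun y => f (c + r • A y)) x = r ^ 2 * Δ f (c + r • A x) := by
  set R : (E n) → (E n) := fun y => c + r • A y with hR
  set L : (E n) →L[ℝ] (E n) := r • (A.toContinuousLinearEquiv : (E n) →L[ℝ] (E n)) with hL
  have hRd : ∀ y, HasFDerivAt R L y := fun y => by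
    have := ((A.toContinuousLinearEquiv : (E n) →L[ℝ] (E n)).hasFDerivAt (x := y)).const_smul r
    exact this.const_add c
  have hRc : Tendsto R (𝓝 x) (𝓝 (R x)) := (hRd x).continuousAt
  have h1 : ∀ᶠ y in 𝓝 x, HasFDerivAt (fun y => f (R y)) ((fderiv ℝ f (R y)).comp L) y := by
    filter_upwards [hRc.eventually hf.eventually_hasFDerivAt] with y hy
    exact hy.comp y (hRd y)
  have h2 := (hf.hasFDerivAt_fderiv_two.comp x (hRd x)).clm_comp (hasFDerivAt_const L x)
  rw [laplacian_eq_of_hasFDerivAt (EuclideanSpace.basisFun (Fin n) ℝ) h1 h2,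
    laplacian_eq_sum_fderiv_fderiv ((EuclideanSpace.basisFun (Fin n) ℝ).map A), Finset.mul_sum]
  refine Finset.sum_congr rfl fun i _ => ?_
  simp [hL, hR]
  ring

theorem laplacian_mul {f g : (E n) → ℝ} {x : E n} (hf : ContDiffAt ℝ 2 f x)
    (hg : ContDiffAt ℝ 2 g x) :
    Δ (fun y => f y * g y) x = f x * Δ g x + 2 * inner ℝ (gradient f x) (gradient g x)
      + g x * Δ f x := by
  have h1 : ∀ᶠ y in 𝓝 x, HasFDerivAt (fun y => f y * g y)
      (f y • fderiv ℝ g y + g y • fderiv ℝ f y) y := by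
    filter_upwards [hf.eventually_hasFDerivAt, hg.eventually_hasFDerivAt] with y h1 h2
    exact h1.mul h2
  have hf1 := hf.eventually_hasFDerivAt.self_of_nhds
  have hg1 := hg.eventually_hasFDerivAt.self_of_nhds
  have h2 := (hf1.smul hg.hasFDerivAt_fderiv_two).add (hg1.smul hf.hasFDerivAt_fderiv_two)
  set b := EuclideanSpace.basisFun (Fin n) ℝ
  rw [laplacian_eq_of_hasFDerivAt b h1 h2, laplacian_eq_sum_fderiv_fderiv b f,
    laplacian_eq_sum_fderiv_fderiv b g, ← b.sum_inner_mul_inner, Finset.mul_sum, Finset.mul_sum,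
    Finset.mul_sum, ← Finset.sum_add_distrib, ← Finset.sum_add_distrib]
  refine Finset.sum_congr rfl fun i _ => ?_
  rw [real_inner_comm (gradient g x)]
  simp only [gradient, InnerProductSpace.toDual_symm_apply, add_apply, smul_apply,
    ContinuousLinearMap.smulRight_apply, smul_eq_mul]
  ring

/-- Laplacian of a function whose gradient is the multiple `c y • y` of the position vector. -/
theorem laplacian_of_radial_gradient {f c : (E n) → ℝ} {c' : (E n) →L[ℝ] ℝ} {x : E n}
    (h1 : ∀ᶠ y in 𝓝 x, HasFDerivAt f (c y • innerSL ℝ y) y) (h2 : HasFDerivAt c c' x) :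
    Δ f x = n * c x + c' x := by
  have h3 := h2.smul (innerSL ℝ : (E n) →L[ℝ] (E n) →L[ℝ] ℝ).hasFDerivAt
  set b := EuclideanSpace.basisFun (Fin n) ℝ
  rw [laplacian_eq_of_hasFDerivAt b h1 h3]
  have hx : c' x = ∑ i, c' (b i) * inner ℝ x (b i) := by
    conv_lhs => rw [← b.sum_repr x]
    rw [map_sum]
    refine Finset.sum_congr rfl fun i _ => ?_
    rw [map_smul, b.repr_apply_apply, real_inner_comm]
    simp [mul_comm]
  have hn : (n : ℝ) * c x = ∑ i : Fin n, c x * inner ℝ (b i) (b i) := by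
    have : ∀ i, inner ℝ (b i) (b i) = (1 : ℝ) := fun i => by
      rw [real_inner_self_eq_norm_sq, b.orthonormal.1 i]; norm_num
    simp only [this, mul_one, Finset.sum_const, Finset.card_univ, Fintype.card_fin, nsmul_eq_mul]
  rw [hx, hn, ← Finset.sum_add_distrib]
  refine Finset.sum_congr rfl fun i _ => ?_
  simp only [add_apply, smul_apply, ContinuousLinearMap.smulRight_apply, smul_eq_mul]
  rfl

theorem hasFDerivAt_log_norm {x : E n} (hx : x ≠ 0) :
    HasFDerivAt (fun y : E n => Real.log ‖y‖) ((‖x‖ ^ 2)⁻¹ • innerSL ℝ x) x := by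
  have h1 : HasFDerivAt (fun y : E n => ‖y‖ ^ 2) (2 • (innerSL ℝ x)) x :=
    (hasStrictFDerivAt_norm_sq x).hasFDerivAt
  have hx2 : ‖x‖ ^ 2 ≠ 0 := by simpa using hx
  have h2 := (h1.log hx2).const_mul (1 / 2)
  have : (fun y : E n => Real.log ‖y‖) = fun y => (1 / 2) * Real.log (‖y‖ ^ 2) := by
    funext y; rw [Real.log_pow]; push_cast; ring
  rw [this]
  refine h2.congr_fderiv ?_
  ext v
  simp
  ring

theorem eventually_ne_zero {x : E n} (hx : x ≠ 0) : ∀ᶠ y in 𝓝 x, y ≠ 0 :=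
  isOpen_ne.mem_nhds hx

theorem hasFDerivAt_comp_log_norm {F : ℝ → ℝ} {d : ℝ} {x : E n} (hx : x ≠ 0)
    (hF : HasDerivAt F d (Real.log ‖x‖)) :
    HasFDerivAt (fun y : E n => F (Real.log ‖y‖)) ((d * (‖x‖ ^ 2)⁻¹) • innerSL ℝ x) x := by
  have := hF.comp_hasFDerivAt x (hasFDerivAt_log_norm hx)
  rwa [smul_smul] at this

/-- Laplacian of a radial function, in the logarithmic radial variable. -/
theorem laplacian_comp_log_norm {F F' : ℝ → ℝ} {d : ℝ} (hF : ∀ s, HasDerivAt F (F' s) s) {x : E n}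
    (hx : x ≠ 0) (hF' : HasDerivAt F' d (Real.log ‖x‖)) :
    Δ (fun y : E n => F (Real.log ‖y‖)) x
      = (‖x‖ ^ 2)⁻¹ * (d + (n - 2) * F' (Real.log ‖x‖)) := by
  have hx2 : ‖x‖ ^ 2 ≠ 0 := by simpa using hx
  have h1 : ∀ᶠ y in 𝓝 x, HasFDerivAt (fun y : E n => F (Real.log ‖y‖))
      ((F' (Real.log ‖y‖) * (‖y‖ ^ 2)⁻¹) • innerSL ℝ y) y := by
    filter_upwards [eventually_ne_zero hx] with y hy
    exact hasFDerivAt_comp_log_norm hy (hF _)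
  have h2 : HasFDerivAt (fun y : E n => ‖y‖ ^ 2) (2 • (innerSL ℝ x)) x :=
    (hasStrictFDerivAt_norm_sq x).hasFDerivAt
  have h3 := (hasFDerivAt_comp_log_norm hx hF').mul ((hasDerivAt_inv hx2).comp_hasFDerivAt x h2)
  rw [laplacian_of_radial_gradient h1 h3]
  simp
  field_simp
  ring

theorem laplacian_nonpos_of_isLocalMax {f : (E n) → ℝ} {x : E n} (hf : ContDiffAt ℝ 2 f x)
    (h : IsLocalMax f x) : Δ f x ≤ 0 := by
  rw [laplacian_eq_sum_fderiv_fderiv (EuclideanSpace.basisFun (Fin n) ℝ)]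
  refine Finset.sum_nonpos fun i _ => ?_
  set v := EuclideanSpace.basisFun (Fin n) ℝ i
  set γ : ℝ → E n := fun t => x + t • v
  have hγ : ∀ t, HasDerivAt γ v t := fun t => by
    have := ((hasDerivAt_id t).smul_const v).const_add x
    rwa [one_smul] at this
  have hγ0 : γ 0 = x := by simp [γ]
  have hγt : Tendsto γ (𝓝 0) (𝓝 x) := by simpa [hγ0] using (hγ 0).continuousAt.tendsto
  have h1 : deriv (fun t => f (γ t)) =ᶠ[𝓝 0] fun t => fderiv ℝ f (γ t) v := by
    filter_upwards [hγt.eventually hf.eventually_hasFDerivAt] with t ht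
    exact (ht.comp_hasDerivAt t (hγ t)).deriv
  have h2 : HasDerivAt (fun t => fderiv ℝ f (γ t) v) (fderiv ℝ (fderiv ℝ f) x v v) 0 := by
    have h3 : HasFDerivAt (fderiv ℝ f) (fderiv ℝ (fderiv ℝ f) x) (γ 0) := by
      rw [hγ0]; exact hf.hasFDerivAt_fderiv_two
    have := (h3.comp_hasDerivAt 0 (hγ 0)).clm_apply (hasDerivAt_const (0 : ℝ) v)
    simpa using this
  have hmax : IsLocalMax (fun t => f (γ t)) 0 := by
    have := hγt.eventually h
    filter_upwards [this] with t ht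
    simpa [hγ0] using ht
  by_contra hcon
  push Not at hcon
  have hdd : deriv (deriv fun t => f (γ t)) 0 = fderiv ℝ (fderiv ℝ f) x v v := by
    rw [h1.deriv_eq, h2.deriv]
  have hmin : IsLocalMin (fun t => f (γ t)) 0 := by
    refine isLocalMin_of_deriv_deriv_pos (by rw [hdd]; exact hcon) hmax.deriv_eq_zero ?_
    have : ContinuousAt f (γ 0) := by rw [hγ0]; exact hf.continuousAt
    exact this.comp (hγ 0).continuousAt
  have hconst : (fun t => f (γ t)) =ᶠ[𝓝 0] fun _ => f (γ 0) := by
    filter_upwards [hmax, hmin] with t h1 h2 using le_antisymm h1 h2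
  have : deriv (deriv fun t => f (γ t)) 0 = 0 := by
    rw [hconst.deriv.deriv_eq]; simp
  rw [hdd] at this
  exact hcon.ne' this

end Toolkit

section Comparison

open InnerProductSpace Laplacian

variable {n : ℕ}

local notation "E" n => EuclideanSpace ℝ (Fin n)

theorem contDiffAt_norm_rpow (s : ℝ) {x : E n} (hx : x ≠ 0) :
    ContDiffAt ℝ 2 (fun y : E n => ‖y‖ ^ s) x :=
  (contDiffAt_norm ℝ hx).rpow_const_of_ne (norm_ne_zero_iff.2 hx)

theorem norm_rpow_eq_exp (s : ℝ) {x : E n} (hx : x ≠ 0) :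
    ‖x‖ ^ s = Real.exp (s * Real.log ‖x‖) := by
  rw [Real.rpow_def_of_pos (norm_pos_iff.2 hx), mul_comm]

theorem hasFDerivAt_norm_rpow_of_ne (s : ℝ) {x : E n} (hx : x ≠ 0) :
    HasFDerivAt (fun y : E n => ‖y‖ ^ s) ((s * ‖x‖ ^ s * (‖x‖ ^ 2)⁻¹) • innerSL ℝ x) x := by
  have h : HasDerivAt (fun t => Real.exp (s * t)) (s * ‖x‖ ^ s) (Real.log ‖x‖) := by
    have := ((hasDerivAt_id (Real.log ‖x‖)).const_mul s).exp
    rw [norm_rpow_eq_exp s hx, mul_comm]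
    simpa using this
  refine (hasFDerivAt_comp_log_norm hx h).congr_of_eventuallyEq ?_
  filter_upwards [eventually_ne_zero hx] with y hy using norm_rpow_eq_exp s hy

theorem laplacian_norm_rpow (s : ℝ) {x : E n} (hx : x ≠ 0) :
    Δ (fun y : E n => ‖y‖ ^ s) x = s * (s + (n - 2)) * ‖x‖ ^ s * (‖x‖ ^ 2)⁻¹ := by
  have h1 : ∀ c t, HasDerivAt (fun t => c * Real.exp (s * t)) (c * s * Real.exp (s * t)) t := by
    intro c t
    refine ((((hasDerivAt_id t).const_mul s).exp).const_mul c).congr_deriv ?_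
    simp only [id]
    ring
  have h := laplacian_comp_log_norm (h1 1) hx (h1 (1 * s) (Real.log ‖x‖))
  have hc : (fun y : E n => ‖y‖ ^ s) =ᶠ[𝓝 x] fun y => 1 * Real.exp (s * Real.log ‖y‖) := by
    filter_upwards [eventually_ne_zero hx] with y hy
    rw [norm_rpow_eq_exp s hy, one_mul]
  rw [(laplacian_congr_nhds hc).self_of_nhds, h, norm_rpow_eq_exp s hx]
  ring

/-- Weak maximum principle for finite families, relative to a positive weight. -/
theorem nonpos_of_weighted_maximum {ι : Type*} [Fintype ι] {Ω : Set (E n)} (hΩ : IsOpen Ω)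
    {ψ : (E n) → ℝ} (hψ : ∀ x ∈ Ω, ContDiffAt ℝ 2 ψ x) (hψ0 : ∀ x ∈ Ω, 0 < ψ x)
    {w : ι → (E n) → ℝ} (hw : ∀ i, ∀ x ∈ Ω, ContDiffAt ℝ 2 (w i) x)
    (hK : ∀ δ > 0, ∃ K, IsCompact K ∧ K ⊆ Ω ∧ ∀ x ∈ Ω, ∀ i, δ * ψ x ≤ w i x → x ∈ K)
    (hΔ : ∀ x ∈ Ω, ∀ i, 0 < w i x → (∀ j, w j x ≤ w i x) → Δ ψ x * w i x < ψ x * Δ (w i) x) :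
    ∀ x ∈ Ω, ∀ i, w i x ≤ 0 := by
  intro x hx i
  by_contra! hcon
  obtain ⟨K, hKc, hKΩ, hKm⟩ := hK (w i x / ψ x) (div_pos hcon (hψ0 x hx))
  have hxK : x ∈ K := hKm x hx i (by rw [div_mul_cancel₀ _ (hψ0 x hx).ne'])
  have hne : (Finset.univ : Finset ι).Nonempty := ⟨i, Finset.mem_univ i⟩
  have hcont : ContinuousOn (fun y => Finset.univ.sup' hne fun j => w j y / ψ y) K := by
    refine ContinuousOn.finset_sup'_apply hne fun j _ => ?_
    intro y hy
    exact ((hw j y (hKΩ hy)).continuousAt.div (hψ y (hKΩ hy)).continuousAt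
      (hψ0 y (hKΩ hy)).ne').continuousWithinAt
  obtain ⟨z, hzK, hz⟩ := hKc.exists_isMaxOn ⟨x, hxK⟩ hcont
  obtain ⟨j, -, hj⟩ := Finset.exists_mem_eq_sup' hne fun j => w j z / ψ z
  have hzΩ := hKΩ hzK
  set M := w j z / ψ z with hM
  have hKM : ∀ y ∈ K, ∀ l, w l y / ψ y ≤ M := by
    intro y hy l
    have h1 := hz hy
    simp only [Set.mem_ofPred_eq, hj] at h1
    exact (Finset.le_sup' (fun j => w j y / ψ y) (Finset.mem_univ l)).trans h1
  have hδM : w i x / ψ x ≤ M := hKM x hxK i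
  have hM0 : 0 < M := (div_pos hcon (hψ0 x hx)).trans_le hδM
  have hall : ∀ y ∈ Ω, ∀ l, w l y ≤ M * ψ y := by
    intro y hy l
    by_cases h : w i x / ψ x * ψ y ≤ w l y
    · exact (div_le_iff₀ (hψ0 y hy)).1 (hKM y (hKm y hy l h) l)
    · exact (not_le.1 h).le.trans (mul_le_mul_of_nonneg_right hδM (hψ0 y hy).le)
  have hwz : w j z = M * ψ z := by rw [hM, div_mul_cancel₀ _ (hψ0 z hzΩ).ne']
  have hmax : IsLocalMax (fun y => w j y - (M • ψ) y) z := by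
    filter_upwards [hΩ.mem_nhds hzΩ] with y hy
    have := hall y hy j
    simp only [Pi.smul_apply, smul_eq_mul]
    linarith
  have hMψ : ContDiffAt ℝ 2 (M • ψ) z := contDiffAt_const.smul (hψ z hzΩ)
  have h1 := laplacian_nonpos_of_isLocalMax ((hw j z hzΩ).sub hMψ) hmax
  have h2 : Δ (fun y => w j y - (M • ψ) y) z = Δ (w j) z - M * Δ ψ z := by
    have := (hw j z hzΩ).laplacian_sub hMψ
    rw [laplacian_smul M (hψ z hzΩ)] at this
    exact this
  have h3 := hΔ z hzΩ j (by rw [hwz]; exact mul_pos hM0 (hψ0 z hzΩ)) (by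
    intro l; rw [hwz]; exact hall z hzΩ l)
  rw [hwz] at h3
  rw [h2] at h1
  nlinarith [hψ0 z hzΩ]

theorem isCompact_annulus (r R : ℝ) : IsCompact {x : E n | r ≤ ‖x‖ ∧ ‖x‖ ≤ R} := by
  refine Metric.isCompact_of_isClosed_isBounded ?_ ?_
  · exact (isClosed_le continuous_const continuous_norm).inter
      (isClosed_le continuous_norm continuous_const)
  · refine (Metric.isBounded_closedBall (x := (0 : E n)) (r := R)).subset fun x hx => ?_
    simpa using hx.2

/-- Comparison near the origin (`σ = -1`) or near infinity (`σ = 1`), for functions which are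
`o(‖x‖ ^ (-(n - 2) / 2))` there. -/
theorem nonpos_of_radial_end {ι : Type*} [Fintype ι] {N : ℝ} (hN : (n : ℝ) = 2 * N + 2) {σ : ℝ}
    (hσ : σ = 1 ∨ σ = -1) {τ₀ : ℝ} {w : ι → (E n) → ℝ}
    (hw : ∀ i, ∀ x ≠ 0, σ * Real.log ‖x‖ ≥ τ₀ → ContDiffAt ℝ 2 (w i) x)
    (hbd : ∀ i, ∀ x ≠ 0, σ * Real.log ‖x‖ = τ₀ → w i x ≤ 0)
    (hend : ∀ i, ∀ δ > 0, ∃ τ₁, ∀ x ≠ 0, τ₁ ≤ σ * Real.log ‖x‖ → ‖x‖ ^ N * w i x < δ)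
    (hΔ : ∀ x ≠ 0, τ₀ < σ * Real.log ‖x‖ → ∀ i, 0 < w i x → (∀ j, w j x ≤ w i x) →
      -N ^ 2 * w i x < ‖x‖ ^ 2 * Δ (w i) x) :
    ∀ x ≠ 0, τ₀ < σ * Real.log ‖x‖ → ∀ i, w i x ≤ 0 := by
  have hlogc : ∀ x : E n, x ≠ 0 → ContinuousAt (fun y : E n => σ * Real.log ‖y‖) x := fun x hx =>
    ((hasFDerivAt_log_norm hx).continuousAt).const_mul σ
  have hΩ : IsOpen {x : E n | x ≠ 0 ∧ τ₀ < σ * Real.log ‖x‖} := by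
    rw [isOpen_iff_mem_nhds]
    rintro x ⟨hx, hx'⟩
    filter_upwards [eventually_ne_zero hx, (hlogc x hx).eventually_const_lt hx'] with y h1 h2
      using ⟨h1, h2⟩
  have key := nonpos_of_weighted_maximum (ι := ι) hΩ (ψ := fun x => ‖x‖ ^ (-N)) (w := w)
    (fun x hx => contDiffAt_norm_rpow _ hx.1) (fun x hx => by
      have := norm_pos_iff.2 hx.1
      positivity) (fun i x hx => hw i x hx.1 hx.2.le) ?_ ?_
  · exact fun x hx hx' => key x ⟨hx, hx'⟩
  · intro δ hδ
    choose t ht using fun i => hend i δ hδ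
    obtain ⟨τ₁, hτ₁⟩ := (Set.finite_range t).bddAbove
    set A := {x : E n | Real.exp (min τ₀ (-(max τ₀ τ₁))) ≤ ‖x‖ ∧
      ‖x‖ ≤ Real.exp (max (-τ₀) (max τ₀ τ₁))} with hA
    have hA0 : ∀ x ∈ A, x ≠ 0 := by
      rintro x ⟨h1, -⟩ rfl
      rw [norm_zero] at h1
      exact absurd (Real.exp_pos _) (not_lt.2 h1)
    have hAc : IsCompact A := isCompact_annulus _ _
    set B := A ∩ {x | τ₀ ≤ σ * Real.log ‖x‖} with hB
    have hBc : IsCompact B := by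
      refine hAc.of_isClosed_subset ?_ Set.inter_subset_left
      exact ContinuousOn.preimage_isClosed_of_isClosed
        (fun x hx => (hlogc x (hA0 x hx)).continuousWithinAt) hAc.isClosed isClosed_Ici
    refine ⟨⋃ i, B ∩ {x | 0 ≤ w i x - δ * ‖x‖ ^ (-N)}, ?_, ?_, ?_⟩
    · refine isCompact_iUnion fun i => hBc.of_isClosed_subset ?_ Set.inter_subset_left
      refine ContinuousOn.preimage_isClosed_of_isClosed (fun x hx => ?_) hBc.isClosed
        (isClosed_Ici (a := (0 : ℝ)))
      exact ((hw i x (hA0 x hx.1) hx.2).continuousAt.sub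
        (continuousAt_const.mul (contDiffAt_norm_rpow _
          (hA0 x hx.1)).continuousAt)).continuousWithinAt
    · intro x hx
      obtain ⟨i, hx⟩ := Set.mem_iUnion.1 hx
      have h0 := hA0 x hx.1.1
      refine ⟨h0, lt_of_le_of_ne hx.1.2 fun h => ?_⟩
      have h1 := hbd i x h0 h.symm
      have h2 : 0 ≤ w i x - δ * ‖x‖ ^ (-N) := hx.2
      have h3 := norm_pos_iff.2 h0
      have : 0 < δ * ‖x‖ ^ (-N) := by positivity
      linarith
    · rintro x ⟨hx0, hx⟩ i hi
      refine Set.mem_iUnion.2 ⟨i, ⟨?_, hx.le⟩, by simpa using hi⟩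
      have hxp := norm_pos_iff.2 hx0
      have hlt : σ * Real.log ‖x‖ < max τ₀ τ₁ := by
        by_contra! hcon
        have h1 := ht i x hx0 ((hτ₁ ⟨i, rfl⟩).trans ((le_max_right _ _).trans hcon))
        have h2 : ‖x‖ ^ N * (δ * ‖x‖ ^ (-N)) = δ := by
          rw [mul_left_comm, ← Real.rpow_add hxp]; simp
        have h3 : ‖x‖ ^ N * (δ * ‖x‖ ^ (-N)) ≤ ‖x‖ ^ N * w i x :=
          mul_le_mul_of_nonneg_left hi (by positivity)
        linarith
      rw [hA, Set.mem_ofPred_eq, ← Real.le_log_iff_exp_le hxp, ← Real.log_le_iff_le_exp hxp]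
      rcases hσ with rfl | rfl
      · constructor
        · exact (min_le_left _ _).trans (by linarith)
        · exact le_trans (by linarith) (le_max_right _ _)
      · constructor
        · exact (min_le_right _ _).trans (by linarith)
        · exact le_trans (by linarith) (le_max_left _ _)
  · rintro x ⟨hx0, hx⟩ i h1 h2
    have h3 := hΔ x hx0 hx i h1 h2
    have hxp := norm_pos_iff.2 hx0
    simp only [laplacian_norm_rpow _ hx0, hN]
    have h4 : -N * (-N + (2 * N + 2 - 2)) * ‖x‖ ^ (-N) * (‖x‖ ^ 2)⁻¹ * w i x
        = ‖x‖ ^ (-N) * ((‖x‖ ^ 2)⁻¹ * (-N ^ 2 * w i x)) := by ring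
    have h5 : Δ (w i) x = (‖x‖ ^ 2)⁻¹ * (‖x‖ ^ 2 * Δ (w i) x) := by field_simp
    rw [h4, h5]
    gcongr

end Comparison

section Nonlinearity

/-- Coefficients and exponents of a cooperative coupling of homogeneity `p - 1`. -/
structure Coupling (k : ℕ) (p : ℝ) where
  κ : Fin k → Fin k → ℝ
  α : Fin k → Fin k → ℝ
  β : Fin k → Fin k → ℝ
  κ_pos : ∀ i j, 0 < κ i j
  one_lt_α : ∀ i j, 1 < α i j
  one_lt_β : ∀ i j, 1 < β i j
  add_eq : ∀ i j, α i j + β i j = p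

namespace Coupling

variable {k : ℕ} {p : ℝ} (C : Coupling k p)

/-- The nonlinearity of the `i`-th equation. -/
def f (i : Fin k) (V : Fin k → ℝ) : ℝ :=
  ∑ j, C.κ i j * V i ^ (C.α i j - 1) * V j ^ (C.β i j)

/-- A bound for the difference quotients of the nonlinearity. -/
def q (i : Fin k) (V : Fin k → ℝ) : ℝ :=
  ∑ j, C.κ i j * (V i ^ (C.α i j - 2) * V j ^ (C.β i j) + V i ^ (C.α i j - 1) * V j ^ (C.β i j - 1))

/-- The sum of all coupling coefficients. -/
def K : ℝ := ∑ i, ∑ j, C.κ i j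

theorem sum_κ_le_K (i : Fin k) : ∑ j, C.κ i j ≤ C.K :=
  Finset.single_le_sum (f := fun i => ∑ j, C.κ i j)
    (fun i _ => Finset.sum_nonneg fun j _ => (C.κ_pos i j).le) (Finset.mem_univ i)

theorem K_pos (i : Fin k) : 0 < C.K :=
  (Finset.sum_pos (fun j _ => C.κ_pos i j) ⟨i, Finset.mem_univ i⟩).trans_le (C.sum_κ_le_K i)

theorem two_lt {k : ℕ} {p : ℝ} (C : Coupling k p) (i : Fin k) : 2 < p := by
  linarith [C.one_lt_α i i, C.one_lt_β i i, C.add_eq i i]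

variable {V W : Fin k → ℝ}

theorem f_pos (hV : ∀ j, 0 < V j) (i : Fin k) : 0 < C.f i V := by
  refine Finset.sum_pos (fun j _ => ?_) ⟨i, Finset.mem_univ i⟩
  have := hV i; have := hV j; have := C.κ_pos i j
  positivity

theorem term_mono (hV : ∀ j, 0 < V j) (h : ∀ j, V j ≤ W j) (i j : Fin k) :
    C.κ i j * V i ^ (C.α i j - 1) * V j ^ (C.β i j)
      ≤ C.κ i j * W i ^ (C.α i j - 1) * W j ^ (C.β i j) := by
  have h1 := hV i; have h2 := hV j; have h3 := C.κ_pos i j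
  have h4 := C.one_lt_α i j; have h5 := C.one_lt_β i j
  have h6 : V i ^ (C.α i j - 1) ≤ W i ^ (C.α i j - 1) :=
    Real.rpow_le_rpow h1.le (h i) (by linarith)
  have h7 : V j ^ (C.β i j) ≤ W j ^ (C.β i j) := Real.rpow_le_rpow h2.le (h j) (by linarith)
  have h8 : 0 < W i := h1.trans_le (h i)
  gcongr

theorem f_mono (hV : ∀ j, 0 < V j) (h : ∀ j, V j ≤ W j) (i : Fin k) : C.f i V ≤ C.f i W :=
  Finset.sum_le_sum fun j _ => C.term_mono hV h i j

theorem f_strictMono (hV : ∀ j, 0 < V j) (h : ∀ j, V j ≤ W j) {j : Fin k} (hj : V j < W j)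
    (i : Fin k) : C.f i V < C.f i W := by
  refine Finset.sum_lt_sum (fun j _ => C.term_mono hV h i j) ⟨j, Finset.mem_univ j, ?_⟩
  have h1 := hV i; have h2 := hV j; have h3 := C.κ_pos i j
  have h4 := C.one_lt_α i j; have h5 := C.one_lt_β i j
  have h6 : V i ^ (C.α i j - 1) ≤ W i ^ (C.α i j - 1) :=
    Real.rpow_le_rpow h1.le (h i) (by linarith)
  have h7 : V j ^ (C.β i j) < W j ^ (C.β i j) := Real.rpow_lt_rpow h2.le hj (by linarith)
  have h8 : 0 < W i := h1.trans_le (h i)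
  have h10 : 0 < W j := h2.trans_le (h j)
  have h9 : 0 < V i ^ (C.α i j - 1) := by positivity
  exact (mul_lt_mul_of_pos_left h7 (by positivity)).trans_le
    (mul_le_mul_of_nonneg_right (by gcongr) (by positivity))

theorem f_smul (hV : ∀ j, 0 < V j) {c : ℝ} (hc : 0 < c) (i : Fin k) :
    C.f i (fun j => c * V j) = c ^ (p - 1) * C.f i V := by
  rw [f, f, Finset.mul_sum]
  refine Finset.sum_congr rfl fun j _ => ?_
  have : c ^ (p - 1) = c ^ (C.α i j - 1) * c ^ (C.β i j) := by
    rw [← Real.rpow_add hc]; congr 1; linarith [C.add_eq i j]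
  rw [Real.mul_rpow hc.le (hV i).le, Real.mul_rpow hc.le (hV j).le, this]
  ring

theorem f_le (hV : ∀ j, 0 < V j) {m : ℝ} (hm : ∀ j, V j ≤ m) (i : Fin k) :
    C.f i V ≤ C.K * m ^ (p - 1) := by
  have hm0 : 0 < m := (hV i).trans_le (hm i)
  refine (C.f_mono hV hm i).trans ?_
  have h : C.f i (fun _ => m) = (∑ j, C.κ i j) * m ^ (p - 1) := by
    rw [f, Finset.sum_mul]
    refine Finset.sum_congr rfl fun j _ => ?_
    rw [mul_assoc, ← Real.rpow_add hm0]
    congr 2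
    linarith [C.add_eq i j]
  rw [h]
  exact mul_le_mul_of_nonneg_right (C.sum_κ_le_K i) (by positivity)

theorem le_f (hV : ∀ j, 0 < V j) (i : Fin k) : C.κ i i * V i ^ (p - 1) ≤ C.f i V := by
  have h : C.κ i i * V i ^ (p - 1) = C.κ i i * V i ^ (C.α i i - 1) * V i ^ (C.β i i) := by
    rw [mul_assoc, ← Real.rpow_add (hV i)]
    congr 2
    linarith [C.add_eq i i]
  rw [h]
  exact Finset.single_le_sum (f := fun j => C.κ i j * V i ^ (C.α i j - 1) * V j ^ (C.β i j))
    (fun j _ => by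
      have := hV i; have := hV j; have := C.κ_pos i j
      positivity) (Finset.mem_univ i)

theorem _root_.rpow_sub_rpow_le {x y d s p : ℝ} (hx : 0 < x) (hy : 0 < y) (hd : 0 ≤ d)
    (hxy : x - d ≤ y) (hs : 0 < s) (hsp : s ≤ p) (hp : 1 ≤ p) :
    x ^ s - y ^ s ≤ p * x ^ (s - 1) * d := by
  have h0 : 0 ≤ p * x ^ (s - 1) * d := by positivity
  rcases le_total x y with h | h
  · have := Real.rpow_le_rpow hx.le h hs.le
    linarith
  have hxs : x ^ s = x ^ (s - 1) * x := by
    rw [Real.rpow_sub_one hx.ne']; field_simp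
  set t := y / x with ht
  have ht0 : 0 < t := div_pos hy hx
  have ht1 : t ≤ 1 := (div_le_one hx).2 h
  have hyt : y = x * t := by rw [ht]; field_simp
  have hkey : 1 - t ^ s ≤ p * (1 - t) := by
    rcases le_total s 1 with h1 | h1
    · have : t ≤ t ^ s := by
        conv_lhs => rw [← Real.rpow_one t]
        exact Real.rpow_le_rpow_of_exponent_ge ht0 ht1 h1
      nlinarith
    · have := one_add_mul_self_le_rpow_one_add (s := t - 1) (by linarith) h1
      rw [add_sub_cancel] at this
      nlinarith
  have h2 : y ^ s = x ^ s * t ^ s := by rw [hyt, Real.mul_rpow hx.le ht0.le]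
  have hpos : 0 < x ^ (s - 1) := by positivity
  calc x ^ s - y ^ s = x ^ (s - 1) * x * (1 - t ^ s) := by rw [h2, hxs]; ring
    _ ≤ x ^ (s - 1) * x * (p * (1 - t)) := by gcongr
    _ = p * x ^ (s - 1) * (x - y) := by rw [hyt]; ring
    _ ≤ p * x ^ (s - 1) * d := by
      have : x - y ≤ d := by linarith
      have : 0 ≤ p := by linarith
      gcongr

theorem f_sub_le (hV : ∀ j, 0 < V j) (hW : ∀ j, 0 < W j) {d : ℝ} (hd : 0 ≤ d)
    (h : ∀ j, V j - d ≤ W j) (i : Fin k) : C.f i V - C.f i W ≤ p * C.q i V * d := by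
  have hp := C.two_lt i
  rw [f, f, q, ← Finset.sum_sub_distrib, Finset.mul_sum, Finset.sum_mul]
  refine Finset.sum_le_sum fun j _ => ?_
  have hκ := C.κ_pos i j; have hα := C.one_lt_α i j; have hβ := C.one_lt_β i j
  have hs := C.add_eq i j
  have h1 := rpow_sub_rpow_le (s := C.α i j - 1) (p := p) (hV i) (hW i) hd (h i) (by linarith)
    (by linarith) (by linarith)
  have h2 := rpow_sub_rpow_le (s := C.β i j) (p := p) (hV j) (hW j) hd (h j) (by linarith)
    (by linarith) (by linarith)
  rw [show C.α i j - 1 - 1 = C.α i j - 2 by ring] at h1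
  have hVi := hV i; have hVj := hV j; have hWi := hW i; have hWj := hW j
  set A := V i ^ (C.α i j - 1) with hA
  set B := V j ^ (C.β i j) with hB
  set A' := W i ^ (C.α i j - 1)
  set B' := W j ^ (C.β i j)
  set a := V i ^ (C.α i j - 2)
  set b := V j ^ (C.β i j - 1)
  have hA0 : 0 < A := by positivity
  have hB0 : 0 < B := by positivity
  have hA0' : 0 < A' := by positivity
  have hB0' : 0 < B' := by positivity
  have ha0 : 0 < a := by positivity
  have hb0 : 0 < b := by positivity
  have hAA : A * B - A' * B' ≤ p * (a * B + A * b) * d := by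
    have e1 : (A - A') * B ≤ p * a * d * B := by gcongr
    have hpb : 0 ≤ p * b * d := by positivity
    rcases le_total B B' with hBB | hBB
    · have : A' * B ≤ A' * B' := by gcongr
      have : 0 ≤ A * (p * b * d) := by positivity
      nlinarith
    · rcases le_total A A' with hAA | hAA
      · have e2 : A * (B - B') ≤ A * (p * b * d) := by gcongr
        have : A * B' ≤ A' * B' := by gcongr
        have : 0 ≤ p * a * d * B := by positivity
        nlinarith
      · have e2 : A' * (B - B') ≤ A * (p * b * d) :=
          mul_le_mul hAA h2 (by linarith) hA0.le
        nlinarith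
  calc C.κ i j * A * B - C.κ i j * A' * B' = C.κ i j * (A * B - A' * B') := by ring
    _ ≤ C.κ i j * (p * (a * B + A * b) * d) := by gcongr
    _ = _ := by ring

theorem exists_q_le {c c' : ℝ} (hc : 0 < c) (i : Fin k) : ∃ M : ℝ, 0 < M ∧ ∀ m : ℝ, 0 < m →
    ∀ V : Fin k → ℝ, (∀ j, c * m ≤ V j ∧ V j ≤ c' * m) → C.q i V ≤ M * m ^ (p - 2) := by
  by_cases hcc : c' < c
  · refine ⟨1, one_pos, fun m hm V hV => ?_⟩
    have h1 := hV i
    have h2 : c' * m < c * m := by gcongr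
    linarith
  push Not at hcc
  have hc' : 0 < c' := hc.trans_le hcc
  have hbound : ∀ (s m x : ℝ), 0 < m → c * m ≤ x → x ≤ c' * m →
      x ^ s ≤ (c ^ s + c' ^ s) * m ^ s := by
    intro s m x hm h1 h2
    have hx : 0 < x := (mul_pos hc hm).trans_le h1
    rw [add_mul, ← Real.mul_rpow hc.le hm.le, ← Real.mul_rpow hc'.le hm.le]
    have : 0 < (c * m) ^ s := by positivity
    have : 0 < (c' * m) ^ s := by positivity
    rcases le_total 0 s with hs | hs
    · have := Real.rpow_le_rpow hx.le h2 hs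
      linarith
    · have := Real.rpow_le_rpow_of_nonpos (mul_pos hc hm) h1 hs
      linarith
  set g : ℝ → ℝ := fun s => c ^ s + c' ^ s
  have hg : ∀ s, 0 < g s := fun s => by positivity
  refine ⟨∑ j, C.κ i j * (g (C.α i j - 2) * g (C.β i j) + g (C.α i j - 1) * g (C.β i j - 1)),
    Finset.sum_pos (fun j _ => ?_) ⟨i, Finset.mem_univ i⟩, fun m hm V hV => ?_⟩
  · have := C.κ_pos i j
    have := hg (C.α i j - 2); have := hg (C.β i j)
    have := hg (C.α i j - 1); have := hg (C.β i j - 1)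
    positivity
  rw [q, Finset.sum_mul]
  refine Finset.sum_le_sum fun j _ => ?_
  have hκ := C.κ_pos i j
  have hV0 : ∀ j, 0 < V j := fun j => (mul_pos hc hm).trans_le (hV j).1
  have h1 : m ^ (p - 2) = m ^ (C.α i j - 2) * m ^ (C.β i j) := by
    rw [← Real.rpow_add hm]; congr 1; linarith [C.add_eq i j]
  have h2 : m ^ (p - 2) = m ^ (C.α i j - 1) * m ^ (C.β i j - 1) := by
    rw [← Real.rpow_add hm]; congr 1; linarith [C.add_eq i j]
  have b1 := hbound (C.α i j - 2) m _ hm (hV i).1 (hV i).2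
  have b2 := hbound (C.β i j) m _ hm (hV j).1 (hV j).2
  have b3 := hbound (C.α i j - 1) m _ hm (hV i).1 (hV i).2
  have b4 := hbound (C.β i j - 1) m _ hm (hV j).1 (hV j).2
  have hi := hV0 i; have hj := hV0 j
  have e1 : V i ^ (C.α i j - 2) * V j ^ (C.β i j)
      ≤ g (C.α i j - 2) * g (C.β i j) * m ^ (p - 2) := by
    refine (mul_le_mul b1 b2 (by positivity) (by positivity)).trans (le_of_eq ?_)
    rw [h1]; ring
  have e2 : V i ^ (C.α i j - 1) * V j ^ (C.β i j - 1)
      ≤ g (C.α i j - 1) * g (C.β i j - 1) * m ^ (p - 2) := by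
    refine (mul_le_mul b3 b4 (by positivity) (by positivity)).trans (le_of_eq ?_)
    rw [h2]; ring
  rw [mul_assoc, add_mul]
  gcongr

end Coupling

end Nonlinearity

section TwoSidedBounds

open InnerProductSpace Laplacian

variable {n k : ℕ} {p : ℝ}

local notation "E" n => EuclideanSpace ℝ (Fin n)

/-- Positive solutions of the system `-Δ v_i = (N² - Λ²) |x|⁻² v_i + |x|^(N(p-2)-2) f_i(v)` on the
punctured space, written in terms of `|x|^N v`. -/
structure IsSolution (C : Coupling k p) (N Λ : ℝ) (v : Fin k → (E n) → ℝ) : Prop where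
  contDiffAt : ∀ i, ∀ x ≠ 0, ContDiffAt ℝ 2 (v i) x
  pos : ∀ i, ∀ x ≠ 0, 0 < v i x
  laplacian : ∀ i, ∀ x ≠ 0, ‖x‖ ^ 2 * Δ (v i) x
    = -((N ^ 2 - Λ ^ 2) * v i x + ‖x‖ ^ (-N) * C.f i (fun j => ‖x‖ ^ N * v j x))

/-- The function `|x|^N v` tends to zero at the end of the punctured space given by the sign. -/
def DecaysAt (N σ : ℝ) (v : Fin k → (E n) → ℝ) : Prop :=
  ∀ δ > 0, ∃ τ, ∀ i, ∀ x ≠ 0, τ ≤ σ * Real.log ‖x‖ → ‖x‖ ^ N * v i x < δ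

theorem sq_mul_laplacian_norm_rpow {N σ : ℝ} (hN : (n : ℝ) = 2 * N + 2) (hσ : σ = 1 ∨ σ = -1)
    (μ : ℝ) {x : E n} (hx : x ≠ 0) :
    ‖x‖ ^ 2 * Δ (fun y : E n => ‖y‖ ^ (-N - σ * μ)) x
      = (μ ^ 2 - N ^ 2) * ‖x‖ ^ (-N - σ * μ) := by
  have hxp := norm_pos_iff.2 hx
  rw [laplacian_norm_rpow _ hx, hN]
  have h : (-N - σ * μ) * (-N - σ * μ + (2 * N + 2 - 2)) = μ ^ 2 - N ^ 2 := by
    rcases hσ with rfl | rfl <;> ring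
  rw [h]
  field_simp

theorem norm_rpow_mul_norm_rpow (N σ μ : ℝ) {x : E n} (hx : x ≠ 0) :
    ‖x‖ ^ N * ‖x‖ ^ (-N - σ * μ) = Real.exp (-(μ * (σ * Real.log ‖x‖))) := by
  have hxp := norm_pos_iff.2 hx
  rw [← Real.rpow_add hxp, Real.rpow_def_of_pos hxp]
  congr 1
  ring

theorem norm_rpow_mul_norm_rpow_neg (N : ℝ) {x : E n} (hx : x ≠ 0) :
    ‖x‖ ^ N * ‖x‖ ^ (-N) = 1 := by
  rw [← Real.rpow_add (norm_pos_iff.2 hx)]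
  simp

namespace IsSolution

variable {C : Coupling k p} {N Λ : ℝ} {v : Fin k → (E n) → ℝ}

theorem pos_rpow_mul (hv : IsSolution C N Λ v) (i : Fin k) {x : E n} (hx : x ≠ 0) :
    0 < ‖x‖ ^ N * v i x :=
  mul_pos (Real.rpow_pos_of_pos (norm_pos_iff.2 hx) _) (hv.pos i x hx)

/-- At a point where the `i`-th component is the largest one, the equation is scalar. -/
theorem le_laplacian_of_max (hv : IsSolution C N Λ v) {i : Fin k} {x : E n} (hx : x ≠ 0)
    (hmax : ∀ j, v j x ≤ v i x) : (Λ ^ 2 - N ^ 2) * v i x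
      - C.K * (‖x‖ ^ (-N) * (‖x‖ ^ N * v i x) ^ (p - 1)) ≤ ‖x‖ ^ 2 * Δ (v i) x := by
  have hxp := norm_pos_iff.2 hx
  rw [hv.laplacian i x hx]
  have h := C.f_le (V := fun j => ‖x‖ ^ N * v j x) (fun j => hv.pos_rpow_mul j hx)
    (m := ‖x‖ ^ N * v i x) (fun j => mul_le_mul_of_nonneg_left (hmax j) (by positivity)) i
  have h2 : ‖x‖ ^ (-N) * C.f i (fun j => ‖x‖ ^ N * v j x)
      ≤ ‖x‖ ^ (-N) * (C.K * (‖x‖ ^ N * v i x) ^ (p - 1)) :=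
    mul_le_mul_of_nonneg_left h (by positivity)
  linarith

theorem exists_weak_decay (hv : IsSolution C N Λ v) (hN : (n : ℝ) = 2 * N + 2) {σ : ℝ}
    (hσ : σ = 1 ∨ σ = -1) (hd : DecaysAt N σ v) {μ : ℝ} (hμ : 0 < μ) (hμΛ : μ < Λ) (i₀ : Fin k) :
    ∃ A > 0, ∃ τ₀ ≥ 0, ∀ i, ∀ x ≠ 0, τ₀ ≤ σ * Real.log ‖x‖ →
      ‖x‖ ^ N * v i x ≤ A * Real.exp (-(μ * (σ * Real.log ‖x‖))) := by
  have hK := C.K_pos i₀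
  have hp := C.two_lt i₀
  have hgap : 0 < Λ ^ 2 - μ ^ 2 := by nlinarith
  set δ := ((Λ ^ 2 - μ ^ 2) / C.K) ^ (1 / (p - 2)) with hδdef
  have hδ : 0 < δ := by positivity
  have hδK : C.K * δ ^ (p - 2) = Λ ^ 2 - μ ^ 2 := by
    rw [hδdef, ← Real.rpow_mul (by positivity), one_div, inv_mul_cancel₀ (by linarith),
      Real.rpow_one]
    field_simp
  obtain ⟨τ, hτ⟩ := hd δ hδ
  set τ₀ := max τ 0
  have hτ₀ : 0 ≤ τ₀ := le_max_right _ _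
  have hdec : ∀ i, ∀ x : E n, x ≠ 0 → τ₀ ≤ σ * Real.log ‖x‖ → ‖x‖ ^ N * v i x < δ :=
    fun i x hx h => hτ i x hx ((le_max_left _ _).trans h)
  set A := δ * Real.exp (μ * τ₀)
  have hA : 0 < A := by positivity
  have hB : ∀ x : E n, x ≠ 0 → ‖x‖ ^ N * (A * ‖x‖ ^ (-N - σ * μ))
      = A * Real.exp (-(μ * (σ * Real.log ‖x‖))) := fun x hx => by
    rw [mul_left_comm, norm_rpow_mul_norm_rpow N σ μ hx]
  have hcB : ∀ x : E n, x ≠ 0 → ContDiffAt ℝ 2 (fun y : E n => A * ‖y‖ ^ (-N - σ * μ)) x :=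
    fun x hx => contDiffAt_const.mul (contDiffAt_norm_rpow _ hx)
  have hbd : ∀ i, ∀ x : E n, x ≠ 0 → σ * Real.log ‖x‖ = τ₀ →
      v i x - A * ‖x‖ ^ (-N - σ * μ) ≤ 0 := by
    intro i x hx h
    have hxp := norm_pos_iff.2 hx
    have h1 := hdec i x hx h.ge
    have h2 := hB x hx
    have hAδ : A * Real.exp (-(μ * τ₀)) = δ := by
      rw [mul_assoc δ, ← Real.exp_add, add_neg_cancel, Real.exp_zero, mul_one]
    rw [h, hAδ] at h2
    rw [← h2] at h1
    have := (mul_lt_mul_iff_right₀ (Real.rpow_pos_of_pos hxp N)).1 h1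
    linarith
  refine ⟨A, hA, τ₀, hτ₀, fun i x hx h => ?_⟩
  have key := nonpos_of_radial_end hN hσ (τ₀ := τ₀)
    (w := fun i => fun x => v i x - A * ‖x‖ ^ (-N - σ * μ))
    (fun i x hx _ => (hv.contDiffAt i x hx).sub (hcB x hx)) hbd ?_ ?_
  · have hle : v i x - A * ‖x‖ ^ (-N - σ * μ) ≤ 0 := by
      rcases h.eq_or_lt with h | h
      · exact hbd i x hx h.symm
      · exact key x hx h i
    have hxp := norm_pos_iff.2 hx
    rw [← hB x hx]
    exact mul_le_mul_of_nonneg_left (by linarith) (by positivity)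
  · intro i ε hε
    obtain ⟨τ₁, hτ₁⟩ := hd ε hε
    refine ⟨τ₁, fun x hx h => lt_of_le_of_lt ?_ (hτ₁ i x hx h)⟩
    have hxp := norm_pos_iff.2 hx
    have : 0 ≤ A * ‖x‖ ^ (-N - σ * μ) := by positivity
    exact mul_le_mul_of_nonneg_left (by linarith) (by positivity)
  · intro x hx h i hwi hmax
    have hxp := norm_pos_iff.2 hx
    have h1 := hv.le_laplacian_of_max hx (i := i) (fun j => by linarith [hmax j])
    have h2 : Δ (fun x => v i x - A * ‖x‖ ^ (-N - σ * μ)) x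
        = Δ (v i) x - A * Δ (fun y : E n => ‖y‖ ^ (-N - σ * μ)) x := by
      have e1 := (hv.contDiffAt i x hx).laplacian_sub (hcB x hx)
      have e2 := laplacian_smul A (contDiffAt_norm_rpow (-N - σ * μ) hx)
      exact e1.trans (congrArg _ e2)
    have h3 := sq_mul_laplacian_norm_rpow hN hσ μ hx
    have hφ := hv.pos_rpow_mul i hx
    have h4 : C.K * (‖x‖ ^ (-N) * (‖x‖ ^ N * v i x) ^ (p - 1)) ≤ (Λ ^ 2 - μ ^ 2) * v i x := by
      have e1 : (‖x‖ ^ N * v i x) ^ (p - 1) = (‖x‖ ^ N * v i x) ^ (p - 2) * (‖x‖ ^ N * v i x) := by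
        rw [← Real.rpow_add_one hφ.ne']
        congr 1; ring
      have e2 : (‖x‖ ^ N * v i x) ^ (p - 2) ≤ δ ^ (p - 2) :=
        Real.rpow_le_rpow hφ.le (hdec i x hx h.le).le (by linarith)
      have e3 : C.K * (‖x‖ ^ (-N) * (‖x‖ ^ N * v i x) ^ (p - 1))
          = C.K * (‖x‖ ^ N * v i x) ^ (p - 2) * v i x := by
        rw [e1]
        linear_combination (C.K * (‖x‖ ^ N * v i x) ^ (p - 2) * v i x)
          * norm_rpow_mul_norm_rpow_neg N hx
      rw [e3, ← hδK]
      have := hv.pos i x hx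
      gcongr
    have h5 : ‖x‖ ^ 2 * Δ (fun x => v i x - A * ‖x‖ ^ (-N - σ * μ)) x
        = ‖x‖ ^ 2 * Δ (v i) x - A * ((μ ^ 2 - N ^ 2) * ‖x‖ ^ (-N - σ * μ)) := by
      rw [h2, ← h3]
      ring
    rw [h5]
    nlinarith [mul_pos (sq_pos_of_pos hμ) hwi]

theorem exists_sharp_decay (hv : IsSolution C N Λ v) (hN : (n : ℝ) = 2 * N + 2) {σ : ℝ}
    (hσ : σ = 1 ∨ σ = -1) (hd : DecaysAt N σ v) (hΛ : 0 < Λ) (i₀ : Fin k) :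
    ∃ A > 0, ∃ τ₀ ≥ 0, ∀ i, ∀ x ≠ 0, τ₀ ≤ σ * Real.log ‖x‖ →
      ‖x‖ ^ N * v i x ≤ A * Real.exp (-(Λ * (σ * Real.log ‖x‖))) := by
  have hK := C.K_pos i₀
  have hp := C.two_lt i₀
  set μ := Λ * (1 + 1 / (p - 1)) / 2 with hμdef
  have hinv : 1 / (p - 1) < 1 := by rw [div_lt_one] <;> linarith
  have hinv0 : 0 < 1 / (p - 1) := by apply one_div_pos.2; linarith
  have hμ : 0 < μ := by positivity
  have hμΛ : μ < Λ := by rw [hμdef]; nlinarith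
  obtain ⟨Λ', hΛ'⟩ : ∃ Λ', Λ' = (p - 1) * μ := ⟨_, rfl⟩
  have hΛΛ' : Λ < Λ' := by
    have : Λ' = Λ * p / 2 := by
      rw [hΛ', hμdef]
      have : p - 1 ≠ 0 := by linarith
      field_simp
      ring
    nlinarith
  obtain ⟨A, hA, τ₀, hτ₀, hdec⟩ := hv.exists_weak_decay hN hσ hd hμ hμΛ i₀
  have hgap : 0 < Λ' ^ 2 - Λ ^ 2 := by nlinarith
  set D := 2 * A * Real.exp (Λ * τ₀) + 2 * (C.K * A ^ (p - 1)) / (Λ' ^ 2 - Λ ^ 2) with hD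
  have hDpos : 0 < D := by positivity
  have hD1 : 2 * A * Real.exp (Λ * τ₀) ≤ D := le_add_of_nonneg_right (by positivity)
  have hD2 : C.K * A ^ (p - 1) ≤ D / 2 * (Λ' ^ 2 - Λ ^ 2) := by
    have h1 : 2 * (C.K * A ^ (p - 1)) / (Λ' ^ 2 - Λ ^ 2) ≤ D :=
      le_add_of_nonneg_left (by positivity)
    rw [div_le_iff₀ hgap] at h1
    linarith
  set B : (E n) → ℝ := fun x => D * ‖x‖ ^ (-N - σ * Λ) - D / 2 * ‖x‖ ^ (-N - σ * Λ') with hBdef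
  have hB : ∀ x : E n, x ≠ 0 → ‖x‖ ^ N * B x
      = D * Real.exp (-(Λ * (σ * Real.log ‖x‖)))
        - D / 2 * Real.exp (-(Λ' * (σ * Real.log ‖x‖))) := fun x hx => by
    rw [← norm_rpow_mul_norm_rpow N σ Λ hx, ← norm_rpow_mul_norm_rpow N σ Λ' hx, hBdef]
    ring
  have hc : ∀ (D μ : ℝ) (x : E n), x ≠ 0 →
      ContDiffAt ℝ 2 (fun y : E n => D * ‖y‖ ^ (-N - σ * μ)) x :=
    fun D μ x hx => contDiffAt_const.mul (contDiffAt_norm_rpow _ hx)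
  have hcB : ∀ x : E n, x ≠ 0 → ContDiffAt ℝ 2 B x :=
    fun x hx => (hc D Λ x hx).sub (hc (D / 2) Λ' x hx)
  have hBlow : ∀ x : E n, x ≠ 0 → 0 ≤ σ * Real.log ‖x‖ →
      D / 2 * Real.exp (-(Λ * (σ * Real.log ‖x‖))) ≤ ‖x‖ ^ N * B x := by
    intro x hx h
    have : Real.exp (-(Λ' * (σ * Real.log ‖x‖))) ≤ Real.exp (-(Λ * (σ * Real.log ‖x‖))) := by
      gcongr
    rw [hB x hx]
    nlinarith
  have hbd : ∀ i, ∀ x : E n, x ≠ 0 → σ * Real.log ‖x‖ = τ₀ → v i x - B x ≤ 0 := by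
    intro i x hx h
    have hxp := norm_pos_iff.2 hx
    have h1 := hdec i x hx h.ge
    have h2 := hBlow x hx (by rw [h]; exact hτ₀)
    rw [h] at h1 h2
    have h3 : A * Real.exp (-(μ * τ₀)) ≤ D / 2 * Real.exp (-(Λ * τ₀)) := by
      have e1 : Real.exp (-(μ * τ₀)) ≤ 1 := by
        rw [Real.exp_le_one_iff]
        have : 0 ≤ μ * τ₀ := by positivity
        linarith
      have e2 : Real.exp (Λ * τ₀) * Real.exp (-(Λ * τ₀)) = 1 := by
        rw [← Real.exp_add]; simp
      have e3 : A * Real.exp (Λ * τ₀) * Real.exp (-(Λ * τ₀)) ≤ D / 2 * Real.exp (-(Λ * τ₀)) := by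
        gcongr
        linarith
      rw [mul_assoc, e2] at e3
      nlinarith
    have := (mul_le_mul_iff_right₀ (Real.rpow_pos_of_pos hxp N)).1 ((h1.trans h3).trans h2)
    linarith
  refine ⟨D, hDpos, τ₀, hτ₀, fun i x hx h => ?_⟩
  have key := nonpos_of_radial_end hN hσ (τ₀ := τ₀) (w := fun i => fun x => v i x - B x)
    (fun i x hx _ => (hv.contDiffAt i x hx).sub (hcB x hx)) hbd ?_ ?_
  · have hle : v i x - B x ≤ 0 := by
      rcases h.eq_or_lt with h | h
      · exact hbd i x hx h.symm
      · exact key x hx h i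
    have hxp := norm_pos_iff.2 hx
    have h1 : ‖x‖ ^ N * v i x ≤ ‖x‖ ^ N * B x :=
      mul_le_mul_of_nonneg_left (by linarith) (by positivity)
    rw [hB x hx] at h1
    have : 0 < D / 2 * Real.exp (-(Λ' * (σ * Real.log ‖x‖))) := by positivity
    linarith
  · intro i ε hε
    obtain ⟨τ₁, hτ₁⟩ := hd ε hε
    refine ⟨max τ₁ 0, fun x hx h => lt_of_le_of_lt ?_ (hτ₁ i x hx ((le_max_left _ _).trans h))⟩
    have hxp := norm_pos_iff.2 hx
    have h1 := hBlow x hx ((le_max_right _ _).trans h)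
    have : 0 ≤ D / 2 * Real.exp (-(Λ * (σ * Real.log ‖x‖))) := by positivity
    rw [mul_sub]
    linarith
  · intro x hx h i hwi hmax
    have hxp := norm_pos_iff.2 hx
    have h1 := hv.le_laplacian_of_max hx (i := i) (fun j => by linarith [hmax j])
    have h2 : Δ (fun x => v i x - B x) x
        = Δ (v i) x - (D * Δ (fun y : E n => ‖y‖ ^ (-N - σ * Λ)) x
          - D / 2 * Δ (fun y : E n => ‖y‖ ^ (-N - σ * Λ')) x) := by
      have e1 := (hv.contDiffAt i x hx).laplacian_sub (hcB x hx)
      have e2 := (hc D Λ x hx).laplacian_sub (hc (D / 2) Λ' x hx)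
      have e3 := laplacian_smul D (contDiffAt_norm_rpow (-N - σ * Λ) hx)
      have e4 := laplacian_smul (D / 2) (contDiffAt_norm_rpow (-N - σ * Λ') hx)
      exact e1.trans (congrArg _ (e2.trans (congrArg₂ _ e3 e4)))
    have h3 := sq_mul_laplacian_norm_rpow hN hσ Λ hx
    have h3' := sq_mul_laplacian_norm_rpow hN hσ Λ' hx
    have hφ := hv.pos_rpow_mul i hx
    have h4 : C.K * (‖x‖ ^ (-N) * (‖x‖ ^ N * v i x) ^ (p - 1))
        ≤ D / 2 * (Λ' ^ 2 - Λ ^ 2) * ‖x‖ ^ (-N - σ * Λ') := by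
      have e2 : (‖x‖ ^ N * v i x) ^ (p - 1)
          ≤ (A * Real.exp (-(μ * (σ * Real.log ‖x‖)))) ^ (p - 1) :=
        Real.rpow_le_rpow hφ.le (hdec i x hx h.le) (by linarith)
      rw [Real.mul_rpow hA.le (Real.exp_pos _).le, ← Real.exp_mul] at e2
      have e3 : ‖x‖ ^ (-N - σ * Λ')
          = ‖x‖ ^ (-N) * Real.exp (-(μ * (σ * Real.log ‖x‖)) * (p - 1)) := by
        rw [Real.rpow_def_of_pos hxp, Real.rpow_def_of_pos hxp, ← Real.exp_add, hΛ']
        congr 1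
        ring
      rw [e3]
      calc C.K * (‖x‖ ^ (-N) * (‖x‖ ^ N * v i x) ^ (p - 1))
          ≤ C.K * (‖x‖ ^ (-N) * (A ^ (p - 1)
            * Real.exp (-(μ * (σ * Real.log ‖x‖)) * (p - 1)))) := by gcongr
        _ = C.K * A ^ (p - 1) * (‖x‖ ^ (-N)
            * Real.exp (-(μ * (σ * Real.log ‖x‖)) * (p - 1))) := by ring
        _ ≤ _ := by gcongr
    have h5 : ‖x‖ ^ 2 * Δ (fun x => v i x - B x) x = ‖x‖ ^ 2 * Δ (v i) x
        - (Λ ^ 2 - N ^ 2) * B x + D / 2 * (Λ' ^ 2 - Λ ^ 2) * ‖x‖ ^ (-N - σ * Λ') := by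
      rw [h2, hBdef]
      linear_combination (-D) * h3 + (D / 2) * h3'
    rw [h5]
    nlinarith [mul_pos (sq_pos_of_pos hΛ) hwi]

theorem exists_lower_bound (hv : IsSolution C N Λ v) (hN : (n : ℝ) = 2 * N + 2) {σ : ℝ}
    (hσ : σ = 1 ∨ σ = -1) (hΛ : 0 < Λ) (i₀ : Fin k) :
    ∃ c > 0, ∀ i, ∀ x ≠ 0, 0 ≤ σ * Real.log ‖x‖ →
      c * Real.exp (-(Λ * (σ * Real.log ‖x‖))) ≤ ‖x‖ ^ N * v i x := by
  obtain ⟨c, hc, hcv⟩ : ∃ c > 0, ∀ i, ∀ x : E n, ‖x‖ = 1 → c ≤ v i x := by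
    have h : ∀ i, ∃ c > 0, ∀ x : E n, ‖x‖ = 1 → c ≤ v i x := by
      intro i
      have hS : IsCompact (Metric.sphere (0 : E n) 1) := isCompact_sphere 0 1
      have h0 : ∀ x ∈ Metric.sphere (0 : E n) 1, x ≠ 0 := fun x hx h => by
        simp [h] at hx
      rcases (Metric.sphere (0 : E n) 1).eq_empty_or_nonempty with hE | hE
      · refine ⟨1, one_pos, fun x hx => ?_⟩
        have : x ∈ Metric.sphere (0 : E n) 1 := by simpa using hx
        simp [hE] at this
      · obtain ⟨z, hz, hmin⟩ := hS.exists_isMinOn hE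
          (fun x hx => (hv.contDiffAt i x (h0 x hx)).continuousAt.continuousWithinAt)
        exact ⟨v i z, hv.pos i z (h0 z hz), fun x hx => hmin (by simpa using hx)⟩
    choose c hc hcv using h
    obtain ⟨i₁, -, hi₁⟩ := Finset.exists_min_image Finset.univ c ⟨i₀, Finset.mem_univ _⟩
    exact ⟨c i₁, hc i₁, fun i x hx => (hi₁ i (Finset.mem_univ i)).trans (hcv i x hx)⟩
  have hB : ∀ x : E n, x ≠ 0 → ‖x‖ ^ N * (c * ‖x‖ ^ (-N - σ * Λ))
      = c * Real.exp (-(Λ * (σ * Real.log ‖x‖))) := fun x hx => by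
    rw [mul_left_comm, norm_rpow_mul_norm_rpow N σ Λ hx]
  have hcB : ∀ x : E n, x ≠ 0 → ContDiffAt ℝ 2 (fun y : E n => c * ‖y‖ ^ (-N - σ * Λ)) x :=
    fun x hx => contDiffAt_const.mul (contDiffAt_norm_rpow _ hx)
  have hbd : ∀ i, ∀ x : E n, x ≠ 0 → σ * Real.log ‖x‖ = 0 →
      c * ‖x‖ ^ (-N - σ * Λ) - v i x ≤ 0 := by
    intro i x hx h
    have hσ0 : σ ≠ 0 := by rcases hσ with rfl | rfl <;> norm_num
    have h1 : ‖x‖ = 1 := by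
      have h2 := (mul_eq_zero.1 h).resolve_left hσ0
      exact Real.eq_one_of_pos_of_log_eq_zero (norm_pos_iff.2 hx) h2
    rw [h1, Real.one_rpow]
    linarith [hcv i x h1]
  refine ⟨c, hc, fun i x hx h => ?_⟩
  have key := nonpos_of_radial_end hN hσ (τ₀ := 0)
    (w := fun i => fun x => c * ‖x‖ ^ (-N - σ * Λ) - v i x)
    (fun i x hx _ => (hcB x hx).sub (hv.contDiffAt i x hx)) hbd ?_ ?_
  · have hle : c * ‖x‖ ^ (-N - σ * Λ) - v i x ≤ 0 := by
      rcases h.eq_or_lt with h | h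
      · exact hbd i x hx h.symm
      · exact key x hx h i
    have hxp := norm_pos_iff.2 hx
    rw [← hB x hx]
    exact mul_le_mul_of_nonneg_left (by linarith) (by positivity)
  · intro i ε hε
    refine ⟨(Real.log c - Real.log ε + 1) / Λ, fun x hx h => ?_⟩
    rw [div_le_iff₀ hΛ] at h
    have h1 : c * Real.exp (-(Λ * (σ * Real.log ‖x‖))) < ε := by
      rw [← Real.exp_log hc, ← Real.exp_add]
      conv_rhs => rw [← Real.exp_log hε]
      rw [Real.exp_lt_exp]
      linarith
    have h2 := hv.pos_rpow_mul i hx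
    rw [mul_sub, hB x hx]
    linarith
  · intro x hx h i hwi hmax
    have hxp := norm_pos_iff.2 hx
    have h2 : Δ (fun x => c * ‖x‖ ^ (-N - σ * Λ) - v i x) x
        = c * Δ (fun y : E n => ‖y‖ ^ (-N - σ * Λ)) x - Δ (v i) x := by
      have e1 := (hcB x hx).laplacian_sub (hv.contDiffAt i x hx)
      have e2 := laplacian_smul c (contDiffAt_norm_rpow (-N - σ * Λ) hx)
      exact e1.trans (congrArg (· - Δ (v i) x) e2)
    have h3 := sq_mul_laplacian_norm_rpow hN hσ Λ hx
    have h4 := hv.laplacian i x hx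
    have h5 : 0 < ‖x‖ ^ (-N) * C.f i (fun j => ‖x‖ ^ N * v j x) :=
      mul_pos (by positivity) (C.f_pos (fun j => hv.pos_rpow_mul j hx) i)
    have h6 : ‖x‖ ^ 2 * Δ (fun x => c * ‖x‖ ^ (-N - σ * Λ) - v i x) x
        = c * ((Λ ^ 2 - N ^ 2) * ‖x‖ ^ (-N - σ * Λ)) - ‖x‖ ^ 2 * Δ (v i) x := by
      rw [h2, ← h3]
      ring
    rw [h6, h4]
    nlinarith [mul_pos (sq_pos_of_pos hΛ) hwi]

/-- Sharp two-sided bounds in terms of the logarithmic radius. -/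
theorem exists_bounds (hv : IsSolution C N Λ v) (hN : (n : ℝ) = 2 * N + 2) (hΛ : 0 < Λ)
    (hd : ∀ σ : ℝ, σ = 1 ∨ σ = -1 → DecaysAt N σ v) (i₀ : Fin k) :
    ∃ c > 0, ∃ c' > 0, ∀ i, ∀ x ≠ 0,
      c * Real.exp (-(Λ * |Real.log ‖x‖|)) ≤ ‖x‖ ^ N * v i x ∧
      ‖x‖ ^ N * v i x ≤ c' * Real.exp (-(Λ * |Real.log ‖x‖|)) := by
  obtain ⟨c₁, hc₁, h₁⟩ := hv.exists_lower_bound hN (Or.inl rfl) hΛ i₀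
  obtain ⟨c₂, hc₂, h₂⟩ := hv.exists_lower_bound hN (Or.inr rfl) hΛ i₀
  obtain ⟨A₁, hA₁, τ₁, hτ₁, h₁'⟩ := hv.exists_sharp_decay hN (Or.inl rfl) (hd 1 (Or.inl rfl)) hΛ i₀
  obtain ⟨A₂, hA₂, τ₂, hτ₂, h₂'⟩ :=
    hv.exists_sharp_decay hN (Or.inr rfl) (hd (-1) (Or.inr rfl)) hΛ i₀
  obtain ⟨M, hM, hbd⟩ : ∃ M > 0, ∀ i, ∀ x : E n, x ≠ 0 → -τ₂ ≤ Real.log ‖x‖ →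
      Real.log ‖x‖ ≤ τ₁ → ‖x‖ ^ N * v i x ≤ M := by
    have h : ∀ i, ∃ M, ∀ x : E n, x ≠ 0 → -τ₂ ≤ Real.log ‖x‖ →
        Real.log ‖x‖ ≤ τ₁ → ‖x‖ ^ N * v i x ≤ M := by
      intro i
      have hcomp := isCompact_annulus (n := n) (Real.exp (-τ₂)) (Real.exp τ₁)
      obtain ⟨M, hM⟩ := hcomp.bddAbove_image (f := fun x => ‖x‖ ^ N * v i x) (fun x hx => by
        have hx0 : x ≠ 0 := norm_pos_iff.1 ((Real.exp_pos _).trans_le hx.1)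
        exact ((contDiffAt_norm_rpow N hx0).continuousAt.mul
          (hv.contDiffAt i x hx0).continuousAt).continuousWithinAt)
      refine ⟨M, fun x hx h1 h2 => hM ⟨x, ⟨?_, ?_⟩, rfl⟩⟩
      · rwa [← Real.le_log_iff_exp_le (norm_pos_iff.2 hx)]
      · rwa [← Real.log_le_iff_le_exp (norm_pos_iff.2 hx)]
    choose M hM using h
    refine ⟨∑ i, |M i| + 1, by positivity, fun i x hx h1 h2 => (hM i x hx h1 h2).trans ?_⟩
    have := Finset.single_le_sum (f := fun i => |M i|) (fun i _ => abs_nonneg _)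
      (Finset.mem_univ i)
    have := le_abs_self (M i)
    linarith
  refine ⟨min c₁ c₂, lt_min hc₁ hc₂, A₁ + A₂ + M * Real.exp (Λ * (τ₁ + τ₂)), by positivity,
    fun i x hx => ⟨?_, ?_⟩⟩
  · rcases le_total 0 (Real.log ‖x‖) with h | h
    · rw [abs_of_nonneg h]
      have := h₁ i x hx (by linarith)
      rw [one_mul] at this
      refine le_trans ?_ this
      gcongr
      exact min_le_left _ _
    · rw [abs_of_nonpos h]
      have := h₂ i x hx (by linarith)
      rw [neg_one_mul] at this
      refine le_trans ?_ this
      gcongr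
      exact min_le_right _ _
  · have hsum : ∀ y, (A₁ + A₂ + M * Real.exp (Λ * (τ₁ + τ₂))) * y
      = A₁ * y + A₂ * y + M * Real.exp (Λ * (τ₁ + τ₂)) * y := fun y => by ring
    have hy := Real.exp_pos (-(Λ * |Real.log ‖x‖|))
    have p1 := mul_pos hA₁ hy
    have p2 := mul_pos hA₂ hy
    have p3 : 0 < M * Real.exp (Λ * (τ₁ + τ₂)) * Real.exp (-(Λ * |Real.log ‖x‖|)) := by positivity
    rw [hsum]
    rcases le_total τ₁ (Real.log ‖x‖) with h | h
    · have h3 := h₁' i x hx (by linarith)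
      rw [one_mul] at h3
      rw [abs_of_nonneg (hτ₁.trans h)] at *
      linarith
    · rcases le_total (-τ₂) (Real.log ‖x‖) with h' | h'
      · have h3 := hbd i x hx h' h
        have h4 : 1 ≤ Real.exp (Λ * (τ₁ + τ₂)) * Real.exp (-(Λ * |Real.log ‖x‖|)) := by
          rw [← Real.exp_add, Real.one_le_exp_iff]
          have : |Real.log ‖x‖| ≤ τ₁ + τ₂ := abs_le.2 ⟨by linarith, by linarith⟩
          nlinarith
        nlinarith
      · have h3 := h₂' i x hx (by linarith)
        rw [neg_one_mul] at h3
        rw [abs_of_nonpos (h'.trans (by linarith))] at *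
        linarith

end IsSolution

end TwoSidedBounds

section Mirror

open InnerProductSpace Laplacian

variable {n : ℕ}

local notation "E" n => EuclideanSpace ℝ (Fin n)

/-- Reflection in the hyperplane `⟨x, e⟩ = μ`. -/
def mirror (e : E n) (μ : ℝ) (x : E n) : E n := x - (2 * (inner ℝ x e - μ)) • e

variable {e : E n}

theorem inner_mirror (he : ‖e‖ = 1) (μ : ℝ) (x : E n) :
    inner ℝ (mirror e μ x) e = 2 * μ - inner ℝ x e := by
  rw [mirror, inner_sub_left, real_inner_smul_left, real_inner_self_eq_norm_sq, he]
  ring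

theorem mirror_mirror (he : ‖e‖ = 1) (μ : ℝ) (x : E n) : mirror e μ (mirror e μ x) = x := by
  rw [mirror, inner_mirror he, mirror, sub_sub, ← add_smul]
  ring_nf
  simp

theorem norm_sq_mirror (he : ‖e‖ = 1) (μ : ℝ) (x : E n) :
    ‖mirror e μ x‖ ^ 2 = ‖x‖ ^ 2 - 4 * μ * (inner ℝ x e - μ) := by
  rw [mirror, norm_sub_sq_real, real_inner_smul_right, norm_smul, he, Real.norm_eq_abs, mul_one,
    sq_abs]
  ring

theorem norm_mirror_lt (he : ‖e‖ = 1) {μ : ℝ} (hμ : 0 < μ) {x : E n} (hx : μ < inner ℝ x e) :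
    ‖mirror e μ x‖ < ‖x‖ := by
  refine lt_of_pow_lt_pow_left₀ 2 (norm_nonneg _) ?_
  rw [norm_sq_mirror he]
  nlinarith [mul_pos hμ (sub_pos.2 hx)]

theorem norm_mirror_sub_mirror (he : ‖e‖ = 1) (μ ν : ℝ) (x : E n) :
    ‖mirror e μ x - mirror e ν x‖ = 2 * |μ - ν| := by
  have : mirror e μ x - mirror e ν x = (2 * (μ - ν)) • e := by
    rw [mirror, mirror, sub_sub_sub_cancel_left, ← sub_smul]
    congr 1
    ring
  rw [this, norm_smul, he, Real.norm_eq_abs, abs_mul, abs_two, mul_one]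

theorem continuous_mirror (e : E n) : Continuous fun z : ℝ × E n => mirror e z.1 z.2 := by
  unfold mirror
  fun_prop

theorem contDiff_inner_const (e : E n) : ContDiff ℝ 2 fun x : E n => (inner ℝ x e : ℝ) :=
  contDiff_id.inner ℝ contDiff_const

theorem contDiff_mirror (e : E n) (μ : ℝ) : ContDiff ℝ 2 (mirror e μ) := by
  have := contDiff_inner_const e
  unfold mirror
  fun_prop

theorem mirror_eq_similarity (he : ‖e‖ = 1) (μ : ℝ) (x : E n) :
    mirror e μ x = (2 * μ) • e + (1 : ℝ) • (ℝ ∙ e)ᗮ.reflection x := by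
  rw [Submodule.reflection_orthogonal_apply, Submodule.reflection_singleton_apply, mirror, he,
    real_inner_comm]
  simp only [RCLike.ofReal_real_eq_id, id, one_pow, div_one, one_smul, neg_sub, mul_sub, sub_smul,
    two_smul, two_mul, add_smul]
  abel

theorem ContDiffAt.comp_mirror {f : (E n) → ℝ} {μ : ℝ} {x : E n}
    (hf : ContDiffAt ℝ 2 f (mirror e μ x)) : ContDiffAt ℝ 2 (fun y => f (mirror e μ y)) x :=
  hf.comp x (contDiff_mirror e μ).contDiffAt

theorem laplacian_comp_mirror (he : ‖e‖ = 1) {f : (E n) → ℝ} {μ : ℝ} {x : E n}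
    (hf : ContDiffAt ℝ 2 f (mirror e μ x)) :
    Δ (fun y => f (mirror e μ y)) x = Δ f (mirror e μ x) := by
  simp only [mirror_eq_similarity he] at hf ⊢
  rw [laplacian_comp_similarity _ _ _ hf]
  ring

theorem hasFDerivAt_comp_inner {g : ℝ → ℝ} {d : ℝ} (e x : E n)
    (hg : HasDerivAt g d (inner ℝ x e)) :
    HasFDerivAt (fun y : E n => g (inner ℝ y e)) (d • innerSL ℝ e) x := by
  have h : HasFDerivAt (fun y : E n => (inner ℝ y e : ℝ)) (innerSL ℝ e) x := by
    have := (innerSL ℝ e).hasFDerivAt (x := x)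
    refine this.congr_of_eventuallyEq (Eventually.of_forall fun y => ?_)
    simp [real_inner_comm]
  exact hg.comp_hasFDerivAt x h

theorem laplacian_comp_inner (he : ‖e‖ = 1) {g g' : ℝ → ℝ} {d : ℝ} {x : E n}
    (hg : ∀ s, HasDerivAt g (g' s) s) (hg' : HasDerivAt g' d (inner ℝ x e)) :
    Δ (fun y : E n => g (inner ℝ y e)) x = d := by
  have h2 := (hasFDerivAt_comp_inner e x hg').smul_const (innerSL ℝ e)
  rw [laplacian_eq_of_hasFDerivAt (EuclideanSpace.basisFun (Fin n) ℝ)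
    (Eventually.of_forall fun y => hasFDerivAt_comp_inner e y (hg _)) h2]
  have h3 := (EuclideanSpace.basisFun (Fin n) ℝ).sum_sq_norm_inner_left e
  rw [he] at h3
  have h4 : ∀ i, ((d • innerSL ℝ e).smulRight (innerSL ℝ e))
      (EuclideanSpace.basisFun (Fin n) ℝ i) (EuclideanSpace.basisFun (Fin n) ℝ i)
      = d * ‖inner ℝ e (EuclideanSpace.basisFun (Fin n) ℝ i)‖ ^ 2 := fun i => by
    rw [Real.norm_eq_abs, sq_abs]
    simp [sq]
    ring
  rw [Finset.sum_congr rfl fun i _ => h4 i, ← Finset.mul_sum, h3]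
  ring

/-- The weight `|x|^(-N) (1 - exp(-M (⟨x, e⟩ - μ)) / 2)`. -/
def planeWeight (N M : ℝ) (e : E n) (μ : ℝ) (x : E n) : ℝ :=
  ‖x‖ ^ (-N) * (1 - Real.exp (-M * (inner ℝ x e - μ)) / 2)

theorem hasDerivAt_planeProfile (M μ c s : ℝ) :
    HasDerivAt (fun s => c * Real.exp (-M * (s - μ))) (c * -M * Real.exp (-M * (s - μ))) s := by
  have := ((((hasDerivAt_id s).sub_const μ).const_mul (-M)).exp).const_mul c
  refine this.congr_deriv ?_
  simp
  ring

theorem contDiff_planeProfile (M : ℝ) (e : E n) (μ : ℝ) :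
    ContDiff ℝ 2 fun x : E n => 1 - Real.exp (-M * (inner ℝ x e - μ)) / 2 := by
  have := contDiff_inner_const e
  fun_prop

theorem contDiffAt_planeWeight (N M : ℝ) (e : E n) (μ : ℝ) {x : E n} (hx : x ≠ 0) :
    ContDiffAt ℝ 2 (planeWeight N M e μ) x := by
  exact (contDiffAt_norm_rpow _ hx).mul (contDiff_planeProfile M e μ).contDiffAt

theorem planeWeight_bounds {N M μ : ℝ} (hM : 0 < M) {x : E n} (hx : x ≠ 0)
    (h : μ < inner ℝ x e) : ‖x‖ ^ (-N) / 2 ≤ planeWeight N M e μ x ∧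
      planeWeight N M e μ x ≤ ‖x‖ ^ (-N) := by
  have hxp := norm_pos_iff.2 hx
  have h1 : Real.exp (-M * (inner ℝ x e - μ)) ≤ 1 := by
    rw [Real.exp_le_one_iff]
    nlinarith
  have h2 := Real.exp_pos (-M * (inner ℝ x e - μ))
  have h3 : 0 < ‖x‖ ^ (-N) := by positivity
  unfold planeWeight
  constructor <;> nlinarith

theorem laplacian_planeWeight_le {N M μ : ℝ} (hN : (n : ℝ) = 2 * N + 2) (hN0 : 0 < N) (hM : 0 < M)
    (he : ‖e‖ = 1) (hμ : 0 < μ) {x : E n} (hx : x ≠ 0) (h : μ < inner ℝ x e) :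
    ‖x‖ ^ 2 * Δ (planeWeight N M e μ) x ≤ -(N ^ 2
      + ‖x‖ ^ 2 * M ^ 2 * Real.exp (-M * (inner ℝ x e - μ)) / 2) * planeWeight N M e μ x := by
  have hxp := norm_pos_iff.2 hx
  have hg : ∀ s, HasDerivAt (fun s => 1 - Real.exp (-M * (s - μ)) / 2)
      (M / 2 * Real.exp (-M * (s - μ))) s := fun s => by
    have := (hasDerivAt_planeProfile M μ (1 / 2) s).const_sub 1
    refine (this.congr_deriv (by ring)).congr_of_eventuallyEq (Eventually.of_forall fun t => ?_)
    simp only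
    ring
  have hχ := laplacian_comp_inner (x := x) he hg (hasDerivAt_planeProfile M μ (M / 2) _)
  have hgrad : gradient (fun y : E n => 1 - Real.exp (-M * (inner ℝ y e - μ)) / 2) x
      = (M / 2 * Real.exp (-M * (inner ℝ x e - μ))) • e := by
    refine HasGradientAt.gradient (hasGradientAt_iff_hasFDerivAt.2 ?_)
    refine (hasFDerivAt_comp_inner e x (hg _)).congr_fderiv ?_
    ext y
    simp
  have hgrad' : gradient (fun y : E n => ‖y‖ ^ (-N)) x
      = (-N * ‖x‖ ^ (-N) * (‖x‖ ^ 2)⁻¹) • x := by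
    refine HasGradientAt.gradient (hasGradientAt_iff_hasFDerivAt.2 ?_)
    refine (hasFDerivAt_norm_rpow_of_ne (-N) hx).congr_fderiv ?_
    ext y
    simp
  have hmul := laplacian_mul (x := x) (contDiffAt_norm_rpow (-N) hx)
    (contDiff_planeProfile M e μ).contDiffAt
  have hb := (planeWeight_bounds (N := N) (e := e) hM hx h).2
  have key : ‖x‖ ^ 2 * Δ (planeWeight N M e μ) x = -N ^ 2 * planeWeight N M e μ x
      - ‖x‖ ^ 2 * M ^ 2 * Real.exp (-M * (inner ℝ x e - μ)) / 2 * ‖x‖ ^ (-N)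
      - N * ‖x‖ ^ (-N) * M * Real.exp (-M * (inner ℝ x e - μ)) * inner ℝ x e := by
    refine (congrArg (‖x‖ ^ 2 * ·) hmul).trans ?_
    rw [hχ, hgrad, hgrad', laplacian_norm_rpow _ hx, hN, real_inner_smul_left,
      real_inner_smul_right, planeWeight]
    field_simp
    ring
  rw [key]
  have hs : 0 < inner ℝ x e := hμ.trans h
  have h1 : 0 ≤ N * ‖x‖ ^ (-N) * M * Real.exp (-M * (inner ℝ x e - μ)) * inner ℝ x e := by
    positivity
  have h2 : 0 ≤ ‖x‖ ^ 2 * M ^ 2 * Real.exp (-M * (inner ℝ x e - μ)) / 2 := by positivity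
  nlinarith [mul_le_mul_of_nonneg_left hb h2]

end Mirror

section MovingPlanes

open InnerProductSpace Laplacian

variable {n k : ℕ} {p : ℝ}

local notation "E" n => EuclideanSpace ℝ (Fin n)

/-- Solutions with sharp two-sided bounds, together with the numerology making the weights
nonincreasing in the radius. -/
structure IsDecayingSolution (C : Coupling k p) (N Λ : ℝ) (v : Fin k → (E n) → ℝ) : Prop
    extends IsSolution C N Λ v where
  dim : (n : ℝ) = 2 * N + 2
  Λ_pos : 0 < Λ
  Λ_le : Λ ≤ N
  exponent_le : N * (p - 2) ≤ 2
  strict : Λ < N ∨ N * (p - 2) < 2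
  bounds : ∃ c > 0, ∃ c' > 0, ∀ i, ∀ x ≠ 0,
      c * Real.exp (-(Λ * |Real.log ‖x‖|)) ≤ ‖x‖ ^ N * v i x ∧
      ‖x‖ ^ N * v i x ≤ c' * Real.exp (-(Λ * |Real.log ‖x‖|))

theorem norm_rpow_mul_f_smul (C : Coupling k p) (N : ℝ) {r : ℝ} (hr : 0 < r) {V : Fin k → ℝ}
    (hV : ∀ j, 0 < V j) (i : Fin k) :
    r ^ (-N) * C.f i (fun j => r ^ N * V j) = r ^ (N * (p - 2)) * C.f i V := by
  rw [C.f_smul hV (by positivity), ← Real.rpow_mul hr.le, ← mul_assoc, ← Real.rpow_add hr]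
  congr 2
  ring

namespace IsDecayingSolution

variable {C : Coupling k p} {N Λ : ℝ} {v : Fin k → (E n) → ℝ}

theorem N_pos (hv : IsDecayingSolution C N Λ v) : 0 < N := hv.Λ_pos.trans_le hv.Λ_le

theorem sq_mul_laplacian_le (hv : IsDecayingSolution C N Λ v) (i : Fin k) {x y : E n} (hy : y ≠ 0)
    (hxy : ‖y‖ ≤ ‖x‖) : ‖x‖ ^ 2 * Δ (v i) y
      ≤ -((N ^ 2 - Λ ^ 2) * v i y + ‖x‖ ^ (-N) * C.f i (fun j => ‖x‖ ^ N * v j y)) := by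
  have hyp := norm_pos_iff.2 hy
  have hxp := hyp.trans_le hxy
  have hV : ∀ j, 0 < v j y := fun j => hv.pos j y hy
  have h := hv.laplacian i y hy
  rw [norm_rpow_mul_f_smul C N hyp hV] at h
  rw [norm_rpow_mul_f_smul C N hxp hV]
  set F := C.f i fun j => v j y
  have hF : 0 < F := C.f_pos hV i
  set ρ := ‖x‖ / ‖y‖ with hρ
  have hρ1 : 1 ≤ ρ := (one_le_div hyp).2 hxy
  have hx : ‖x‖ = ρ * ‖y‖ := by rw [hρ]; field_simp
  have hρ0 : 0 < ρ := by linarith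
  have e1 : ‖x‖ ^ 2 * Δ (v i) y = -(ρ ^ 2 * ((N ^ 2 - Λ ^ 2) * v i y)
      + ρ ^ 2 * (‖y‖ ^ (N * (p - 2)) * F)) := by
    rw [hx]
    linear_combination ρ ^ 2 * h
  have e2 : ‖x‖ ^ (N * (p - 2)) ≤ ρ ^ 2 * ‖y‖ ^ (N * (p - 2)) := by
    rw [hx, Real.mul_rpow hρ0.le hyp.le]
    have : ρ ^ (N * (p - 2)) ≤ ρ ^ (2 : ℝ) :=
      Real.rpow_le_rpow_of_exponent_le hρ1 hv.exponent_le
    rw [Real.rpow_two] at this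
    gcongr
  have e3 : 0 ≤ (N ^ 2 - Λ ^ 2) * v i y := by
    have := hV i
    have h1 := hv.Λ_pos
    have h2 := hv.Λ_le
    have : 0 ≤ N ^ 2 - Λ ^ 2 := by nlinarith
    positivity
  have e4 : (N ^ 2 - Λ ^ 2) * v i y ≤ ρ ^ 2 * ((N ^ 2 - Λ ^ 2) * v i y) :=
    le_mul_of_one_le_left e3 (one_le_pow₀ hρ1)
  have e5 : ‖x‖ ^ (N * (p - 2)) * F ≤ ρ ^ 2 * (‖y‖ ^ (N * (p - 2)) * F) := by
    rw [← mul_assoc]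
    gcongr
  rw [e1]
  linarith

theorem sq_mul_laplacian_lt (hv : IsDecayingSolution C N Λ v) (i : Fin k) {x y : E n} (hy : y ≠ 0)
    (hxy : ‖y‖ < ‖x‖) : ‖x‖ ^ 2 * Δ (v i) y
      < -((N ^ 2 - Λ ^ 2) * v i y + ‖x‖ ^ (-N) * C.f i (fun j => ‖x‖ ^ N * v j y)) := by
  have hyp := norm_pos_iff.2 hy
  have hxp := hyp.trans hxy
  have hV : ∀ j, 0 < v j y := fun j => hv.pos j y hy
  have h := hv.laplacian i y hy
  rw [norm_rpow_mul_f_smul C N hyp hV] at h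
  rw [norm_rpow_mul_f_smul C N hxp hV]
  set F := C.f i fun j => v j y
  have hF : 0 < F := C.f_pos hV i
  set ρ := ‖x‖ / ‖y‖ with hρ
  have hρ1 : 1 < ρ := (one_lt_div hyp).2 hxy
  have hx : ‖x‖ = ρ * ‖y‖ := by rw [hρ]; field_simp
  have hρ0 : 0 < ρ := by linarith
  have e1 : ‖x‖ ^ 2 * Δ (v i) y = -(ρ ^ 2 * ((N ^ 2 - Λ ^ 2) * v i y)
      + ρ ^ 2 * (‖y‖ ^ (N * (p - 2)) * F)) := by
    rw [hx]
    linear_combination ρ ^ 2 * h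
  have h1 := hv.Λ_pos
  have h2 := hv.Λ_le
  have hvi := hV i
  have hyN : 0 < ‖y‖ ^ (N * (p - 2)) := by positivity
  have e0 : ‖x‖ ^ (N * (p - 2)) = ρ ^ (N * (p - 2)) * ‖y‖ ^ (N * (p - 2)) := by
    rw [hx, Real.mul_rpow hρ0.le hyp.le]
  have e2 : ρ ^ (N * (p - 2)) ≤ ρ ^ 2 := by
    have := Real.rpow_le_rpow_of_exponent_le hρ1.le hv.exponent_le
    rwa [Real.rpow_two] at this
  have e6 : 0 ≤ N ^ 2 - Λ ^ 2 := by nlinarith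
  have hρ2 : 1 < ρ ^ 2 := one_lt_pow₀ hρ1 (by norm_num)
  have hyF := mul_pos hyN hF
  rw [e1, e0, mul_assoc]
  rcases hv.strict with h | h
  · have e7 : 0 < N ^ 2 - Λ ^ 2 := by nlinarith
    have := mul_pos (sub_pos.2 hρ2) (mul_pos e7 hvi)
    have := mul_le_mul_of_nonneg_right e2 hyF.le
    nlinarith
  · have e7 : ρ ^ (N * (p - 2)) < ρ ^ 2 := by
      have := Real.rpow_lt_rpow_of_exponent_lt hρ1 h
      rwa [Real.rpow_two] at this
    have := mul_nonneg (sub_pos.2 hρ2).le (mul_nonneg e6 hvi.le)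
    have := mul_lt_mul_of_pos_right e7 hyF
    nlinarith

theorem exists_q_bound (hv : IsDecayingSolution C N Λ v) (i₀ : Fin k) : ∃ Q > 0, ∃ T > 0,
    ∀ i, ∀ x ≠ 0, p * C.q i (fun j => ‖x‖ ^ N * v j x) ≤ Q ∧
      (T ≤ |Real.log ‖x‖| → p * C.q i (fun j => ‖x‖ ^ N * v j x) < Λ ^ 2) := by
  obtain ⟨c, hc, c', hc', hb⟩ := hv.bounds
  have hp := C.two_lt i₀
  have hΛ := hv.Λ_pos
  choose M hM hMq using fun i => C.exists_q_le (c' := c') hc i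
  set S := ∑ i, M i
  have hS : 0 < S := Finset.sum_pos (fun i _ => hM i) ⟨i₀, Finset.mem_univ _⟩
  have hq : ∀ i, ∀ x : E n, x ≠ 0 → p * C.q i (fun j => ‖x‖ ^ N * v j x)
      ≤ p * S * Real.exp (-(Λ * (p - 2) * |Real.log ‖x‖|)) := by
    intro i x hx
    have h1 := hMq i _ (Real.exp_pos _) _ (fun j => hb j x hx)
    rw [← Real.exp_mul] at h1
    have h2 : M i ≤ S := Finset.single_le_sum (fun i _ => (hM i).le) (Finset.mem_univ i)
    have h3 : -(Λ * |Real.log ‖x‖|) * (p - 2) = -(Λ * (p - 2) * |Real.log ‖x‖|) := by ring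
    rw [h3] at h1
    rw [mul_assoc]
    refine mul_le_mul_of_nonneg_left (h1.trans ?_) (by linarith)
    gcongr
  have hpS : 0 < p * S := mul_pos (by linarith) hS
  have hrate : 0 < Λ * (p - 2) := mul_pos hΛ (by linarith)
  refine ⟨p * S, hpS, max 1 ((Real.log (p * S) - Real.log (Λ ^ 2) + 1) / (Λ * (p - 2))),
    lt_max_of_lt_left one_pos, fun i x hx =>
      ⟨(hq i x hx).trans ?_, fun hT => (hq i x hx).trans_lt ?_⟩⟩
  · have : Real.exp (-(Λ * (p - 2) * |Real.log ‖x‖|)) ≤ 1 := by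
      rw [Real.exp_le_one_iff, neg_nonpos]
      positivity
    nlinarith
  · have h1 := (le_max_right _ _).trans hT
    rw [div_le_iff₀ hrate] at h1
    conv_lhs => rw [← Real.exp_log hpS]
    conv_rhs => rw [← Real.exp_log (show 0 < Λ ^ 2 by positivity)]
    rw [← Real.exp_add, Real.exp_lt_exp]
    linarith

/-- The differential inequality for the difference with the reflected solution. -/
theorem le_sq_mul_laplacian_sub (hv : IsDecayingSolution C N Λ v) {e : E n} (he : ‖e‖ = 1) {μ : ℝ}
    (hμ : 0 < μ) {x : E n} (hx : μ < inner ℝ x e) (hx' : mirror e μ x ≠ 0) {i : Fin k}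
    (hi : 0 < v i x - v i (mirror e μ x))
    (hmax : ∀ j, v j x - v j (mirror e μ x) ≤ v i x - v i (mirror e μ x)) :
    -(N ^ 2 - Λ ^ 2 + p * C.q i (fun j => ‖x‖ ^ N * v j x)) * (v i x - v i (mirror e μ x))
      ≤ ‖x‖ ^ 2 * Δ (fun x => v i x - v i (mirror e μ x)) x := by
  have hlt := norm_mirror_lt he hμ hx
  have hxp : 0 < ‖x‖ := (norm_nonneg _).trans_lt hlt
  have hx0 := norm_pos_iff.1 hxp
  have hsub : Δ (fun x => v i x - v i (mirror e μ x)) x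
      = Δ (v i) x - Δ (v i) (mirror e μ x) := by
    have h1 := (hv.contDiffAt i x hx0).laplacian_sub (hv.contDiffAt i _ hx').comp_mirror
    exact h1.trans (congrArg _ (laplacian_comp_mirror he (hv.contDiffAt i _ hx')))
  have h1 := hv.laplacian i x hx0
  have h2 := hv.sq_mul_laplacian_le i hx' hlt.le
  set d := v i x - v i (mirror e μ x) with hd
  have h3 := C.f_sub_le (V := fun j => ‖x‖ ^ N * v j x)
    (W := fun j => ‖x‖ ^ N * v j (mirror e μ x)) (d := ‖x‖ ^ N * d)
    (fun j => mul_pos (by positivity) (hv.pos j x hx0))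
    (fun j => mul_pos (by positivity) (hv.pos j _ hx')) (by positivity)
    (fun j => by
      rw [← mul_sub]
      exact mul_le_mul_of_nonneg_left (by linarith [hmax j]) (by positivity)) i
  have h4 := mul_le_mul_of_nonneg_left h3 (show 0 ≤ ‖x‖ ^ (-N) by positivity)
  have h5 : ‖x‖ ^ (-N) * (p * C.q i (fun j => ‖x‖ ^ N * v j x) * (‖x‖ ^ N * d))
      = p * C.q i (fun j => ‖x‖ ^ N * v j x) * d := by
    linear_combination (p * C.q i (fun j => ‖x‖ ^ N * v j x) * d)
      * norm_rpow_mul_norm_rpow_neg N hx0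
  rw [h5, mul_sub] at h4
  have h6 : (N ^ 2 - Λ ^ 2) * d
      = (N ^ 2 - Λ ^ 2) * v i x - (N ^ 2 - Λ ^ 2) * v i (mirror e μ x) := by
    rw [hd, mul_sub]
  clear_value d
  rw [hsub]
  linarith

/-- The plane `⟨x, e⟩ = μ` has been reached by the moving plane procedure. -/
def PlaneReached (v : Fin k → (E n) → ℝ) (e : E n) (μ : ℝ) : Prop :=
  ∀ i, ∀ x, μ < inner ℝ x e → mirror e μ x ≠ 0 → v i x ≤ v i (mirror e μ x)

theorem exists_planeReached_criterion (hv : IsDecayingSolution C N Λ v) (i₀ : Fin k) :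
    ∃ T > 0, ∃ M > 0, ∀ e : E n, ‖e‖ = 1 → ∀ μ > 0,
      (∃ ρ > 0, ∀ i, ∀ x, μ < inner ℝ x e → mirror e μ x ≠ 0 → ‖mirror e μ x‖ < ρ →
        v i x ≤ v i (mirror e μ x)) →
      (∀ i, ∀ x, |Real.log ‖x‖| ≤ T → μ + M⁻¹ ≤ inner ℝ x e → mirror e μ x ≠ 0 →
        v i x ≤ v i (mirror e μ x)) → PlaneReached v e μ := by
  obtain ⟨Q, hQ, T, hT, hq⟩ := hv.exists_q_bound i₀
  obtain ⟨c, hc, c', hc', hb⟩ := hv.bounds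
  have hΛ := hv.Λ_pos
  obtain ⟨M, hM, hMQ⟩ : ∃ M > 0, Q < Real.exp (-T) ^ 2 * M ^ 2 * Real.exp (-1) / 2 := by
    set L := Real.exp (-T) ^ 2 * Real.exp (-1) / 2 with hL
    have hL0 : 0 < L := by positivity
    refine ⟨Q / L + 1, by positivity, ?_⟩
    have h1 : Q / L < (Q / L + 1) ^ 2 := by
      have : 0 < Q / L := by positivity
      nlinarith
    rw [div_lt_iff₀ hL0] at h1
    rw [hL] at h1 ⊢
    linarith
  refine ⟨T, hT, M, hM, fun e he μ hμ hnear hzone => ?_⟩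
  obtain ⟨ρ, hρ, hnear⟩ := hnear
  have hne : ∀ x : E n, μ ≤ inner ℝ x e → x ≠ 0 := by
    rintro x hx rfl
    rw [inner_zero_left] at hx
    linarith
  have hcm : Continuous (mirror e μ) := (contDiff_mirror e μ).continuous
  have hci : Continuous fun x : E n => (inner ℝ x e : ℝ) := (contDiff_inner_const e).continuous
  set w : Fin k → (E n) → ℝ := fun i x => v i x - v i (mirror e μ x) with hw
  have hΩ : IsOpen {x : E n | μ < inner ℝ x e ∧ mirror e μ x ≠ 0} :=
    (isOpen_lt continuous_const hci).inter (isOpen_ne.preimage hcm)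
  have key := nonpos_of_weighted_maximum hΩ (ψ := planeWeight N M e μ) (w := w)
    (fun x hx => contDiffAt_planeWeight N M e μ (hne x hx.1.le))
    (fun x hx => by
      have := norm_pos_iff.2 (hne x hx.1.le)
      exact lt_of_lt_of_le (by positivity) (planeWeight_bounds hM (hne x hx.1.le) hx.1).1)
    (fun i x hx => (hv.contDiffAt i x (hne x hx.1.le)).sub
      (hv.contDiffAt i _ hx.2).comp_mirror) ?_ ?_
  · exact fun i x hx hx' => by linarith [key x ⟨hx, hx'⟩ i]
  · intro δ hδ
    set R := (Real.log c' - Real.log (δ / 2) + 1) / Λ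
    set A : Set (E n) := {x | μ ≤ inner ℝ x e ∧ ‖x‖ ≤ Real.exp (max R 0) ∧ ρ ≤ ‖mirror e μ x‖}
    have hAc : IsCompact A := by
      refine (isCompact_closedBall (0 : E n) (Real.exp (max R 0))).of_isClosed_subset ?_ ?_
      · exact (isClosed_le continuous_const hci).inter
          ((isClosed_le continuous_norm continuous_const).inter
            (isClosed_le continuous_const (continuous_norm.comp hcm)))
      · intro x hx
        rw [mem_closedBall_zero_iff]
        exact hx.2.1
    have hA' : ∀ x ∈ A, mirror e μ x ≠ 0 := fun x hx h => by
      have := hx.2.2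
      rw [h, norm_zero] at this
      linarith
    refine ⟨⋃ i, A ∩ (fun x => w i x - δ / 2 * ‖x‖ ^ (-N)) ⁻¹' Set.Ici 0,
      isCompact_iUnion fun i => ?_, ?_, ?_⟩
    · refine hAc.of_isClosed_subset ?_ Set.inter_subset_left
      refine ContinuousOn.preimage_isClosed_of_isClosed (fun x hx => ?_) hAc.isClosed isClosed_Ici
      have h1 := (hv.contDiffAt i x (hne x hx.1)).continuousAt
      have h2 := (hv.contDiffAt i _ (hA' x hx)).comp_mirror.continuousAt
      have h3 := (contDiffAt_norm_rpow (-N) (hne x hx.1)).continuousAt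
      exact ((h1.sub h2).sub (continuousAt_const.mul h3)).continuousWithinAt
    · intro x hx
      obtain ⟨i, hxA, hxi⟩ := Set.mem_iUnion.1 hx
      refine ⟨hxA.1.lt_of_ne fun h => ?_, hA' x hxA⟩
      have h0 : mirror e μ x = x := by simp [mirror, ← h]
      have h1 : 0 ≤ w i x - δ / 2 * ‖x‖ ^ (-N) := hxi
      have h2 := norm_pos_iff.2 (hne x hxA.1)
      have h3 : 0 < δ / 2 * ‖x‖ ^ (-N) := by positivity
      simp only [hw, h0, sub_self] at h1
      linarith
    · rintro x ⟨hx, hx'⟩ i hi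
      have hx0 := hne x hx.le
      have hxp := norm_pos_iff.2 hx0
      have h1 := (planeWeight_bounds (N := N) hM hx0 hx).1
      have h2 : δ / 2 * ‖x‖ ^ (-N) ≤ w i x := by nlinarith
      have h3 : 0 < δ / 2 * ‖x‖ ^ (-N) := by positivity
      refine Set.mem_iUnion.2 ⟨i, ⟨hx.le, ?_, ?_⟩, by simpa using h2⟩
      · rw [← Real.log_le_iff_le_exp hxp]
        by_contra! hcon
        have h4 := (hb i x hx0).2
        have h5 : δ / 2 ≤ ‖x‖ ^ N * v i x := by
          have h6 : δ / 2 * ‖x‖ ^ (-N) ≤ v i x := h2.trans (by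
            simp only [hw]
            linarith [hv.pos i _ hx'])
          have h7 := mul_le_mul_of_nonneg_left h6 (show 0 ≤ ‖x‖ ^ N by positivity)
          rwa [mul_left_comm, norm_rpow_mul_norm_rpow_neg N hx0, mul_one] at h7
        have h6 : c' * Real.exp (-(Λ * |Real.log ‖x‖|)) < δ / 2 := by
          conv_lhs => rw [← Real.exp_log hc']
          conv_rhs => rw [← Real.exp_log (half_pos hδ)]
          rw [← Real.exp_add, Real.exp_lt_exp]
          have h7 : R < |Real.log ‖x‖| := (le_max_left _ _).trans_lt (hcon.trans_le (le_abs_self _))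
          rw [div_lt_iff₀ hΛ] at h7
          linarith
        linarith
      · by_contra! hcon
        have := hnear i x hx hx' hcon
        simp only [hw] at h2
        linarith
  · rintro x ⟨hx, hx'⟩ i hi hmax
    have hx0 := hne x hx.le
    have hxp := norm_pos_iff.2 hx0
    have h1 := hv.le_sq_mul_laplacian_sub he hμ hx hx' hi hmax
    have h2 := laplacian_planeWeight_le hv.dim hv.N_pos hM he hμ hx0 hx
    have hψ : 0 < planeWeight N M e μ x :=
      lt_of_lt_of_le (by positivity) (planeWeight_bounds hM hx0 hx).1
    have h3 : N ^ 2 - Λ ^ 2 + p * C.q i (fun j => ‖x‖ ^ N * v j x)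
        < N ^ 2 + ‖x‖ ^ 2 * M ^ 2 * Real.exp (-M * (inner ℝ x e - μ)) / 2 := by
      have hnn : 0 ≤ ‖x‖ ^ 2 * M ^ 2 * Real.exp (-M * (inner ℝ x e - μ)) / 2 := by positivity
      rcases le_or_gt T |Real.log ‖x‖| with h | h
      · linarith [(hq i x hx0).2 h]
      · have h4 : inner ℝ x e < μ + M⁻¹ := by
          by_contra! hcon
          have := hzone i x h.le hcon hx'
          simp only [hw] at hi
          linarith
        have h5 : Real.exp (-T) ≤ ‖x‖ := by
          rw [← Real.le_log_iff_exp_le hxp]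
          linarith [(abs_lt.1 h).1]
        have h6 : Real.exp (-1) ≤ Real.exp (-M * (inner ℝ x e - μ)) := by
          rw [Real.exp_le_exp]
          have := mul_lt_mul_of_pos_left h4 hM
          rw [mul_add, mul_inv_cancel₀ hM.ne'] at this
          linarith
        have h7 : Real.exp (-T) ^ 2 * M ^ 2 * Real.exp (-1) / 2
            ≤ ‖x‖ ^ 2 * M ^ 2 * Real.exp (-M * (inner ℝ x e - μ)) / 2 := by gcongr
        have := (hq i x hx0).1
        nlinarith
    have h4 : ‖x‖ ^ 2 * (Δ (planeWeight N M e μ) x * w i x)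
        < ‖x‖ ^ 2 * (planeWeight N M e μ x * Δ (w i) x) := by
      calc ‖x‖ ^ 2 * (Δ (planeWeight N M e μ) x * w i x)
          = (‖x‖ ^ 2 * Δ (planeWeight N M e μ) x) * w i x := by ring
        _ ≤ -(N ^ 2 + ‖x‖ ^ 2 * M ^ 2 * Real.exp (-M * (inner ℝ x e - μ)) / 2)
            * planeWeight N M e μ x * w i x := mul_le_mul_of_nonneg_right h2 hi.le
        _ < planeWeight N M e μ x * (-(N ^ 2 - Λ ^ 2 + p * C.q i (fun j => ‖x‖ ^ N * v j x))
            * w i x) := by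
          have := mul_lt_mul_of_pos_right h3 (mul_pos hψ hi)
          linarith
        _ ≤ planeWeight N M e μ x * (‖x‖ ^ 2 * Δ (w i) x) := mul_le_mul_of_nonneg_left h1 hψ.le
        _ = _ := by ring
    exact lt_of_mul_lt_mul_left h4 (by positivity)

end IsDecayingSolution

end MovingPlanes

section Symmetry

open InnerProductSpace Laplacian

variable {n k : ℕ} {p : ℝ}

local notation "E" n => EuclideanSpace ℝ (Fin n)

/-- A property of positive reals that holds near infinity and propagates downwards holds
everywhere. -/
theorem forall_pos_of_continuation {P : ℝ → Prop} (hstart : ∃ R, ∀ μ ≥ R, P μ)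
    (hcont : ∀ l > 0, (∀ μ > l, P μ) → ∃ ε > 0, ∀ μ, l - ε < μ → 0 < μ → P μ) :
    ∀ μ > 0, P μ := by
  obtain ⟨R, hR⟩ := hstart
  set S : Set ℝ := {l | 0 ≤ l ∧ ∀ μ > l, P μ} with hS
  have hne : S.Nonempty := ⟨max R 0, le_max_right _ _,
    fun μ hμ => hR μ ((le_max_left _ _).trans hμ.le)⟩
  have hbdd : BddBelow S := ⟨0, fun l hl => hl.1⟩
  set l := sInf S
  have hl0 : 0 ≤ l := le_csInf hne fun l hl => hl.1
  have hl : ∀ μ > l, P μ := fun μ hμ => by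
    obtain ⟨m, hm, hmμ⟩ := exists_lt_of_csInf_lt hne hμ
    exact hm.2 μ hmμ
  rcases hl0.eq_or_lt with h | h
  · intro μ hμ
    exact hl μ (by rw [← h]; exact hμ)
  · exfalso
    obtain ⟨ε, hε, hP⟩ := hcont l h hl
    have h1 : max (l - ε) 0 ∈ S := ⟨le_max_right _ _, fun μ hμ =>
      hP μ ((le_max_left _ _).trans_lt hμ) ((le_max_right _ _).trans_lt hμ)⟩
    have h2 := csInf_le hbdd h1
    have h3 : max (l - ε) 0 < l := max_lt (by linarith) h
    linarith

namespace IsDecayingSolution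

variable {C : Coupling k p} {N Λ : ℝ} {v : Fin k → (E n) → ℝ}

theorem exists_planeReached_start (hv : IsDecayingSolution C N Λ v) (i₀ : Fin k) {e : E n}
    (he : ‖e‖ = 1) : ∃ R, ∀ μ ≥ R, PlaneReached v e μ := by
  obtain ⟨T, hT, M, hM, hcrit⟩ := hv.exists_planeReached_criterion i₀
  obtain ⟨c, hc, c', hc', hb⟩ := hv.bounds
  have hΛ := hv.Λ_pos
  have hN := hv.N_pos
  set s := max T ((Real.log c' - Real.log c) / Λ)
  have hs0 : 0 ≤ s := hT.le.trans (le_max_left _ _)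
  refine ⟨Real.exp s, fun μ hμ => ?_⟩
  have hμ0 : 0 < μ := (Real.exp_pos _).trans_le hμ
  have hfar : ∀ x : E n, μ < inner ℝ x e → x ≠ 0 ∧ s < Real.log ‖x‖ := fun x hx => by
    have h1 : inner ℝ x e ≤ ‖x‖ := by
      have := real_inner_le_norm x e
      rwa [he, mul_one] at this
    have h2 : 0 < ‖x‖ := by linarith
    exact ⟨norm_pos_iff.1 h2, (Real.lt_log_iff_exp_lt h2).2 (by linarith)⟩
  refine hcrit e he μ hμ0 ⟨1, one_pos, fun i x hx hx' hρ => ?_⟩ fun i x hlog hx hx' => ?_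
  · obtain ⟨hx0, hxs⟩ := hfar x hx
    have hxp := norm_pos_iff.2 hx0
    set y := mirror e μ x with hy
    have hyp := norm_pos_iff.2 hx'
    have hylog : Real.log ‖y‖ ≤ 0 := Real.log_nonpos hyp.le hρ.le
    have h1 := (hb i x hx0).2
    have h2 := (hb i y hx').1
    rw [abs_of_nonneg (hs0.trans hxs.le)] at h1
    rw [abs_of_nonpos hylog] at h2
    have h3 : ‖y‖ ^ N * c ≤ ‖y‖ ^ N * v i y := by
      refine le_trans ?_ h2
      rw [norm_rpow_eq_exp N hx', mul_comm]
      gcongr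
      have := hv.Λ_le
      nlinarith
    have h4 : c ≤ v i y := (mul_le_mul_iff_right₀ (by positivity)).1 h3
    have h5 : c' * Real.exp (-(Λ * Real.log ‖x‖)) ≤ c := by
      have h6 := (le_max_right T ((Real.log c' - Real.log c) / Λ)).trans hxs.le
      rw [div_le_iff₀ hΛ] at h6
      conv_lhs => rw [← Real.exp_log hc']
      conv_rhs => rw [← Real.exp_log hc]
      rw [← Real.exp_add, Real.exp_le_exp]
      linarith
    have h6 : v i x ≤ ‖x‖ ^ N * v i x := by
      refine le_mul_of_one_le_left (hv.pos i x hx0).le ?_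
      rw [norm_rpow_eq_exp N hx0, Real.one_le_exp_iff]
      exact mul_nonneg hN.le (hs0.trans hxs.le)
    linarith
  · exfalso
    have h1 : μ < inner ℝ x e := by
      have := inv_pos.2 hM
      linarith
    have h2 := (hfar x h1).2
    have h3 := le_max_left T ((Real.log c' - Real.log c) / Λ)
    have := le_abs_self (Real.log ‖x‖)
    linarith

theorem planeReached_of_forall_gt (hv : IsDecayingSolution C N Λ v) {e : E n} {l : ℝ}
    (h : ∀ μ > l, PlaneReached v e μ) : PlaneReached v e l := by
  intro i x hx hx'
  have hc : ContinuousAt (fun μ : ℝ => mirror e μ x) l := by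
    have := (continuous_mirror e).comp (Continuous.prodMk_left x)
    exact this.continuousAt
  have ht : Tendsto (fun μ => v i (mirror e μ x)) (𝓝[>] l) (𝓝 (v i (mirror e l x))) :=
    ((hv.contDiffAt i _ hx').continuousAt.comp
      (f := fun μ : ℝ => mirror e μ x) hc).continuousWithinAt
  refine ge_of_tendsto ht ?_
  have h1 : ∀ᶠ μ in 𝓝[>] l, mirror e μ x ≠ 0 :=
    (hc.continuousWithinAt (s := Set.Ioi l)).eventually_ne hx'
  have h2 : ∀ᶠ μ in 𝓝[>] l, μ < inner ℝ x e :=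
    mem_nhdsWithin_of_mem_nhds (Iio_mem_nhds hx)
  filter_upwards [h1, h2, self_mem_nhdsWithin] with μ h1 h2 h3 using h μ h3 i x h2 h1

theorem PlaneReached.lt (hv : IsDecayingSolution C N Λ v) {e : E n} (he : ‖e‖ = 1) {μ : ℝ}
    (hμ : 0 < μ) (h : PlaneReached v e μ) {i : Fin k} {x : E n} (hx : μ < inner ℝ x e)
    (hx' : mirror e μ x ≠ 0) : v i x < v i (mirror e μ x) := by
  refine (h i x hx hx').lt_of_ne fun heq => ?_
  have hlt := norm_mirror_lt he hμ hx
  have hxp : 0 < ‖x‖ := (norm_nonneg _).trans_lt hlt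
  have hx0 := norm_pos_iff.1 hxp
  have h1 := (hv.contDiffAt i x hx0).sub (hv.contDiffAt i _ hx').comp_mirror
  have hsub : Δ (fun x => v i x - v i (mirror e μ x)) x
      = Δ (v i) x - Δ (v i) (mirror e μ x) := by
    have h1 := (hv.contDiffAt i x hx0).laplacian_sub (hv.contDiffAt i _ hx').comp_mirror
    exact h1.trans (congrArg _ (laplacian_comp_mirror he (hv.contDiffAt i _ hx')))
  have hmax : IsLocalMax (fun x => v i x - v i (mirror e μ x)) x := by
    have e1 : ∀ᶠ y in 𝓝 x, μ < inner ℝ y e :=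
      (contDiff_inner_const e).continuous.continuousAt.eventually_const_lt hx
    have e2 : ∀ᶠ y in 𝓝 x, mirror e μ y ≠ 0 :=
      (contDiff_mirror e μ).continuous.continuousAt.eventually_ne hx'
    filter_upwards [e1, e2] with y h1 h2
    have := h i y h1 h2
    linarith
  have h2 := laplacian_nonpos_of_isLocalMax h1 hmax
  rw [hsub] at h2
  have h3 := hv.sq_mul_laplacian_lt i hx' hlt
  have h4 := hv.laplacian i x hx0
  have h5 : C.f i (fun j => ‖x‖ ^ N * v j x) ≤ C.f i (fun j => ‖x‖ ^ N * v j (mirror e μ x)) :=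
    C.f_mono (fun j => hv.pos_rpow_mul j hx0)
      (fun j => mul_le_mul_of_nonneg_left (h j x hx hx') (by positivity)) i
  have h6 := mul_le_mul_of_nonneg_left h5 (show 0 ≤ ‖x‖ ^ (-N) by positivity)
  rw [← heq] at h3
  have h7 : ‖x‖ ^ 2 * (Δ (v i) x - Δ (v i) (mirror e μ x)) ≤ 0 :=
    mul_nonpos_of_nonneg_of_nonpos (by positivity) h2
  linarith

theorem PlaneReached.exists_gap (hv : IsDecayingSolution C N Λ v) {e : E n} (he : ‖e‖ = 1) {μ : ℝ}
    (hμ : 0 < μ) (h : PlaneReached v e μ) (i₀ : Fin k) : ∃ ρ > 0, ∃ c₀ > 0, ∀ i, ∀ y : E n, y ≠ 0 →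
      ‖y‖ < ρ → c₀ ≤ v i y - v i (mirror e μ y) := by
  have hN := hv.N_pos
  have hside : ∀ y : E n, ‖y‖ < μ → μ < inner ℝ (mirror e μ y) e ∧ mirror e μ y ≠ 0 := by
    intro y hy
    have h1 : inner ℝ y e < μ := by
      have := real_inner_le_norm y e
      rw [he, mul_one] at this
      linarith
    have h2 : μ < inner ℝ (mirror e μ y) e := by
      rw [inner_mirror he]
      linarith
    refine ⟨h2, fun h0 => ?_⟩
    rw [h0, inner_zero_left] at h2
    linarith
  have hlt : ∀ i, ∀ y : E n, y ≠ 0 → ‖y‖ < μ → v i (mirror e μ y) < v i y := by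
    intro i y hy0 hy
    have := PlaneReached.lt hv he hμ h (i := i) (hside y hy).1 (by rwa [mirror_mirror he])
    rwa [mirror_mirror he] at this
  have hcd : ∀ i, ∀ y : E n, y ≠ 0 → ‖y‖ < μ →
      ContDiffAt ℝ 2 (fun y => v i y - v i (mirror e μ y)) y := fun i y hy0 hy =>
    (hv.contDiffAt i y hy0).sub (hv.contDiffAt i _ (hside y hy).2).comp_mirror
  obtain ⟨c₀, hc₀, hmin⟩ : ∃ c₀ > 0, ∀ i, ∀ y : E n, ‖y‖ = μ / 2 →
      c₀ ≤ v i y - v i (mirror e μ y) := by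
    have hh : ∀ i, ∃ c > 0, ∀ y : E n, ‖y‖ = μ / 2 → c ≤ v i y - v i (mirror e μ y) := by
      intro i
      have h0 : ∀ y ∈ Metric.sphere (0 : E n) (μ / 2), y ≠ 0 ∧ ‖y‖ < μ := fun y hy => by
        rw [mem_sphere_zero_iff_norm] at hy
        exact ⟨norm_pos_iff.1 (by linarith), by linarith⟩
      have hne : (Metric.sphere (0 : E n) (μ / 2)).Nonempty :=
        ⟨(μ / 2) • e, by simp [norm_smul, he, abs_of_pos hμ]⟩
      obtain ⟨z, hz, hzmin⟩ := (isCompact_sphere (0 : E n) (μ / 2)).exists_isMinOn hne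
        (fun y hy => (hcd i y (h0 y hy).1 (h0 y hy).2).continuousAt.continuousWithinAt)
      refine ⟨_, sub_pos.2 (hlt i z (h0 z hz).1 (h0 z hz).2), fun y hy => hzmin ?_⟩
      simpa using hy
    choose c hc hcm using hh
    obtain ⟨i₁, -, hi₁⟩ := Finset.exists_min_image Finset.univ c ⟨i₀, Finset.mem_univ _⟩
    exact ⟨c i₁, hc i₁, fun i y hy => (hi₁ i (Finset.mem_univ i)).trans (hcm i y hy)⟩
  have hlog : ∀ y : E n, y ≠ 0 → -Real.log (μ / 2) ≤ -1 * Real.log ‖y‖ → ‖y‖ ≤ μ / 2 := by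
    intro y hy0 hy
    rw [← Real.log_le_log_iff (norm_pos_iff.2 hy0) (half_pos hμ)]
    linarith
  refine ⟨μ / 2, half_pos hμ, c₀, hc₀, fun i y hy0 hy => ?_⟩
  have key := nonpos_of_radial_end hv.dim (Or.inr rfl : (-1 : ℝ) = 1 ∨ (-1 : ℝ) = -1)
    (τ₀ := -Real.log (μ / 2)) (w := fun i y => c₀ - (v i y - v i (mirror e μ y))) ?_ ?_ ?_ ?_
  · have hylt := Real.log_lt_log (norm_pos_iff.2 hy0) hy
    have := key y hy0 (by linarith) i
    linarith
  · intro i y hy0 hy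
    exact contDiffAt_const.sub (hcd i y hy0 (by linarith [hlog y hy0 hy]))
  · intro i y hy0 hy
    have h1 : ‖y‖ = μ / 2 :=
      Real.log_injOn_pos (norm_pos_iff.2 hy0) (half_pos hμ) (by linarith)
    linarith [hmin i y h1]
  · intro i δ hδ
    have h0 := hside 0 (by simpa using hμ)
    have ht : Tendsto (fun y : E n => ‖y‖ ^ N * (c₀ + v i (mirror e μ y))) (𝓝 0)
        (𝓝 (‖(0 : E n)‖ ^ N * (c₀ + v i (mirror e μ 0)))) := by
      refine Tendsto.mul ?_ (tendsto_const_nhds.add ?_)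
      · exact (continuous_norm.rpow_const fun _ => Or.inr hN.le).continuousAt
      · exact ((hv.contDiffAt i _ h0.2).comp_mirror).continuousAt
    rw [norm_zero, Real.zero_rpow hN.ne', zero_mul] at ht
    obtain ⟨r, hr, hball⟩ := Metric.eventually_nhds_iff.1 (ht.eventually_lt_const hδ)
    refine ⟨-Real.log r + 1, fun y hy0 hy => lt_of_le_of_lt ?_ (hball (y := y) ?_)⟩
    · refine mul_le_mul_of_nonneg_left ?_ (by positivity)
      linarith [hv.pos i y hy0]
    · rw [dist_zero_right]
      exact (Real.log_lt_log_iff (norm_pos_iff.2 hy0) hr).1 (by linarith)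
  · intro y hy0 hy i hi _
    have hylt : ‖y‖ < μ := by linarith [hlog y hy0 hy.le]
    have hm := hside y hylt
    have hle : ‖y‖ < ‖mirror e μ y‖ := by
      have := norm_mirror_lt he hμ hm.1
      rwa [mirror_mirror he] at this
    have hsub : Δ (fun y => c₀ - (v i y - v i (mirror e μ y))) y
        = Δ (v i) (mirror e μ y) - Δ (v i) y := by
      have h1 := (contDiffAt_const (c := c₀)).laplacian_sub (hcd i y hy0 hylt)
      have h2 := (hv.contDiffAt i y hy0).laplacian_sub (hv.contDiffAt i _ hm.2).comp_mirror
      have h3 := laplacian_comp_mirror he (hv.contDiffAt i _ hm.2)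
      have h4 : Δ (fun _ : E n => c₀) y = 0 := by
        simp
      have h5 := h1.trans (congrArg₂ (· - ·) h4 (h2.trans (congrArg (Δ (v i) y - ·) h3)))
      refine h5.trans ?_
      ring
    have h2 := hv.sq_mul_laplacian_le i hy0 hle.le
    have h3 := hv.laplacian i _ hm.2
    have hmp : 0 < ‖mirror e μ y‖ := norm_pos_iff.2 hm.2
    have h5 : C.f i (fun j => ‖mirror e μ y‖ ^ N * v j (mirror e μ y))
        ≤ C.f i (fun j => ‖mirror e μ y‖ ^ N * v j y) :=
      C.f_mono (fun j => hv.pos_rpow_mul j hm.2)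
        (fun j => mul_le_mul_of_nonneg_left (hlt j y hy0 hylt).le (by positivity)) i
    have h6 := mul_le_mul_of_nonneg_left h5 (show 0 ≤ ‖mirror e μ y‖ ^ (-N) by positivity)
    have h7 : (N ^ 2 - Λ ^ 2) * v i (mirror e μ y) ≤ (N ^ 2 - Λ ^ 2) * v i y := by
      have e1 := hv.Λ_pos
      have e2 := hv.Λ_le
      refine mul_le_mul_of_nonneg_left (hlt i y hy0 hylt).le ?_
      nlinarith
    have h8 : 0 ≤ ‖mirror e μ y‖ ^ 2 * (Δ (v i) (mirror e μ y) - Δ (v i) y) := by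
      rw [mul_sub]
      linarith
    have h9 : 0 ≤ Δ (v i) (mirror e μ y) - Δ (v i) y :=
      nonneg_of_mul_nonneg_right h8 (by positivity)
    rw [hsub]
    have h10 : 0 ≤ ‖y‖ ^ 2 * (Δ (v i) (mirror e μ y) - Δ (v i) y) := by positivity
    nlinarith [mul_pos (sq_pos_of_pos hN) hi]

theorem exists_planeReached_continuation (hv : IsDecayingSolution C N Λ v) (i₀ : Fin k) {e : E n}
    (he : ‖e‖ = 1) {l : ℝ} (hl : 0 < l) (h : ∀ μ > l, PlaneReached v e μ) :
    ∃ ε > 0, ∀ μ, l - ε < μ → 0 < μ → PlaneReached v e μ := by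
  have hl' := hv.planeReached_of_forall_gt h
  obtain ⟨T, hT, M, hM, hcrit⟩ := hv.exists_planeReached_criterion i₀
  obtain ⟨ρ, hρ, c₀, hc₀, hgap⟩ := PlaneReached.exists_gap hv he hl hl' i₀
  have hxne : mirror e l 0 ≠ 0 := by
    intro h0
    have := inner_mirror he l 0
    rw [h0, inner_zero_left, sub_zero] at this
    linarith
  have hpersist : ∃ r > 0, ∀ i, ∀ z, dist z (mirror e l 0) < r →
      |v i z - v i (mirror e l 0)| < c₀ / 2 := by
    have h1 : ∀ᶠ z in 𝓝 (mirror e l 0), ∀ i, |v i z - v i (mirror e l 0)| < c₀ / 2 := by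
      refine eventually_all.2 fun i => ?_
      have := (hv.contDiffAt i _ hxne).continuousAt
      simpa [Real.dist_eq] using Metric.tendsto_nhds.1 this (c₀ / 2) (half_pos hc₀)
    obtain ⟨r, hr, hball⟩ := Metric.eventually_nhds_iff.1 h1
    exact ⟨r, hr, fun i z hz => hball hz i⟩
  obtain ⟨r, hr, hpersist⟩ := hpersist
  have hdist : ∀ μ (y : E n), dist (mirror e μ y) (mirror e l 0) ≤ 3 * ‖y‖ + 2 * |μ - l| := by
    intro μ y
    have h1 := norm_mirror_sub_mirror he μ l y
    have h2 : ‖mirror e l y - mirror e l 0‖ ≤ 3 * ‖y‖ := by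
      have e1 : mirror e l y - mirror e l 0 = y - (2 * inner ℝ y e : ℝ) • e := by
        simp only [mirror, inner_zero_left]
        have : (2 * (inner ℝ y e - l)) • e = (2 * inner ℝ y e : ℝ) • e + (2 * (0 - l)) • e := by
          rw [← add_smul]
          ring_nf
        rw [this]
        abel
      rw [e1]
      refine (norm_sub_le _ _).trans ?_
      rw [norm_smul, he, Real.norm_eq_abs, abs_mul, abs_two, mul_one]
      have := abs_real_inner_le_norm y e
      rw [he, mul_one] at this
      linarith
    rw [dist_eq_norm]
    calc ‖mirror e μ y - mirror e l 0‖
        = ‖(mirror e μ y - mirror e l y) + (mirror e l y - mirror e l 0)‖ := by abel_nf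
      _ ≤ _ := norm_add_le _ _
      _ ≤ _ := by linarith
  set ρ' := min ρ (r / 6) with hρ'
  have hρ'0 : 0 < ρ' := lt_min hρ (by positivity)
  have hnear : ∀ μ, |μ - l| < r / 4 → ∀ i, ∀ y : E n, y ≠ 0 → ‖y‖ < ρ' →
      v i (mirror e μ y) ≤ v i y := by
    intro μ hμ i y hy0 hy
    have h1 := hgap i y hy0 (hy.trans_le (min_le_left _ _))
    have h2 : ‖y‖ < r / 6 := hy.trans_le (min_le_right _ _)
    have h3 := hpersist i (mirror e μ y) (by linarith [hdist μ y])
    have h4 := hpersist i (mirror e l y) (by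
      have := hdist l y
      rw [sub_self, abs_zero] at this
      linarith)
    rw [abs_lt] at h3 h4
    linarith [h3.2, h4.1]
  set K : Set (E n) := {x | (Real.exp (-T) ≤ ‖x‖ ∧ ‖x‖ ≤ Real.exp T) ∧
    (l + M⁻¹ / 2 ≤ inner ℝ x e ∧ ρ' / 2 ≤ ‖mirror e l x‖)}
  have hM' := inv_pos.2 hM
  have hK : IsCompact K := by
    refine (isCompact_annulus _ _).inter_right ?_
    exact (isClosed_le continuous_const (contDiff_inner_const e).continuous).inter
      (isClosed_le continuous_const (continuous_norm.comp (contDiff_mirror e l).continuous))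
  have hev : ∀ᶠ μ in 𝓝 l, ∀ x ∈ K, ∀ i, v i x ≤ v i (mirror e μ x) := by
    refine hK.eventually_forall_of_forall_eventually fun x hx => eventually_all.2 fun i => ?_
    have hx' : mirror e l x ≠ 0 := norm_pos_iff.1 (by linarith [hx.2.2])
    have hx0 : x ≠ 0 := norm_pos_iff.1 ((Real.exp_pos _).trans_le hx.1.1)
    have hlt := PlaneReached.lt hv he hl hl' (i := i) (by linarith [hx.2.1]) hx'
    have c1 : ContinuousAt (fun z : ℝ × E n => v i z.2) (l, x) :=
      (hv.contDiffAt i x hx0).continuousAt.comp (f := fun z : ℝ × E n => z.2) continuousAt_snd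
    have c2 : ContinuousAt (fun z : ℝ × E n => v i (mirror e z.1 z.2)) (l, x) :=
      (hv.contDiffAt i _ hx').continuousAt.comp (f := fun z : ℝ × E n => mirror e z.1 z.2)
        (continuous_mirror e).continuousAt
    filter_upwards [c1.eventually_lt c2 hlt] with z hz using hz.le
  obtain ⟨ε₁, hε₁, hεK⟩ := Metric.eventually_nhds_iff.1 hev
  refine ⟨min (min ε₁ (r / 4)) (min (ρ' / 4) (M⁻¹ / 2)), by positivity, fun μ hμ hμ0 => ?_⟩
  rcases lt_or_ge l μ with hlμ | hlμ
  · exact h μ hlμ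
  have a1 := min_le_left (min ε₁ (r / 4)) (min (ρ' / 4) (M⁻¹ / 2))
  have a2 := min_le_right (min ε₁ (r / 4)) (min (ρ' / 4) (M⁻¹ / 2))
  have a3 := min_le_left ε₁ (r / 4)
  have a4 := min_le_right ε₁ (r / 4)
  have a5 := min_le_left (ρ' / 4) (M⁻¹ / 2)
  have a6 := min_le_right (ρ' / 4) (M⁻¹ / 2)
  have habs : |μ - l| = l - μ := by rw [abs_of_nonpos (by linarith)]; ring
  have hnear' : ∀ i, ∀ x : E n, mirror e μ x ≠ 0 → ‖mirror e μ x‖ < ρ' →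
      v i x ≤ v i (mirror e μ x) := fun i x hx' hxρ => by
    have := hnear μ (by linarith) i _ hx' hxρ
    rwa [mirror_mirror he] at this
  refine hcrit e he μ hμ0 ⟨ρ', hρ'0, fun i x _ => hnear' i x⟩ fun i x hx hx1 hx2 => ?_
  rcases lt_or_ge ‖mirror e μ x‖ ρ' with hcase | hcase
  · exact hnear' i x hx2 hcase
  · have hxs : 0 < inner ℝ x e := by linarith
    have hx0 : x ≠ 0 := by
      rintro rfl
      rw [inner_zero_left] at hxs
      exact lt_irrefl _ hxs
    have hxp := norm_pos_iff.2 hx0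
    refine hεK (by rw [Real.dist_eq]; linarith) x ⟨⟨?_, ?_⟩, by linarith, ?_⟩ i
    · rw [← Real.le_log_iff_exp_le hxp]
      exact (abs_le.1 hx).1
    · rw [← Real.log_le_iff_le_exp hxp]
      exact (abs_le.1 hx).2
    · have b1 := norm_mirror_sub_mirror he μ l x
      have b2 := norm_sub_norm_le (mirror e μ x) (mirror e l x)
      linarith

theorem radial (hv : IsDecayingSolution C N Λ v) (i : Fin k) {x y : E n} (hx : x ≠ 0)
    (hxy : ‖x‖ = ‖y‖) : v i x = v i y := by
  have hall : ∀ e : E n, ‖e‖ = 1 → PlaneReached v e 0 := fun e he =>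
    hv.planeReached_of_forall_gt (forall_pos_of_continuation
      (hv.exists_planeReached_start i he)
      fun l hl h => hv.exists_planeReached_continuation i he hl h)
  have hle : ∀ x y : E n, x ≠ 0 → ‖x‖ = ‖y‖ → v i x ≤ v i y := by
    intro x y hx hxy
    by_cases hne : x = y
    · rw [hne]
    have hd : 0 < ‖x - y‖ := norm_pos_iff.2 (sub_ne_zero.2 hne)
    set e : E n := ‖x - y‖⁻¹ • (x - y) with he
    have he1 : ‖e‖ = 1 := by
      rw [he, norm_smul, norm_inv, norm_norm, inv_mul_cancel₀ hd.ne']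
    have hinner : inner ℝ x e = ‖x - y‖ / 2 := by
      have h1 := norm_sub_sq_real x y
      rw [← hxy] at h1
      rw [he, real_inner_smul_right, inner_sub_right, real_inner_self_eq_norm_sq,
        inv_mul_eq_iff_eq_mul₀ hd.ne']
      linarith
    have hm : mirror e 0 x = y := by
      rw [mirror, hinner, sub_zero, mul_div_cancel₀ _ two_ne_zero, he, smul_smul,
        mul_inv_cancel₀ hd.ne', one_smul, sub_sub_cancel]
    have := hall e he1 i x (by rw [hinner]; positivity) (by
      rw [hm]
      exact norm_pos_iff.1 (hxy ▸ norm_pos_iff.2 hx))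
    rwa [hm] at this
  exact le_antisymm (hle x y hx hxy)
    (hle y x (norm_pos_iff.1 (hxy ▸ norm_pos_iff.2 hx)) hxy.symm)

end IsDecayingSolution

end Symmetry

section Profiles

variable {k : ℕ} {p : ℝ}

theorem nonpos_of_isLocalMax_of_hasDerivAt {g g' : ℝ → ℝ} {d t : ℝ}
    (h1 : ∀ᶠ s in 𝓝 t, HasDerivAt g (g' s) s) (h2 : HasDerivAt g' d t) (hmax : IsLocalMax g t) :
    d ≤ 0 := by
  by_contra! hd
  have hg : deriv g =ᶠ[𝓝 t] g' := h1.mono fun s hs => hs.deriv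
  have hdd : deriv (deriv g) t = d := by rw [hg.deriv_eq, h2.deriv]
  have hmin := isLocalMin_of_deriv_deriv_pos (by rwa [hdd]) hmax.deriv_eq_zero
    h1.self_of_nhds.continuousAt
  have hconst : g =ᶠ[𝓝 t] fun _ => g t := by
    filter_upwards [hmax, hmin] with s e1 e2 using le_antisymm e1 e2
  have h0 : deriv g =ᶠ[𝓝 t] fun _ => 0 := by
    simpa using hconst.deriv
  rw [h0.deriv_eq, deriv_const] at hdd
  exact hd.ne hdd

/-- Maximum principle on a half line with a positive weight. -/
theorem nonpos_of_weighted_maximum_Ici {ι : Type*} [Fintype ι] {l : ℝ} {ψ ψ' ψ'' : ℝ → ℝ}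
    (hψ : ∀ t, HasDerivAt ψ (ψ' t) t) (hψ' : ∀ t, HasDerivAt ψ' (ψ'' t) t)
    (hψ0 : ∀ t ≥ l, 1 / 2 ≤ ψ t) {w w' w'' : ι → ℝ → ℝ}
    (hw : ∀ i t, HasDerivAt (w i) (w' i t) t) (hw' : ∀ i t, HasDerivAt (w' i) (w'' i t) t)
    (hl : ∀ i, w i l ≤ 0) (hinf : ∀ i, Tendsto (w i) atTop (𝓝 0))
    (hΔ : ∀ t > l, ∀ i, 0 < w i t → (∀ j, ψ t * w j t ≤ ψ t * w i t) →
      ψ'' t * w i t < ψ t * w'' i t) :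
    ∀ t ≥ l, ∀ i, w i t ≤ 0 := by
  intro x hx i
  by_contra! hcon
  have hψp : ∀ t ≥ l, 0 < ψ t := fun t ht => by linarith [hψ0 t ht]
  set δ := w i x / ψ x with hδ
  have hδ0 : 0 < δ := div_pos hcon (hψp x hx)
  obtain ⟨R, hR⟩ : ∃ R, ∀ t ≥ R, ∀ j, w j t < δ / 2 :=
    eventually_atTop.1 (eventually_all.2 fun j => (hinf j).eventually_lt_const (by positivity))
  have hxR : x < R := by
    by_contra! h
    have h1 := hR x h i
    have h2 : w i x = δ * ψ x := by rw [hδ, div_mul_cancel₀ _ (hψp x hx).ne']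
    nlinarith [hψ0 x hx]
  have hne : (Finset.univ : Finset ι).Nonempty := ⟨i, Finset.mem_univ i⟩
  have hcont : ContinuousOn (fun y => Finset.univ.sup' hne fun j => w j y / ψ y)
      (Set.Icc l R) := by
    refine ContinuousOn.finset_sup'_apply hne fun j _ => ?_
    intro y hy
    exact ((hw j y).continuousAt.div (hψ y).continuousAt (hψp y hy.1).ne').continuousWithinAt
  obtain ⟨z, hzK, hz⟩ := isCompact_Icc.exists_isMaxOn ⟨x, hx, hxR.le⟩ hcont
  obtain ⟨j, -, hj⟩ := Finset.exists_mem_eq_sup' hne fun j => w j z / ψ z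
  set M := w j z / ψ z with hM
  have hKM : ∀ y ∈ Set.Icc l R, ∀ m, w m y / ψ y ≤ M := by
    intro y hy m
    have h1 := hz hy
    simp only [Set.mem_ofPred_eq, hj] at h1
    exact (Finset.le_sup' (fun j => w j y / ψ y) (Finset.mem_univ m)).trans h1
  have hδM : δ ≤ M := hKM x ⟨hx, hxR.le⟩ i
  have hall : ∀ y ≥ l, ∀ m, w m y ≤ M * ψ y := by
    intro y hy m
    rcases le_total y R with h | h
    · exact (div_le_iff₀ (hψp y hy)).1 (hKM y ⟨hy, h⟩ m)
    · have := hR y h m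
      nlinarith [hψ0 y hy]
  have hψz := hψp z hzK.1
  have hwz : w j z = M * ψ z := by rw [hM, div_mul_cancel₀ _ hψz.ne']
  have hwz0 : 0 < w j z := by rw [hwz]; exact mul_pos (hδ0.trans_le hδM) hψz
  have hlz : l < z := by
    rcases hzK.1.eq_or_lt with h | h
    · rw [← h] at hwz0
      exact absurd hwz0 (not_lt.2 (hl j))
    · exact h
  have hmax : IsLocalMax (fun y => w j y - M * ψ y) z := by
    filter_upwards [Ioi_mem_nhds hlz] with y hy
    have := hall y (le_of_lt hy) j
    linarith
  have h1 := nonpos_of_isLocalMax_of_hasDerivAt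
    (Eventually.of_forall fun s => (hw j s).sub ((hψ s).const_mul M))
    ((hw' j z).sub ((hψ' z).const_mul M)) hmax
  have h2 := hΔ z hlz j hwz0 fun m =>
    mul_le_mul_of_nonneg_left (by rw [hwz]; exact hall z hzK.1 m) hψz.le
  rw [hwz] at h2
  nlinarith

/-- Strong maximum principle for `z'' ≤ Λ² z` and nonnegative `z`. -/
theorem eq_zero_of_deriv_two_le {Λ l t₀ : ℝ} {z z' z'' : ℝ → ℝ} (hz : ∀ t, HasDerivAt z (z' t) t)
    (hz' : ∀ t, HasDerivAt z' (z'' t) t) (hle : ∀ t > l, z'' t ≤ Λ ^ 2 * z t)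
    (h0 : ∀ t ≥ l, 0 ≤ z t) (ht₀ : l < t₀) (h : z t₀ = 0) : ∀ t > l, z t = 0 := by
  have hmin : IsLocalMin z t₀ := by
    filter_upwards [Ioi_mem_nhds ht₀] with y hy
    rw [h]
    exact h0 y (le_of_lt hy)
  have hd0 : z' t₀ = 0 := by rw [← (hz t₀).deriv]; exact hmin.deriv_eq_zero
  have hexp : ∀ c t : ℝ, HasDerivAt (fun t => Real.exp (c * t)) (Real.exp (c * t) * c) t :=
    fun c t => by simpa using ((hasDerivAt_id t).const_mul c).exp
  have hG : ∀ c t, HasDerivAt (fun t => Real.exp (c * t) * (z' t - c * z t))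
      (Real.exp (c * t) * (z'' t - c ^ 2 * z t)) t := fun c t => by
    refine ((hexp c t).fun_mul ((hz' t).fun_sub ((hz t).const_mul c))).congr_deriv ?_
    ring
  have hH : ∀ c t, HasDerivAt (fun t => Real.exp (-c * t) * z t)
      (Real.exp (-c * t) * (z' t - c * z t)) t := fun c t => by
    refine ((hexp (-c) t).fun_mul (hz t)).congr_deriv ?_
    ring
  have hGanti : ∀ c, c ^ 2 = Λ ^ 2 →
      AntitoneOn (fun t => Real.exp (c * t) * (z' t - c * z t)) (Set.Ioi l) := by
    intro c hc
    refine antitoneOn_of_hasDerivWithinAt_nonpos (convex_Ioi l)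
      (fun t _ => (hG c t).continuousAt.continuousWithinAt)
      (fun t _ => (hG c t).hasDerivWithinAt) fun t ht => ?_
    rw [interior_Ioi] at ht
    refine mul_nonpos_of_nonneg_of_nonpos (Real.exp_pos _).le ?_
    rw [hc]
    linarith [hle t ht]
  have hGt : ∀ c, Real.exp (c * t₀) * (z' t₀ - c * z t₀) = 0 := fun c => by simp [h, hd0]
  intro t ht
  refine le_antisymm ?_ (h0 t (le_of_lt ht))
  suffices hs : ∃ c, Real.exp (-c * t) * z t ≤ Real.exp (-c * t₀) * z t₀ by
    obtain ⟨c, hs⟩ := hs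
    rw [h, mul_zero] at hs
    exact nonpos_of_mul_nonpos_right hs (Real.exp_pos _)
  rcases le_total t₀ t with htt | htt
  · refine ⟨-Λ, ?_⟩
    refine antitoneOn_of_hasDerivWithinAt_nonpos (convex_Ici t₀)
      (fun t _ => (hH (-Λ) t).continuousAt.continuousWithinAt)
      (fun t _ => (hH (-Λ) t).hasDerivWithinAt) (fun s hs => ?_) Set.self_mem_Ici htt htt
    rw [interior_Ici] at hs
    have h1 := hGanti (-Λ) (by ring) (Set.mem_Ioi.2 ht₀) (Set.mem_Ioi.2 (ht₀.trans hs))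
      (le_of_lt hs)
    simp only [hGt] at h1
    exact mul_nonpos_of_nonneg_of_nonpos (Real.exp_pos _).le
      (nonpos_of_mul_nonpos_right h1 (Real.exp_pos _))
  · refine ⟨Λ, ?_⟩
    refine monotoneOn_of_hasDerivWithinAt_nonneg (convex_Icc t t₀)
      (fun t _ => (hH Λ t).continuousAt.continuousWithinAt)
      (fun t _ => (hH Λ t).hasDerivWithinAt) (fun s hs => ?_) ⟨le_rfl, htt⟩ ⟨htt, le_rfl⟩ htt
    rw [interior_Icc] at hs
    have h1 := hGanti Λ rfl (Set.mem_Ioi.2 (ht.trans hs.1)) (Set.mem_Ioi.2 ht₀) hs.2.le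
    simp only [hGt] at h1
    exact mul_nonneg (Real.exp_pos _).le (nonneg_of_mul_nonneg_right h1 (Real.exp_pos _))

/-- Positive homoclinic solutions of `φ_i'' = Λ² φ_i - f_i(φ)`. -/
structure IsProfile (C : Coupling k p) (Λ : ℝ) (φ φ' : Fin k → ℝ → ℝ) : Prop where
  Λ_pos : 0 < Λ
  hasDerivAt : ∀ i t, HasDerivAt (φ i) (φ' i t) t
  hasDerivAt' : ∀ i t, HasDerivAt (φ' i) (Λ ^ 2 * φ i t - C.f i (fun j => φ j t)) t
  bounds : ∃ c > 0, ∃ c' > 0, ∀ i t, c * Real.exp (-(Λ * |t|)) ≤ φ i t ∧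
    φ i t ≤ c' * Real.exp (-(Λ * |t|))

namespace IsProfile

variable {C : Coupling k p} {Λ : ℝ} {φ φ' : Fin k → ℝ → ℝ}

theorem pos (h : IsProfile C Λ φ φ') (i : Fin k) (t : ℝ) : 0 < φ i t := by
  obtain ⟨c, hc, c', hc', hb⟩ := h.bounds
  exact (mul_pos hc (Real.exp_pos _)).trans_le (hb i t).1

theorem tendsto_atTop (h : IsProfile C Λ φ φ') (i : Fin k) : Tendsto (φ i) atTop (𝓝 0) := by
  obtain ⟨c, hc, c', hc', hb⟩ := h.bounds
  refine squeeze_zero (fun t => (h.pos i t).le) (fun t => (hb i t).2) ?_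
  have h1 : Tendsto (fun t : ℝ => -(Λ * |t|)) atTop atBot :=
    tendsto_neg_atTop_atBot.comp (tendsto_abs_atTop_atTop.const_mul_atTop h.Λ_pos)
  simpa using (Real.tendsto_exp_atBot.comp h1).const_mul c'

theorem comp_neg (h : IsProfile C Λ φ φ') :
    IsProfile C Λ (fun i t => φ i (-t)) (fun i t => -φ' i (-t)) where
  Λ_pos := h.Λ_pos
  hasDerivAt i t := by
    exact ((h.hasDerivAt i (-t)).comp t (hasDerivAt_neg t)).congr_deriv (mul_neg_one _)
  hasDerivAt' i t := by
    exact ((h.hasDerivAt' i (-t)).comp t (hasDerivAt_neg t)).fun_neg.congr_deriv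
      (by rw [mul_neg_one, neg_neg])
  bounds := by
    obtain ⟨c, hc, c', hc', hb⟩ := h.bounds
    exact ⟨c, hc, c', hc', fun i t => by simpa using hb i (-t)⟩

theorem exists_tendsto (h : IsProfile C Λ φ φ') (i : Fin k) :
    ∃ L > 0, Tendsto (fun t => Real.exp (Λ * t) * φ i t) atTop (𝓝 L) := by
  obtain ⟨c, hc, c', hc', hb⟩ := h.bounds
  have hΛ := h.Λ_pos
  have hexp : ∀ c t : ℝ, HasDerivAt (fun t => Real.exp (c * t)) (Real.exp (c * t) * c) t :=
    fun c t => by simpa using ((hasDerivAt_id t).const_mul c).exp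
  set H := fun t => Real.exp (Λ * t) * φ i t with hH
  have hHd : ∀ t, HasDerivAt H (Real.exp (Λ * t) * (φ' i t + Λ * φ i t)) t := fun t => by
    refine ((hexp Λ t).fun_mul (h.hasDerivAt i t)).congr_deriv ?_
    ring
  have hHb : ∀ t ≥ 0, c ≤ H t ∧ H t ≤ c' := by
    intro t ht
    have h1 := hb i t
    rw [abs_of_nonneg ht, Real.exp_neg, ← div_eq_mul_inv, ← div_eq_mul_inv,
      div_le_iff₀ (Real.exp_pos _), le_div_iff₀ (Real.exp_pos _)] at h1
    simp only [hH]
    constructor <;> linarith [h1.1, h1.2]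
  set G := fun t => Real.exp (-Λ * t) * (φ' i t + Λ * φ i t) with hG
  have hGd : ∀ t, HasDerivAt G (-(Real.exp (-Λ * t) * C.f i (fun j => φ j t))) t := fun t => by
    refine ((hexp (-Λ) t).fun_mul
      ((h.hasDerivAt' i t).fun_add ((h.hasDerivAt i t).const_mul Λ))).congr_deriv ?_
    ring
  have hGanti : Antitone G := antitone_of_hasDerivAt_nonpos hGd fun t =>
    neg_nonpos.2 (mul_pos (Real.exp_pos _) (C.f_pos (fun j => h.pos j t) i)).le
  have hHG : ∀ t, Real.exp (Λ * t) * (φ' i t + Λ * φ i t) = Real.exp (2 * Λ * t) * G t := by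
    intro t
    simp only [hG]
    rw [← mul_assoc, ← Real.exp_add]
    ring_nf
  have hG0 : ∀ t ≥ 0, 0 ≤ G t := by
    intro t ht
    by_contra! hneg
    have hbd : ∀ s ≥ t, H s ≤ H t + G t * (s - t) := by
      intro s hs
      have hmono : AntitoneOn (fun s => H s - G t * s) (Set.Ici t) := by
        refine antitoneOn_of_hasDerivWithinAt_nonpos (convex_Ici t)
          (fun s _ => ((hHd s).sub ((hasDerivAt_id s).const_mul
            (G t))).continuousAt.continuousWithinAt)
          (fun s _ => ((hHd s).sub ((hasDerivAt_id s).const_mul (G t))).hasDerivWithinAt)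
          fun s hs => ?_
        rw [interior_Ici] at hs
        have hs' : t < s := hs
        have e1 := hGanti hs'.le
        have e2 : 1 ≤ Real.exp (2 * Λ * s) := Real.one_le_exp (by
          have : 0 ≤ s := by linarith
          positivity)
        rw [hHG]
        nlinarith
      have := hmono Set.self_mem_Ici (Set.mem_Ici.2 hs) hs
      simp only at this
      linarith
    have h1 := hbd (t + c' / (-G t)) (by
      have : 0 ≤ c' / (-G t) := div_nonneg hc'.le (by linarith)
      linarith)
    have h2 := hHb (t + c' / (-G t)) (by
      have : 0 ≤ c' / (-G t) := div_nonneg hc'.le (by linarith)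
      linarith)
    have h3 : G t * (t + c' / (-G t) - t) = -c' := by
      have := hneg.ne
      rw [add_sub_cancel_left]
      field_simp
    linarith [(hHb t ht).2]
  have hHmono : MonotoneOn H (Set.Ici 0) := by
    refine monotoneOn_of_hasDerivWithinAt_nonneg (convex_Ici 0)
      (fun t _ => (hHd t).continuousAt.continuousWithinAt)
      (fun t _ => (hHd t).hasDerivWithinAt) fun t ht => ?_
    rw [interior_Ici] at ht
    rw [hHG]
    exact mul_nonneg (Real.exp_pos _).le (hG0 t (le_of_lt ht))
  have hmono' : Monotone (fun t => H (max t 0)) := fun s t hst =>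
    hHmono (Set.mem_Ici.2 (le_max_right _ _)) (Set.mem_Ici.2 (le_max_right _ _))
      (max_le_max_right 0 hst)
  have hbdd : BddAbove (Set.range fun t => H (max t 0)) := by
    refine ⟨c', ?_⟩
    rintro _ ⟨t, rfl⟩
    exact (hHb _ (le_max_right _ _)).2
  have ht := tendsto_atTop_ciSup hmono' hbdd
  refine ⟨_, hc.trans_le ?_, ht.congr' ?_⟩
  · exact (hHb _ (le_max_right 0 0)).1.trans (le_ciSup hbdd 0)
  · filter_upwards [eventually_ge_atTop 0] with t ht
    rw [max_eq_left ht]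

end IsProfile

end Profiles

section ProfileSymmetry

variable {k : ℕ} {p : ℝ}

/-- On the right of `l`, the functions are at most their reflections about `l`. -/
def AxisReached (φ : Fin k → ℝ → ℝ) (l : ℝ) : Prop :=
  ∀ i, ∀ t ≥ l, φ i t ≤ φ i (2 * l - t)

namespace IsProfile

variable {C : Coupling k p} {Λ : ℝ} {φ φ' : Fin k → ℝ → ℝ}

theorem exists_q_bound (h : IsProfile C Λ φ φ') (i₀ : Fin k) : ∃ Q > 0, ∃ T > 0,
    ∀ i t, p * C.q i (fun j => φ j t) ≤ Q ∧
      (T ≤ |t| → p * C.q i (fun j => φ j t) < Λ ^ 2) := by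
  obtain ⟨c, hc, c', hc', hb⟩ := h.bounds
  have hp := C.two_lt i₀
  have hΛ := h.Λ_pos
  choose M hM hMq using fun i => C.exists_q_le (c' := c') hc i
  set S := ∑ i, M i
  have hS : 0 < S := Finset.sum_pos (fun i _ => hM i) ⟨i₀, Finset.mem_univ _⟩
  have hq : ∀ i t, p * C.q i (fun j => φ j t)
      ≤ p * S * Real.exp (-(Λ * (p - 2) * |t|)) := by
    intro i t
    have h1 := hMq i _ (Real.exp_pos _) _ (fun j => hb j t)
    rw [← Real.exp_mul] at h1
    have h2 : M i ≤ S := Finset.single_le_sum (fun i _ => (hM i).le) (Finset.mem_univ i)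
    have h3 : -(Λ * |t|) * (p - 2) = -(Λ * (p - 2) * |t|) := by ring
    rw [h3] at h1
    rw [mul_assoc]
    refine mul_le_mul_of_nonneg_left (h1.trans ?_) (by linarith)
    gcongr
  have hpS : 0 < p * S := mul_pos (by linarith) hS
  have hrate : 0 < Λ * (p - 2) := mul_pos hΛ (by linarith)
  refine ⟨p * S, hpS, max 1 ((Real.log (p * S) - Real.log (Λ ^ 2) + 1) / (Λ * (p - 2))),
    lt_max_of_lt_left one_pos, fun i t => ⟨(hq i t).trans ?_, fun hT => (hq i t).trans_lt ?_⟩⟩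
  · have : Real.exp (-(Λ * (p - 2) * |t|)) ≤ 1 := by
      rw [Real.exp_le_one_iff, neg_nonpos]
      positivity
    nlinarith
  · have h1 := (le_max_right _ _).trans hT
    rw [div_le_iff₀ hrate] at h1
    conv_lhs => rw [← Real.exp_log hpS]
    conv_rhs => rw [← Real.exp_log (show 0 < Λ ^ 2 by positivity)]
    rw [← Real.exp_add, Real.exp_lt_exp]
    linarith

theorem hasDerivAt_reflect (h : IsProfile C Λ φ φ') (l : ℝ) (i : Fin k) (t : ℝ) :
    HasDerivAt (fun t => φ i t - φ i (2 * l - t)) (φ' i t + φ' i (2 * l - t)) t := by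
  have h1 : HasDerivAt (fun t : ℝ => 2 * l - t) (-1) t := (hasDerivAt_id t).const_sub _
  refine ((h.hasDerivAt i t).fun_sub ((h.hasDerivAt i (2 * l - t)).comp t h1)).congr_deriv ?_
  ring

theorem hasDerivAt_reflect' (h : IsProfile C Λ φ φ') (l : ℝ) (i : Fin k) (t : ℝ) :
    HasDerivAt (fun t => φ' i t + φ' i (2 * l - t))
      (Λ ^ 2 * (φ i t - φ i (2 * l - t))
        - (C.f i (fun j => φ j t) - C.f i (fun j => φ j (2 * l - t)))) t := by
  have h1 : HasDerivAt (fun t : ℝ => 2 * l - t) (-1) t := (hasDerivAt_id t).const_sub _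
  refine ((h.hasDerivAt' i t).fun_add ((h.hasDerivAt' i (2 * l - t)).comp t h1)).congr_deriv ?_
  ring

theorem tendsto_reflect (h : IsProfile C Λ φ φ') (l : ℝ) (i : Fin k) :
    Tendsto (fun t => φ i t - φ i (2 * l - t)) atTop (𝓝 0) := by
  have h2 := (h.comp_neg.tendsto_atTop i).comp (tendsto_atTop_add_const_right atTop (-(2 * l))
    tendsto_id)
  have h3 : Tendsto (fun t => φ i (2 * l - t)) atTop (𝓝 0) := h2.congr fun t => by
    simp only [Function.comp, id]
    congr 1
    ring
  simpa using (h.tendsto_atTop i).sub h3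

theorem exists_axisReached_criterion (h : IsProfile C Λ φ φ') (i₀ : Fin k) :
    ∃ T > 0, ∃ M > 0, ∀ l,
      (∀ i t, t ≤ T → l + M⁻¹ ≤ t → φ i t ≤ φ i (2 * l - t)) → AxisReached φ l := by
  obtain ⟨Q, hQ, T, hT, hq⟩ := h.exists_q_bound i₀
  have hΛ := h.Λ_pos
  set M := 1 + 2 * Q * Real.exp 1 with hM
  have hM1 : 1 < M := by
    have := Real.exp_pos 1
    rw [hM]
    have : 0 < 2 * Q * Real.exp 1 := by positivity
    linarith
  refine ⟨T, hT, M, by linarith, fun l hl => ?_⟩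
  have hlin : ∀ t : ℝ, HasDerivAt (fun t => -(M * (t - l))) (-M) t := fun t => by
    simpa using (((hasDerivAt_id t).sub_const l).const_mul M).fun_neg
  have key := nonpos_of_weighted_maximum_Ici (l := l)
    (ψ := fun t => 1 - 1 / 2 * Real.exp (-(M * (t - l))))
    (ψ' := fun t => M / 2 * Real.exp (-(M * (t - l))))
    (ψ'' := fun t => -(M ^ 2 / 2 * Real.exp (-(M * (t - l)))))
    (fun t => (((hlin t).exp.const_mul (1 / 2 : ℝ)).const_sub 1).congr_deriv (by ring))
    (fun t => ((hlin t).exp.const_mul (M / 2)).congr_deriv (by ring))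
    (fun t ht => by
      have : Real.exp (-(M * (t - l))) ≤ 1 := by
        rw [Real.exp_le_one_iff, neg_nonpos]
        exact mul_nonneg (by linarith) (by linarith)
      linarith)
    (h.hasDerivAt_reflect l) (h.hasDerivAt_reflect' l) (fun i => by
      rw [show 2 * l - l = l by ring, sub_self])
    (h.tendsto_reflect l) ?_
  · intro i t ht
    linarith [key t ht i]
  intro t ht i hi hmax
  have hexp := Real.exp_pos (-(M * (t - l)))
  have hexp1 : Real.exp (-(M * (t - l))) ≤ 1 := by
    rw [Real.exp_le_one_iff, neg_nonpos]
    exact mul_nonneg (by linarith) (by linarith)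
  set ε := Real.exp (-(M * (t - l))) with hε
  set d := φ i t - φ i (2 * l - t) with hd
  have hψ : 0 < 1 - 1 / 2 * ε := by linarith
  have hmax' : ∀ j, φ j t - d ≤ φ j (2 * l - t) := fun j => by
    have := le_of_mul_le_mul_left (hmax j) hψ
    linarith
  have hf := C.f_sub_le (fun j => h.pos j t) (fun j => h.pos j (2 * l - t)) hi.le hmax' i
  obtain ⟨hq1, hq2⟩ := hq i t
  have hcase : p * C.q i (fun j => φ j t) * (1 - 1 / 2 * ε)
      < Λ ^ 2 * (1 - 1 / 2 * ε) + M ^ 2 / 2 * ε := by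
    by_cases h1 : T ≤ |t|
    · have := mul_lt_mul_of_pos_right (hq2 h1) hψ
      have : 0 < M ^ 2 / 2 * ε := by positivity
      linarith
    · have h2 : t < l + M⁻¹ := by
        by_contra! h3
        have := hl i t ((le_abs_self t).trans (not_le.1 h1).le) h3
        linarith
      have h3 : Real.exp (-1) ≤ ε := by
        rw [hε, Real.exp_le_exp]
        have : M * (t - l) ≤ M * M⁻¹ := by
          refine mul_le_mul_of_nonneg_left ?_ (by linarith)
          linarith
        rw [mul_inv_cancel₀ (by linarith)] at this
        linarith
      have h4 : Real.exp 1 * Real.exp (-1) = 1 := by rw [← Real.exp_add]; simp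
      have h5 : 2 * Q < M * ε := by
        have e1 : M * Real.exp (-1) = Real.exp (-1) + 2 * Q := by
          rw [hM]; linear_combination 2 * Q * h4
        have e2 : M * Real.exp (-1) ≤ M * ε := mul_le_mul_of_nonneg_left h3 (by linarith)
        have := Real.exp_pos (-1)
        linarith
      have h6 : M * ε ≤ M ^ 2 * ε := by
        refine mul_le_mul_of_nonneg_right ?_ hexp.le
        nlinarith
      have h7 : p * C.q i (fun j => φ j t) * (1 - 1 / 2 * ε) ≤ Q * 1 :=
        mul_le_mul hq1 (by linarith) hψ.le hQ.le
      have : 0 < Λ ^ 2 * (1 - 1 / 2 * ε) := by positivity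
      linarith
  have h8 := mul_lt_mul_of_pos_right hcase hi
  have h9 := mul_le_mul_of_nonneg_left hf hψ.le
  nlinarith

theorem even_of_eq (h : IsProfile C Λ φ φ') {l : ℝ} (hl : AxisReached φ l) {i : Fin k} {t₀ : ℝ}
    (ht₀ : l < t₀) (heq : φ i (2 * l - t₀) = φ i t₀) : ∀ j t, φ j (2 * l - t) = φ j t := by
  have hf : ∀ j, ∀ t ≥ l, C.f j (fun m => φ m t) ≤ C.f j (fun m => φ m (2 * l - t)) :=
    fun j t ht => C.f_mono (fun m => h.pos m t) (fun m => hl m t ht) j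
  have hz : ∀ t > l, -(φ i t - φ i (2 * l - t)) = 0 :=
    eq_zero_of_deriv_two_le (Λ := Λ) (fun t => (h.hasDerivAt_reflect l i t).fun_neg)
      (fun t => (h.hasDerivAt_reflect' l i t).fun_neg)
      (fun t ht => by linarith [hf i t (le_of_lt ht)]) (fun t ht => by linarith [hl i t ht]) ht₀
      (by linarith)
  have hfz : ∀ t > l, C.f i (fun m => φ m t) = C.f i (fun m => φ m (2 * l - t)) := by
    intro t ht
    have e1 : (fun t => φ i t - φ i (2 * l - t)) =ᶠ[𝓝 t] fun _ => 0 := by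
      filter_upwards [Ioi_mem_nhds ht] with s hs
      linarith [hz s hs]
    have e2 : (fun t => φ' i t + φ' i (2 * l - t)) =ᶠ[𝓝 t] fun _ => 0 := by
      filter_upwards [e1.eventually_nhds] with s hs
      rw [← (h.hasDerivAt_reflect l i s).deriv, Filter.EventuallyEq.deriv_eq hs, deriv_const]
    have e3 := (h.hasDerivAt_reflect' l i t).deriv
    rw [e2.deriv_eq, deriv_const] at e3
    have e4 := hz t ht
    nlinarith
  have hright : ∀ j, ∀ t > l, φ j (2 * l - t) = φ j t := by
    intro j t ht
    by_contra hne
    have hlt : φ j t < φ j (2 * l - t) := lt_of_le_of_ne (hl j t (le_of_lt ht)) (Ne.symm hne)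
    exact (C.f_strictMono (fun m => h.pos m t) (fun m => hl m t (le_of_lt ht)) hlt i).ne (hfz t ht)
  intro j t
  rcases lt_trichotomy l t with ht | rfl | ht
  · exact hright j t ht
  · ring_nf
  · have := hright j (2 * l - t) (by linarith)
    rw [sub_sub_cancel] at this
    exact this.symm

theorem axisReached_of_forall_gt (h : IsProfile C Λ φ φ') {l : ℝ}
    (hl : ∀ m > l, AxisReached φ m) : AxisReached φ l := by
  have hc : ∀ i, Continuous (φ i) := fun i =>
    continuous_iff_continuousAt.2 fun t => (h.hasDerivAt i t).continuousAt
  intro i t ht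
  have h1 : Tendsto (fun s : ℝ => φ i (t + s)) (𝓝[>] 0) (𝓝 (φ i (t + 0))) :=
    ((hc i).comp (continuous_const.add continuous_id)).continuousAt.continuousWithinAt
  have h2 : Tendsto (fun s : ℝ => φ i (2 * (l + s) - (t + s))) (𝓝[>] 0)
      (𝓝 (φ i (2 * (l + 0) - (t + 0)))) := by
    have : Continuous fun s : ℝ => φ i (2 * (l + s) - (t + s)) := (hc i).comp (by fun_prop)
    exact this.continuousAt.continuousWithinAt
  have h3 := le_of_tendsto_of_tendsto h1 h2 (by
    filter_upwards [self_mem_nhdsWithin] with s hs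
    have hs' : 0 < s := hs
    exact hl (l + s) (by linarith) i (t + s) (by linarith))
  simpa using h3

theorem exists_axisReached_continuation (h : IsProfile C Λ φ φ') (i₀ : Fin k) {l : ℝ}
    (hlt : ∀ i, ∀ t > l, φ i t < φ i (2 * l - t)) :
    ∃ ε > 0, ∀ m, l - ε < m → m ≤ l → AxisReached φ m := by
  have hc : ∀ i, Continuous (φ i) := fun i =>
    continuous_iff_continuousAt.2 fun t => (h.hasDerivAt i t).continuousAt
  obtain ⟨T, hT, M, hM, hcrit⟩ := h.exists_axisReached_criterion i₀
  have hM' := inv_pos.2 hM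
  have hev : ∀ᶠ m in 𝓝 l, ∀ t ∈ Set.Icc (l + M⁻¹ / 2) T, ∀ i, φ i t ≤ φ i (2 * m - t) := by
    refine isCompact_Icc.eventually_forall_of_forall_eventually fun t ht =>
      eventually_all.2 fun i => ?_
    have c1 : Continuous (fun z : ℝ × ℝ => φ i z.2) := (hc i).comp continuous_snd
    have c2 : Continuous (fun z : ℝ × ℝ => φ i (2 * z.1 - z.2)) := (hc i).comp (by fun_prop)
    have := (c1.continuousAt (x := (l, t))).eventually_lt c2.continuousAt
      (hlt i t (by linarith [ht.1]))
    exact this.mono fun z hz => le_of_lt hz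
  obtain ⟨ε, hε, hball⟩ := Metric.eventually_nhds_iff.1 hev
  refine ⟨min ε (M⁻¹ / 2), lt_min hε (by positivity), fun m hm hml => ?_⟩
  have h1 := min_le_left ε (M⁻¹ / 2)
  have h2 := min_le_right ε (M⁻¹ / 2)
  refine hcrit m fun i t htT ht => hball ?_ t ⟨by linarith, htT⟩ i
  rw [Real.dist_eq, abs_lt]
  constructor <;> linarith

/-- All components of a profile are even and strictly decreasing about one common axis. -/
theorem exists_axis (h : IsProfile C Λ φ φ') (i₀ : Fin k) :
    ∃ l, ∀ i, (∀ t, φ i (2 * l - t) = φ i t) ∧ StrictAntiOn (φ i) (Set.Ici l) := by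
  obtain ⟨T, hT, M, hM, hcrit⟩ := h.exists_axisReached_criterion i₀
  have hM' := inv_pos.2 hM
  set S : Set ℝ := {l | ∀ m > l, AxisReached φ m} with hS
  have hTS : T ∈ S := fun m hm => hcrit m fun i t h1 h2 => by
    have : T < m := hm
    linarith
  have hbdd : BddBelow S := by
    obtain ⟨R, hR⟩ := eventually_atTop.1
      ((h.comp_neg.tendsto_atTop i₀).eventually_lt_const (h.pos i₀ 0))
    refine ⟨-(max R 0) - 1, fun l hl => ?_⟩
    by_contra! hlt
    have h1 := hl (-(max R 0)) (by linarith) i₀ 0 (by linarith [le_max_right R 0])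
    have h2 := hR (2 * max R 0) (by linarith [le_max_left R 0, le_max_right R 0])
    rw [show 2 * -(max R 0) - 0 = -(2 * max R 0) by ring] at h1
    linarith
  set l := sInf S
  have hgt : ∀ m > l, AxisReached φ m := fun m hm => by
    obtain ⟨s, hs, hsm⟩ := exists_lt_of_csInf_lt ⟨T, hTS⟩ hm
    exact hs m hsm
  have hl := h.axisReached_of_forall_gt hgt
  have heven : ∀ j t, φ j (2 * l - t) = φ j t := by
    by_contra hne
    have hlt : ∀ i, ∀ t > l, φ i t < φ i (2 * l - t) := fun i t ht =>
      lt_of_le_of_ne (hl i t (le_of_lt ht)) fun heq => hne (h.even_of_eq hl ht heq.symm)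
    obtain ⟨ε, hε, hcont⟩ := h.exists_axisReached_continuation i₀ hlt
    have hmem : l - ε / 2 ∈ S := fun m hm => by
      rcases le_or_gt m l with hml | hml
      · have : l - ε / 2 < m := hm
        exact hcont m (by linarith) hml
      · exact hgt m hml
    have := csInf_le hbdd hmem
    linarith
  have hgt' : ∀ m > l, ∀ i, ∀ t > m, φ i t < φ i (2 * m - t) := by
    intro m hm i t ht
    refine lt_of_le_of_ne (hgt m hm i t (le_of_lt ht)) fun heq => ?_
    have he := h.even_of_eq (hgt m hm) ht heq.symm
    have hper : Function.Periodic (φ i) (2 * (m - l)) := fun s => by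
      rw [← he i, ← heven i]
      congr 1
      ring
    have hm' : 0 < 2 * (m - l) := by
      have : l < m := hm
      linarith
    have ht := (h.tendsto_atTop i).comp (tendsto_natCast_atTop_atTop.atTop_mul_const hm')
    have hconst : ∀ N : ℕ, φ i 0 = φ i (N * (2 * (m - l))) := fun N => by
      rw [← zero_add ((N : ℝ) * (2 * (m - l))), hper.nat_mul N 0]
    have h0 := tendsto_nhds_unique (ht.congr fun N => (hconst N).symm) tendsto_const_nhds
    exact (h.pos i 0).ne h0
  refine ⟨l, fun i => ⟨heven i, fun s hs t ht hst => ?_⟩⟩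
  have hs' : l ≤ s := hs
  have := hgt' ((s + t) / 2) (show l < (s + t) / 2 by linarith) i t (by linarith)
  rwa [show 2 * ((s + t) / 2) - t = s by ring] at this

end IsProfile

end ProfileSymmetry

section RadialProfiles

open InnerProductSpace Laplacian

variable {n k : ℕ} {p : ℝ}

local notation "E" n => EuclideanSpace ℝ (Fin n)

/-- In logarithmic coordinates, the components of a decaying solution are given by a profile. -/
theorem IsDecayingSolution.exists_isProfile {C : Coupling k p} {N Λ : ℝ} {v : Fin k → (E n) → ℝ}
    (hv : IsDecayingSolution C N Λ v) {e : E n} (he : ‖e‖ = 1) :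
    ∃ φ φ' : Fin k → ℝ → ℝ, IsProfile C Λ φ φ' ∧
      ∀ i, ∀ x ≠ 0, ‖x‖ ^ N * v i x = φ i (Real.log ‖x‖) := by
  set F : Fin k → ℝ → ℝ := fun i s => v i (Real.exp s • e) with hF
  have hnorm : ∀ s : ℝ, ‖Real.exp s • e‖ = Real.exp s := fun s => by
    rw [norm_smul, he, mul_one, Real.norm_eq_abs, abs_of_pos (Real.exp_pos s)]
  have hne : ∀ s : ℝ, Real.exp s • e ≠ 0 := fun s => by
    rw [← norm_pos_iff, hnorm]
    exact Real.exp_pos s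
  have hrpow : ∀ s M : ℝ, Real.exp s ^ M = Real.exp (M * s) := fun s M => by
    rw [← Real.exp_mul, mul_comm]
  have hvF : ∀ i, ∀ x ≠ 0, v i x = F i (Real.log ‖x‖) := fun i x hx => by
    refine hv.radial i hx ?_
    rw [hnorm, Real.exp_log (norm_pos_iff.2 hx)]
  have hFc : ∀ i, ContDiff ℝ 2 (F i) := fun i => contDiff_iff_contDiffAt.2 fun s =>
    (hv.contDiffAt i _ (hne s)).comp (f := fun s : ℝ => Real.exp s • e) s
      (Real.contDiff_exp.smul contDiff_const).contDiffAt
  have hF1 : ∀ i s, HasDerivAt (F i) (deriv (F i) s) s := fun i s =>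
    ((hFc i).differentiable (by norm_num) s).hasDerivAt
  have hF2 : ∀ i s, HasDerivAt (deriv (F i)) (deriv (deriv (F i)) s) s := fun i s =>
    (((contDiff_succ_iff_deriv (n := 1)).1 (hFc i)).2.2.differentiable (by norm_num) s).hasDerivAt
  have hode : ∀ i s, deriv (deriv (F i)) s + 2 * N * deriv (F i) s
      = -((N ^ 2 - Λ ^ 2) * F i s
        + Real.exp (-N * s) * C.f i (fun j => Real.exp (N * s) * F j s)) := by
    intro i s
    have h1 : v i =ᶠ[𝓝 (Real.exp s • e)] fun y => F i (Real.log ‖y‖) :=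
      (eventually_ne_zero (hne s)).mono fun y hy => hvF i y hy
    have h2 := hv.laplacian i _ (hne s)
    rw [(laplacian_congr_nhds h1).self_of_nhds, laplacian_comp_log_norm (hF1 i) (hne s) (hF2 i _),
      hnorm, Real.log_exp, mul_inv_cancel_left₀ (by positivity), hv.dim, hrpow, hrpow] at h2
    rw [← h2]
    ring
  have hexp : ∀ s : ℝ, HasDerivAt (fun s => Real.exp (N * s)) (Real.exp (N * s) * N) s :=
    fun s => by simpa using ((hasDerivAt_id s).const_mul N).exp
  refine ⟨fun i s => Real.exp (N * s) * F i s,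
    fun i s => Real.exp (N * s) * (N * F i s + deriv (F i) s),
    ⟨hv.Λ_pos, fun i s => ?_, fun i s => ?_, ?_⟩, fun i x hx => ?_⟩
  · exact ((hexp s).fun_mul (hF1 i s)).congr_deriv (by ring)
  · refine ((hexp s).fun_mul (((hF1 i s).const_mul N).fun_add (hF2 i s))).congr_deriv ?_
    have h1 := hode i s
    have h2 : Real.exp (N * s) * Real.exp (-N * s) = 1 := by
      rw [← Real.exp_add]
      simp
    have h3 : Real.exp (N * s) * (deriv (deriv (F i)) s + 2 * N * deriv (F i) s)
        = -((N ^ 2 - Λ ^ 2) * (Real.exp (N * s) * F i s)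
          + C.f i (fun j => Real.exp (N * s) * F j s)) := by
      rw [h1]
      linear_combination -(C.f i (fun j => Real.exp (N * s) * F j s)) * h2
    linear_combination h3
  · obtain ⟨c, hc, c', hc', hb⟩ := hv.bounds
    refine ⟨c, hc, c', hc', fun i s => ?_⟩
    have := hb i _ (hne s)
    rwa [hnorm, Real.log_exp, hrpow] at this
  · rw [hvF i x hx, norm_rpow_eq_exp N hx]

end RadialProfiles

section Averages

open InnerProductSpace Laplacian

variable {n k : ℕ} {p : ℝ}

local notation "E" n => EuclideanSpace ℝ (Fin n)

/-- A radial cutoff function supported in the closed unit ball. -/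
def bump (m : ℕ) (x : E n) : ℝ := max (1 - ‖x‖ ^ 2) 0 ^ m

theorem bump_nonneg (m : ℕ) (x : E n) : 0 ≤ bump m x := pow_nonneg (le_max_right _ _) m

theorem bump_base_le_one (x : E n) : max (1 - ‖x‖ ^ 2) 0 ≤ 1 :=
  max_le (by linarith [sq_nonneg ‖x‖]) zero_le_one

theorem bump_le_one (m : ℕ) (x : E n) : bump m x ≤ 1 :=
  pow_le_one₀ (le_max_right _ _) (bump_base_le_one x)

theorem bump_eq_zero {m : ℕ} (hm : m ≠ 0) {x : E n} (hx : 1 ≤ ‖x‖) : bump m x = 0 := by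
  rw [bump, max_eq_right (by nlinarith), zero_pow hm]

theorem continuous_bump (m : ℕ) : Continuous (bump m : (E n) → ℝ) :=
  ((continuous_const.sub (continuous_norm.pow 2)).max continuous_const).pow m

theorem hasCompactSupport_bump {m : ℕ} (hm : m ≠ 0) :
    HasCompactSupport (bump m : (E n) → ℝ) :=
  HasCompactSupport.intro (isCompact_closedBall 0 1) fun x hx =>
    bump_eq_zero hm (by simpa using (not_le.1 fun h => hx (by simpa using h)).le)

theorem hasDerivAt_max_zero_pow (m : ℕ) (t : ℝ) :
    HasDerivAt (fun t : ℝ => max t 0 ^ (m + 2)) ((m + 2) * max t 0 ^ (m + 1)) t := by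
  rcases lt_trichotomy t 0 with ht | rfl | ht
  · have h1 : (fun t : ℝ => max t 0 ^ (m + 2)) =ᶠ[𝓝 t] fun _ => 0 := by
      filter_upwards [Iio_mem_nhds ht] with s hs
      rw [max_eq_right (le_of_lt hs), zero_pow (by omega)]
    rw [max_eq_right ht.le, zero_pow (by omega), mul_zero]
    exact (hasDerivAt_const t 0).congr_of_eventuallyEq h1
  · rw [max_self, zero_pow (by omega), mul_zero, hasDerivAt_iff_isLittleO]
    simp only [max_self, sub_zero, smul_zero]
    rw [zero_pow (by omega)]
    simp only [sub_zero]
    refine Asymptotics.IsBigO.trans_isLittleO (g := fun t : ℝ => t ^ (m + 2)) ?_ ?_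
    · refine Asymptotics.isBigO_of_le _ fun s => ?_
      rw [norm_pow, norm_pow]
      refine pow_le_pow_left₀ (norm_nonneg _) ?_ _
      rw [Real.norm_eq_abs, Real.norm_eq_abs]
      rcases le_total s 0 with h | h
      · rw [max_eq_right h, abs_zero]; exact abs_nonneg s
      · rw [max_eq_left h]
    · exact Asymptotics.isLittleO_pow_id (by omega)
  · have h1 : (fun t : ℝ => max t 0 ^ (m + 2)) =ᶠ[𝓝 t] fun t => t ^ (m + 2) := by
      filter_upwards [Ioi_mem_nhds ht] with s hs
      rw [max_eq_left (le_of_lt hs)]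
    rw [max_eq_left ht.le]
    refine ((hasDerivAt_pow (m + 2) t).congr_of_eventuallyEq h1).congr_deriv ?_
    push_cast
    ring_nf

theorem hasFDerivAt_bump (m : ℕ) (x : E n) :
    HasFDerivAt (bump (m + 2)) (-(2 * (m + 2) * bump (m + 1) x) • innerSL ℝ x) x := by
  have h1 : HasFDerivAt (fun y : E n => 1 - ‖y‖ ^ 2) (-(2 • innerSL ℝ x)) x :=
    (hasStrictFDerivAt_norm_sq x).hasFDerivAt.const_sub 1
  refine ((hasDerivAt_max_zero_pow m _).comp_hasFDerivAt x h1).congr_fderiv ?_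
  ext y
  simp [bump]
  ring

theorem integral_bump_pos (m : ℕ) (hm : m ≠ 0) : 0 < ∫ x : E n, bump m x :=
  (continuous_bump m).integral_pos_of_hasCompactSupport_nonneg_nonzero (x := 0)
    (hasCompactSupport_bump hm) (fun x => bump_nonneg m x) (by simp [bump])

theorem integrable_bump_mul {m : ℕ} (hm : m ≠ 0) {g : (E n) → ℝ} (hg : Continuous g) :
    Integrable fun x => bump m x * g x :=
  ((continuous_bump m).mul hg).integrable_of_hasCompactSupport
    ((hasCompactSupport_bump hm).mul_right)

theorem continuous_fderiv_apply {g : (E n) → ℝ} (hg : ContDiff ℝ 2 g) (e : E n) :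
    ContDiff ℝ 1 (fun y => fderiv ℝ g y e) :=
  (hg.fderiv_right (m := 1) (by norm_num)).clm_apply contDiff_const

theorem laplacian_eq_sum_fderiv_apply {g : (E n) → ℝ} (hg : ContDiff ℝ 2 g) (x : E n) :
    Δ g x = ∑ i, fderiv ℝ (fun y => fderiv ℝ g y (EuclideanSpace.basisFun (Fin n) ℝ i)) x
      (EuclideanSpace.basisFun (Fin n) ℝ i) := by
  rw [laplacian_eq_sum_fderiv_fderiv (EuclideanSpace.basisFun (Fin n) ℝ)]
  refine Finset.sum_congr rfl fun i _ => ?_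
  have h1 : DifferentiableAt ℝ (fderiv ℝ g) x :=
    (hg.fderiv_right (m := 1) (by norm_num)).differentiable (by norm_num) x
  have h2 := h1.hasFDerivAt.clm_apply
    (hasFDerivAt_const (EuclideanSpace.basisFun (Fin n) ℝ i) x)
  rw [h2.fderiv]
  simp

theorem continuous_laplacian {g : (E n) → ℝ} (hg : ContDiff ℝ 2 g) : Continuous (Δ g) := by
  have : Δ g = fun x => ∑ i, fderiv ℝ (fun y => fderiv ℝ g y
      (EuclideanSpace.basisFun (Fin n) ℝ i)) x (EuclideanSpace.basisFun (Fin n) ℝ i) :=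
    funext fun x => laplacian_eq_sum_fderiv_apply hg x
  rw [this]
  exact continuous_finsetSum _ fun i _ =>
    ((continuous_fderiv_apply hg _).continuous_fderiv (by norm_num)).clm_apply continuous_const

/-- Integration by parts against a cutoff. -/
theorem integral_bump_mul_laplacian (m : ℕ) {g : (E n) → ℝ} (hg : ContDiff ℝ 2 g) :
    ∫ x, bump (m + 2) x * Δ g x = 2 * (m + 2) * ∫ x, bump (m + 1) x * fderiv ℝ g x x := by
  set b := EuclideanSpace.basisFun (Fin n) ℝ with hb
  set G : Fin n → (E n) → ℝ := fun i y => fderiv ℝ g y (b i) with hG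
  have hGc : ∀ i, ContDiff ℝ 1 (G i) := fun i => continuous_fderiv_apply hg _
  have hGd : ∀ i, Continuous fun x => fderiv ℝ (G i) x (b i) := fun i =>
    ((hGc i).continuous_fderiv (by norm_num)).clm_apply continuous_const
  have hin : ∀ i, Continuous fun x : E n => (inner ℝ x (b i) : ℝ) := fun i =>
    (contDiff_inner_const (b i)).continuous
  have hfd : ∀ i (x : E n), fderiv ℝ (bump (m + 2)) x (b i)
      = -(2 * (m + 2)) * (bump (m + 1) x * inner ℝ x (b i)) := fun i x => by
    rw [(hasFDerivAt_bump m x).fderiv]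
    simp
    ring
  have h_int : ∀ i, Integrable fun x => bump (m + 1) x * (inner ℝ x (b i) * G i x) := fun i =>
    integrable_bump_mul (by omega) ((hin i).mul (hGc i).continuous)
  have hibp : ∀ i, ∫ x, bump (m + 2) x * fderiv ℝ (G i) x (b i)
      = 2 * (m + 2) * ∫ x, bump (m + 1) x * (inner ℝ x (b i) * G i x) := by
    intro i
    have heq : (fun x => fderiv ℝ (bump (m + 2)) x (b i) * G i x)
        = fun x => -(2 * ((m : ℝ) + 2)) * (bump (m + 1) x * (inner ℝ x (b i) * G i x)) := by
      funext x
      rw [hfd]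
      ring
    rw [integral_mul_fderiv_eq_neg_fderiv_mul_of_integrable (v := b i) ?_ ?_ ?_ ?_ ?_, heq,
      integral_const_mul]
    · ring
    · rw [heq]
      exact (h_int i).const_mul _
    · exact integrable_bump_mul (by omega) (hGd i)
    · exact integrable_bump_mul (by omega) (hGc i).continuous
    · exact fun x _ => (hasFDerivAt_bump m x).differentiableAt
    · exact fun x _ => (hGc i).differentiable (by norm_num) x
  have h1 : ∀ x, bump (m + 2) x * Δ g x = ∑ i, bump (m + 2) x * fderiv ℝ (G i) x (b i) :=
    fun x => by rw [laplacian_eq_sum_fderiv_apply hg, Finset.mul_sum]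
  have h2 : ∀ x, bump (m + 1) x * fderiv ℝ g x x
      = ∑ i, bump (m + 1) x * (inner ℝ x (b i) * G i x) := fun x => by
    have e1 : fderiv ℝ g x x = fderiv ℝ g x (∑ i, b.repr x i • b i) := by rw [b.sum_repr]
    rw [e1, map_sum, Finset.mul_sum]
    refine Finset.sum_congr rfl fun i _ => ?_
    rw [map_smul, smul_eq_mul, b.repr_apply_apply, real_inner_comm]
  simp only [h1, h2]
  rw [integral_finsetSum _ fun i _ => integrable_bump_mul (by omega) (hGd i),
    integral_finsetSum _ fun i _ => h_int i, Finset.mul_sum]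
  exact Finset.sum_congr rfl fun i _ => hibp i

end Averages

section MeanValue

open InnerProductSpace Laplacian

variable {n k : ℕ} {p : ℝ}

local notation "E" n => EuclideanSpace ℝ (Fin n)

theorem continuous_add_smul (y : E n) (r : ℝ) : Continuous fun x : E n => y + r • x := by
  fun_prop

theorem contDiff_comp_add_smul {f : (E n) → ℝ} (hf : ContDiff ℝ 2 f) (y : E n) (r : ℝ) :
    ContDiff ℝ 2 fun x => f (y + r • x) :=
  hf.comp (by fun_prop)

theorem fderiv_comp_add_smul {f : (E n) → ℝ} (hf : ContDiff ℝ 2 f) (y : E n) (r : ℝ) (x : E n) :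
    fderiv ℝ (fun x => f (y + r • x)) x = r • fderiv ℝ f (y + r • x) := by
  have h1 : HasFDerivAt (fun x : E n => y + r • x) (r • ContinuousLinearMap.id ℝ (E n)) x :=
    ((hasFDerivAt_id x).const_smul r).const_add y
  have h2 := ((hf.differentiable (by norm_num) (y + r • x)).hasFDerivAt.comp x h1).fderiv
  refine h2.trans ?_
  ext z
  simp

theorem laplacian_comp_add_smul {f : (E n) → ℝ} (hf : ContDiff ℝ 2 f) (y : E n) (r : ℝ)
    (x : E n) : Δ (fun x => f (y + r • x)) x = r ^ 2 * Δ f (y + r • x) :=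
  laplacian_comp_similarity (LinearIsometryEquiv.refl ℝ (E n)) r y hf.contDiffAt

theorem hasDerivAt_integral_bump {f : (E n) → ℝ} (hf : ContDiff ℝ 2 f) (y : E n) (r : ℝ) :
    HasDerivAt (fun r : ℝ => ∫ x, bump 2 x * f (y + r • x))
      (∫ x, bump 2 x * fderiv ℝ f (y + r • x) x) r := by
  have hfc := hf.continuous
  have hfd : Continuous (fderiv ℝ f) := hf.continuous_fderiv (by norm_num)
  obtain ⟨B, hB⟩ := (isCompact_closedBall y (|r| + 1)).exists_bound_of_continuousOn
    hfd.continuousOn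
  have hcont : ∀ s : ℝ, Continuous fun x : E n => f (y + s • x) := fun s =>
    (contDiff_comp_add_smul hf y s).continuous
  refine (hasDerivAt_integral_of_dominated_loc_of_deriv_le (Metric.ball_mem_nhds r one_pos)
    (Eventually.of_forall fun s => (integrable_bump_mul (by norm_num)
      (hcont s)).aestronglyMeasurable)
    (integrable_bump_mul (by norm_num) (hcont r))
    (F' := fun s x => bump 2 x * fderiv ℝ f (y + s • x) x) ?_ (bound := fun x => bump 2 x * B)
    (Eventually.of_forall fun x s hs => ?_) (integrable_bump_mul (by norm_num) continuous_const)
    (Eventually.of_forall fun x s hs => ?_)).2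
  · have h1 : Continuous fun x : E n => fderiv ℝ f (y + r • x) x :=
      (hfd.comp (continuous_add_smul y r)).clm_apply continuous_id'
    exact (integrable_bump_mul (by norm_num) h1).aestronglyMeasurable
  · rw [norm_mul, Real.norm_eq_abs, abs_of_nonneg (bump_nonneg 2 x)]
    rcases le_total 1 ‖x‖ with hx | hx
    · rw [bump_eq_zero two_ne_zero hx, zero_mul, zero_mul]
    refine mul_le_mul_of_nonneg_left ?_ (bump_nonneg 2 x)
    have hs' : |s - r| < 1 := by simpa [Real.dist_eq] using hs
    have hmem : y + s • x ∈ Metric.closedBall y (|r| + 1) := by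
      rw [Metric.mem_closedBall, dist_eq_norm, add_sub_cancel_left, norm_smul, Real.norm_eq_abs]
      have h1 : |s| ≤ |r| + 1 := by
        have := abs_add_le (s - r) r
        rw [sub_add_cancel] at this
        linarith
      have := mul_le_mul h1 hx (norm_nonneg _) (by positivity)
      linarith
    have h2 := hB _ hmem
    have h3 := (fderiv ℝ f (y + s • x)).le_opNorm x
    have h4 := mul_le_mul h2 hx (norm_nonneg _) ((norm_nonneg _).trans h2)
    linarith
  · have h1 : HasDerivAt (fun s : ℝ => y + s • x) x s := by
      simpa using ((hasDerivAt_id s).smul_const x).const_add y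
    exact ((hf.differentiable (by norm_num) (y + s • x)).hasFDerivAt.comp_hasDerivAt s
      h1).const_mul _

/-- Mean value inequality for functions with Laplacian bounded below. -/
theorem mul_integral_bump_le {f : (E n) → ℝ} (hf : ContDiff ℝ 2 f) {y : E n} {ρ K : ℝ}
    (hρ : 0 < ρ) (hK : ∀ z, ‖z - y‖ < ρ → -K ≤ Δ f z) :
    f y * ∫ x : E n, bump 2 x
      ≤ (∫ x, bump 2 x * f (y + ρ • x)) + K * ρ ^ 2 / 12 * ∫ x : E n, bump 3 x := by
  set I3 := ∫ x : E n, bump 3 x with hI3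
  set M : ℝ → ℝ := fun r => ∫ x, bump 2 x * f (y + r • x) with hM
  have hd : ∀ r, HasDerivAt (fun r => M r + K * r ^ 2 / 12 * I3)
      ((∫ x, bump 2 x * fderiv ℝ f (y + r • x) x) + K * r / 6 * I3) r := by
    intro r
    have h1 : HasDerivAt (fun r : ℝ => K * r ^ 2 / 12 * I3) (K * r / 6 * I3) r :=
      ((((hasDerivAt_pow 2 r).const_mul K).div_const 12).mul_const I3).congr_deriv (by
        push_cast; ring)
    exact (hasDerivAt_integral_bump hf y r).fun_add h1
  have hmono : MonotoneOn (fun r => M r + K * r ^ 2 / 12 * I3) (Set.Icc 0 ρ) := by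
    refine monotoneOn_of_hasDerivWithinAt_nonneg (convex_Icc 0 ρ)
      (fun t _ => (hd t).continuousAt.continuousWithinAt)
      (fun t _ => (hd t).hasDerivWithinAt) fun r hr => ?_
    rw [interior_Icc] at hr
    obtain ⟨hr0, hrρ⟩ := hr
    have h1 := integral_bump_mul_laplacian 1 (contDiff_comp_add_smul hf y r)
    simp only [laplacian_comp_add_smul hf, fderiv_comp_add_smul hf] at h1
    have h2 : (fun x => bump (1 + 2) x * (r ^ 2 * Δ f (y + r • x)))
        = fun x => r ^ 2 * (bump 3 x * Δ f (y + r • x)) := by funext x; ring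
    have h3 : (fun x => bump (1 + 1) x * (r • fderiv ℝ f (y + r • x)) x)
        = fun x => r * (bump 2 x * fderiv ℝ f (y + r • x) x) := by
      funext x
      simp only [smul_apply, smul_eq_mul]
      ring
    rw [h2, h3, integral_const_mul, integral_const_mul] at h1
    have hcl : Continuous fun x : E n => Δ f (y + r • x) :=
      (continuous_laplacian hf).comp (continuous_add_smul y r)
    have h4 : -K * I3 ≤ ∫ x, bump 3 x * Δ f (y + r • x) := by
      rw [hI3, ← integral_const_mul]
      refine integral_mono ?_ (integrable_bump_mul (by norm_num) hcl) fun x => ?_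
      · have := (continuous_bump (n := n) 3).integrable_of_hasCompactSupport (μ := volume)
          (hasCompactSupport_bump (by norm_num))
        exact this.const_mul _
      · simp only
        rcases le_or_gt 1 ‖x‖ with hx | hx
        · rw [bump_eq_zero (by norm_num) hx, mul_zero, zero_mul]
        · rw [mul_comm]
          refine mul_le_mul_of_nonneg_left (hK _ ?_) (bump_nonneg 3 x)
          rw [add_sub_cancel_left, norm_smul, Real.norm_eq_abs, abs_of_pos hr0]
          nlinarith [norm_nonneg x]
    have h5 : ∫ x, bump 2 x * fderiv ℝ f (y + r • x) x
        = r / 6 * ∫ x, bump 3 x * Δ f (y + r • x) := by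
      refine mul_left_cancel₀ hr0.ne' ?_
      push_cast at h1
      linarith
    rw [h5]
    have := mul_le_mul_of_nonneg_left h4 (show 0 ≤ r / 6 by positivity)
    linarith
  have h0 := hmono (Set.left_mem_Icc.2 hρ.le) (Set.right_mem_Icc.2 hρ.le) hρ.le
  have hM0 : M 0 = f y * ∫ x : E n, bump 2 x := by
    simp only [hM, zero_smul, add_zero]
    rw [integral_mul_const, mul_comm]
  simp only [hM0] at h0
  linarith

/-- The integral over a ball in rescaled coordinates. -/
theorem setIntegral_ball_comp_add_smul (h : (E n) → ℝ) (y : E n) {ρ : ℝ} (hρ : 0 < ρ) :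
    ∫ x in Metric.ball (0 : E n) 1, h (y + ρ • x)
      = (ρ ^ n)⁻¹ * ∫ x in Metric.ball y ρ, h x := by
  rw [← integral_indicator measurableSet_ball, ← integral_indicator measurableSet_ball]
  have h1 : ((Metric.ball (0 : E n) 1).indicator fun x => h (y + ρ • x))
      = fun x => (fun z => (Metric.ball y ρ).indicator h (y + z)) (ρ • x) := by
    funext x
    simp only [Set.indicator]
    have : x ∈ Metric.ball (0 : E n) 1 ↔ y + ρ • x ∈ Metric.ball y ρ := by
      rw [mem_ball_zero_iff, Metric.mem_ball, dist_eq_norm, add_sub_cancel_left, norm_smul,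
        Real.norm_eq_abs, abs_of_pos hρ, mul_lt_iff_lt_one_right hρ]
    by_cases hx : x ∈ Metric.ball (0 : E n) 1
    · rw [if_pos hx, if_pos (this.1 hx)]
    · rw [if_neg hx, if_neg fun h => hx (this.2 h)]
  rw [h1, Measure.integral_comp_smul volume (fun z => (Metric.ball y ρ).indicator h (y + z)) ρ,
    integral_add_left_eq_self (fun z => (Metric.ball y ρ).indicator h z) y]
  simp only [finrank_euclideanSpace, Fintype.card_fin, smul_eq_mul]
  rw [abs_of_pos (by positivity)]

/-- Control of the superlinear term by the Dirichlet energy. -/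
theorem integral_bump_mul_rpow_le {w : (E n) → ℝ} (hw : ContDiff ℝ 2 w) {y : E n}
    {ρ c C N ε s σ : ℝ} (hρ : 0 < ρ) (hρ1 : ρ ≤ 1) (hn : (n : ℝ) = 2 * N + 2) (hs : 0 < s)
    (hC : 0 ≤ C) (hσ : 0 < σ)
    (heq : ∀ z, ‖z - y‖ < ρ → c * w z ^ s ≤ -Δ w z + C * ‖fderiv ℝ w z‖)
    (hε : ∫ x in Metric.ball y ρ, ‖fderiv ℝ w x‖ ^ 2 ≤ ε) :
    c * ρ ^ 2 * ∫ x, bump 2 x * w (y + ρ • x) ^ s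
      ≤ (4 + C) * ρ ^ (-N) * (σ * ε + σ⁻¹ * volume.real (Metric.ball (0 : E n) 1)) := by
  set B := Metric.ball (0 : E n) 1 with hB
  have hcd : ∀ {f : (E n) → ℝ}, Continuous f → Continuous fun x => f (y + ρ • x) := fun hf =>
    hf.comp (continuous_add_smul y ρ)
  have hfdn : Continuous fun x => ‖fderiv ℝ w (y + ρ • x)‖ :=
    hcd (hw.continuous_fderiv (by norm_num)).norm
  have hfd : Continuous fun x => fderiv ℝ w (y + ρ • x) x :=
    ((hw.continuous_fderiv (by norm_num)).comp
      (continuous_add_smul y ρ)).clm_apply continuous_id'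
  have hws : Continuous fun x => w (y + ρ • x) ^ s :=
    (hcd hw.continuous).rpow_const fun _ => Or.inr hs.le
  have hΔc : Continuous fun x => Δ w (y + ρ • x) := hcd (continuous_laplacian hw)
  have hmem : ∀ x : E n, ‖x‖ < 1 → ‖y + ρ • x - y‖ < ρ := fun x hx => by
    rw [add_sub_cancel_left, norm_smul, Real.norm_eq_abs, abs_of_pos hρ]
    nlinarith [norm_nonneg x]
  have hibp : ρ * ∫ x, bump 2 x * Δ w (y + ρ • x)
      = 4 * ∫ x, bump 1 x * fderiv ℝ w (y + ρ • x) x := by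
    have h1 := integral_bump_mul_laplacian 0 (contDiff_comp_add_smul hw y ρ)
    simp only [laplacian_comp_add_smul hw, fderiv_comp_add_smul hw] at h1
    have h2 : (fun x => bump (0 + 2) x * (ρ ^ 2 * Δ w (y + ρ • x)))
        = fun x => ρ ^ 2 * (bump 2 x * Δ w (y + ρ • x)) := by funext x; ring
    have h3 : (fun x => bump (0 + 1) x * (ρ • fderiv ℝ w (y + ρ • x)) x)
        = fun x => ρ * (bump 1 x * fderiv ℝ w (y + ρ • x) x) := by
      funext x
      simp only [smul_apply, smul_eq_mul]
      ring
    rw [h2, h3, integral_const_mul, integral_const_mul] at h1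
    refine mul_left_cancel₀ hρ.ne' ?_
    push_cast at h1
    linarith
  have hBint : ∀ {f : (E n) → ℝ}, Continuous f → IntegrableOn f B := fun hf =>
    (hf.continuousOn.integrableOn_compact (isCompact_closedBall 0 1)).mono_set
      Metric.ball_subset_closedBall
  set G := ∫ x in B, ‖fderiv ℝ w (y + ρ • x)‖ with hG
  have hbG : ∀ m : ℕ, m ≠ 0 → ∫ x, bump m x * ‖fderiv ℝ w (y + ρ • x)‖ ≤ G := by
    intro m hm
    rw [hG, ← integral_indicator measurableSet_ball]
    refine integral_mono (integrable_bump_mul hm hfdn)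
      ((hBint hfdn).integrable_indicator measurableSet_ball) fun x => ?_
    simp only
    by_cases hx : x ∈ Metric.ball (0 : E n) 1
    · rw [Set.indicator_of_mem hx]
      exact mul_le_of_le_one_left (norm_nonneg _) (bump_le_one m x)
    · rw [Set.indicator_of_notMem hx, bump_eq_zero hm (by simpa using hx), zero_mul]
  have hb1 : -(∫ x, bump 1 x * fderiv ℝ w (y + ρ • x) x) ≤ G := by
    rw [← integral_neg]
    have hi : Integrable fun x => -(bump 1 x * fderiv ℝ w (y + ρ • x) x) :=
      (integrable_bump_mul one_ne_zero hfd).neg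
    refine (integral_mono hi (integrable_bump_mul one_ne_zero hfdn) fun x => ?_).trans
      (hbG 1 one_ne_zero)
    simp only
    rcases le_or_gt 1 ‖x‖ with hx | hx
    · rw [bump_eq_zero one_ne_zero hx, zero_mul, zero_mul, neg_zero]
    · rw [← mul_neg]
      refine mul_le_mul_of_nonneg_left ?_ (bump_nonneg 1 x)
      have h1 := (fderiv ℝ w (y + ρ • x)).le_opNorm x
      have h2 := neg_le_abs (fderiv ℝ w (y + ρ • x) x)
      rw [Real.norm_eq_abs] at h1
      nlinarith [norm_nonneg (fderiv ℝ w (y + ρ • x)), norm_nonneg x]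
  have hmain : c * ∫ x, bump 2 x * w (y + ρ • x) ^ s
      ≤ -(∫ x, bump 2 x * Δ w (y + ρ • x)) + C * ∫ x, bump 2 x * ‖fderiv ℝ w (y + ρ • x)‖ := by
    have hi : Integrable fun x => -(bump 2 x * Δ w (y + ρ • x)) :=
      (integrable_bump_mul two_ne_zero hΔc).neg
    rw [← integral_const_mul, ← integral_const_mul, ← integral_neg, ← integral_add hi
      ((integrable_bump_mul two_ne_zero hfdn).const_mul C)]
    refine integral_mono ((integrable_bump_mul two_ne_zero hws).const_mul c)
      (hi.add
      ((integrable_bump_mul two_ne_zero hfdn).const_mul C)) fun x => ?_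
    simp only
    rcases le_or_gt 1 ‖x‖ with hx | hx
    · simp [bump_eq_zero two_ne_zero hx]
    · have := mul_le_mul_of_nonneg_left (heq _ (hmem x hx)) (bump_nonneg 2 x)
      linarith
  have hC1 : C * ∫ x, bump 2 x * ‖fderiv ℝ w (y + ρ • x)‖ ≤ C * G :=
    mul_le_mul_of_nonneg_left (hbG 2 two_ne_zero) hC
  have hG0 : 0 ≤ G := integral_nonneg fun x => norm_nonneg _
  have hfirst : c * ρ ^ 2 * ∫ x, bump 2 x * w (y + ρ • x) ^ s ≤ (4 + C) * (ρ * G) := by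
    have h1 := mul_le_mul_of_nonneg_left hmain (show 0 ≤ ρ ^ 2 by positivity)
    have h2 : ρ * (C * G) ≤ C * G :=
      mul_le_of_le_one_left (by positivity) hρ1
    have h3 := mul_le_mul_of_nonneg_left hC1 (show 0 ≤ ρ ^ 2 by positivity)
    have h4 := mul_le_mul_of_nonneg_left h2 hρ.le
    have h5 := mul_le_mul_of_nonneg_left hb1 hρ.le
    linear_combination h1 + h3 + h4 + 4 * h5 - ρ * hibp
  set t := σ * ρ ^ N with ht
  have ht0 : 0 < t := by positivity
  have hG2 : ρ * G ≤ t * (ρ ^ 2 * ∫ x in B, ‖fderiv ℝ w (y + ρ • x)‖ ^ 2)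
      + t⁻¹ * volume.real B := by
    have h1 : volume.real B = ∫ x in B, (1 : ℝ) := by simp [Measure.real]
    have hi1 : IntegrableOn (fun x => t * (ρ ^ 2 * ‖fderiv ℝ w (y + ρ • x)‖ ^ 2)) B :=
      ((hBint (hfdn.pow 2)).const_mul _).const_mul _
    have hi2 : IntegrableOn (fun _ : E n => t⁻¹ * (1 : ℝ)) B :=
      (hBint continuous_const).const_mul _
    rw [h1, hG, ← integral_const_mul, ← integral_const_mul, ← integral_const_mul,
      ← integral_const_mul, ← integral_add hi1 hi2]
    refine integral_mono ((hBint hfdn).const_mul _)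
      (hi1.add hi2) fun x => ?_
    simp only [mul_one]
    have h2 : 0 ≤ t⁻¹ * (t * (ρ * ‖fderiv ℝ w (y + ρ • x)‖) - 1) ^ 2 := by positivity
    have h3 : t⁻¹ * (t * (ρ * ‖fderiv ℝ w (y + ρ • x)‖) - 1) ^ 2
        = t * (ρ ^ 2 * ‖fderiv ℝ w (y + ρ • x)‖ ^ 2)
          - 2 * (ρ * ‖fderiv ℝ w (y + ρ • x)‖) + t⁻¹ := by
      field_simp
      ring
    have h4 : 0 ≤ ρ * ‖fderiv ℝ w (y + ρ • x)‖ := by positivity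
    linarith
  have hscale : ρ ^ 2 * ∫ x in B, ‖fderiv ℝ w (y + ρ • x)‖ ^ 2 ≤ ρ ^ (-(2 * N)) * ε := by
    rw [hB, setIntegral_ball_comp_add_smul (fun x => ‖fderiv ℝ w x‖ ^ 2) y hρ, ← mul_assoc]
    have h1 : ρ ^ 2 * (ρ ^ n)⁻¹ = ρ ^ (-(2 * N)) := by
      rw [← Real.rpow_natCast, ← Real.rpow_natCast, ← Real.rpow_neg hρ.le, ← Real.rpow_add hρ, hn]
      congr 1
      push_cast
      ring
    rw [h1]
    exact mul_le_mul_of_nonneg_left hε (by positivity)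
  have h1 : t * ρ ^ (-(2 * N)) = σ * ρ ^ (-N) := by
    rw [ht, mul_assoc, ← Real.rpow_add hρ]
    congr 2
    ring
  have h2 : t⁻¹ = σ⁻¹ * ρ ^ (-N) := by
    rw [ht, mul_inv, Real.rpow_neg hρ.le]
  have h3 := mul_le_mul_of_nonneg_left hscale ht0.le
  rw [← mul_assoc t (ρ ^ (-(2 * N))), h1] at h3
  rw [h2] at hG2
  have h4 := mul_le_mul_of_nonneg_left (hG2.trans (add_le_add_left h3 _))
    (show 0 ≤ 4 + C by linarith)
  refine hfirst.trans (h4.trans (le_of_eq ?_))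
  ring

end MeanValue

section Regularity

open InnerProductSpace Laplacian

variable {n k : ℕ} {p : ℝ}

local notation "E" n => EuclideanSpace ℝ (Fin n)

/-- Point picking: below a point where `V` is not small there is a ball, of radius tied to the
value of `V` at its center, on which `V` is controlled by that value. -/
theorem exists_center_of_le {V : (E n) → ℝ} (hV : Continuous V) {y₀ : E n} {q r θ δ : ℝ}
    (hq : 0 < q) (hr : 0 < r) (hθ : 0 < θ) (hδ : 0 < δ) (hδr : δ ^ q ≤ (r / 2) ^ q * θ)
    (hy₀ : θ ≤ V y₀) :
    ∃ y ρ, 0 < V y ∧ 0 < ρ ∧ ρ ≤ r ∧ V y * ρ ^ q = δ ^ q ∧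
      ∀ z, ‖z - y‖ < ρ → ‖z - y₀‖ < r ∧ V z ≤ 2 ^ q * V y := by
  have hcont : Continuous fun z : E n => (r - ‖z - y₀‖) ^ q * V z :=
    ((continuous_const.sub (continuous_id.sub continuous_const).norm).rpow_const
      fun _ => Or.inr hq.le).mul hV
  obtain ⟨y, hy, hmax⟩ := (isCompact_closedBall y₀ r).exists_isMaxOn
    ⟨y₀, Metric.mem_closedBall_self hr.le⟩ hcont.continuousOn
  have hy' : ‖y - y₀‖ ≤ r := by rwa [Metric.mem_closedBall, dist_eq_norm] at hy
  have hmax' : ∀ z, ‖z - y₀‖ ≤ r → (r - ‖z - y₀‖) ^ q * V z ≤ (r - ‖y - y₀‖) ^ q * V y :=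
    fun z hz => hmax (by rwa [Metric.mem_closedBall, dist_eq_norm])
  have h0 : r ^ q * θ ≤ (r - ‖y - y₀‖) ^ q * V y := by
    have := hmax' y₀ (by simpa using hr.le)
    rw [sub_self, norm_zero, sub_zero] at this
    exact (mul_le_mul_of_nonneg_left hy₀ (by positivity)).trans this
  have h0' : 0 < (r - ‖y - y₀‖) ^ q * V y := lt_of_lt_of_le (by positivity) h0
  obtain ⟨d, hd⟩ : ∃ d, d = (r - ‖y - y₀‖) / 2 := ⟨_, rfl⟩
  have hd2 : r - ‖y - y₀‖ = 2 * d := by rw [hd]; ring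
  rw [hd2] at h0 h0'
  have hd0 : 0 < d := by
    rcases (show 0 ≤ d by rw [hd]; linarith).eq_or_lt with h | h
    · rw [← h, mul_zero, Real.zero_rpow hq.ne', zero_mul] at h0'
      exact absurd h0' (lt_irrefl _)
    · exact h
  have hm : 0 < V y := pos_of_mul_pos_right h0' (by positivity)
  have hdr : d ≤ r := by
    rw [hd]
    linarith [norm_nonneg (y - y₀)]
  have hkey : δ ^ q ≤ d ^ q * V y := by
    rw [Real.mul_rpow zero_le_two hd0.le] at h0
    rw [Real.div_rpow hr.le zero_le_two, div_mul_eq_mul_div,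
      le_div_iff₀ (by positivity)] at hδr
    have h2 : (0 : ℝ) < 2 ^ q := by positivity
    refine le_of_mul_le_mul_right ?_ h2
    linarith
  refine ⟨y, δ * (V y) ^ (-q⁻¹), hm, by positivity, ?_, ?_, ?_⟩
  all_goals
    have hρ : (δ * (V y) ^ (-q⁻¹)) ^ q = δ ^ q * (V y)⁻¹ := by
      rw [Real.mul_rpow hδ.le (by positivity), ← Real.rpow_mul hm.le, neg_mul,
        inv_mul_cancel₀ hq.ne', Real.rpow_neg_one]
    have hρd : δ * (V y) ^ (-q⁻¹) ≤ d := by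
      rw [← Real.rpow_le_rpow_iff (by positivity) hd0.le hq, hρ, mul_inv_le_iff₀ hm]
      exact hkey
  · exact hρd.trans hdr
  · rw [hρ]
    field_simp
  · intro z hz
    have h1 : ‖z - y₀‖ ≤ ‖z - y‖ + ‖y - y₀‖ := by
      simpa using norm_add_le (z - y) (y - y₀)
    have h2 : ‖z - y₀‖ < r := by linarith
    refine ⟨h2, ?_⟩
    rcases le_or_gt (V z) 0 with h | h
    · exact h.trans (by positivity)
    have h3 := hmax' z h2.le
    rw [hd2, Real.mul_rpow zero_le_two hd0.le] at h3
    have h4 : d ^ q * V z ≤ (r - ‖z - y₀‖) ^ q * V z :=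
      mul_le_mul_of_nonneg_right (Real.rpow_le_rpow hd0.le (by linarith) hq.le) h.le
    have h5 : 0 < d ^ q := by positivity
    refine le_of_mul_le_mul_left ?_ h5
    linarith

theorem le_add_rpow_mul_rpow {x t p : ℝ} (hp : 2 < p) (hx : 0 < x) (ht : 0 < t) :
    x ≤ t + t ^ (2 - p) * x ^ (p - 1) := by
  rcases le_total x t with h | h
  · have : 0 ≤ t ^ (2 - p) * x ^ (p - 1) := by positivity
    linarith
  · have h1 : x = t ^ (2 - p) * t ^ (p - 2) * x := by
      rw [← Real.rpow_add ht]; norm_num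
    have h2 : x ^ (p - 1) = x ^ (p - 2) * x := by
      rw [← Real.rpow_add_one hx.ne']; congr 1; ring
    have h3 : t ^ (p - 2) ≤ x ^ (p - 2) := Real.rpow_le_rpow ht.le h (by linarith)
    have h4 : t ^ (2 - p) * (t ^ (p - 2) * x) ≤ t ^ (2 - p) * (x ^ (p - 2) * x) :=
      mul_le_mul_of_nonneg_left (mul_le_mul_of_nonneg_right h3 hx.le) (by positivity)
    rw [h2]
    nlinarith

set_option maxHeartbeats 1000000 in
/-- Interior smallness of positive solutions with small Dirichlet energy. -/
theorem exists_energy_threshold {N A c C₁ C₂ θ : ℝ} (hp : 2 < p) (hn : (n : ℝ) = 2 * N + 2)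
    (hN : N * (p - 2) ≤ 2) (hA : 0 < A) (hc : 0 < c) (hC₁ : 0 ≤ C₁) (hC₂ : 0 ≤ C₂)
    (hθ : 0 < θ) :
    ∃ ε > 0, ∀ (y₀ : E n) (w v : Fin k → (E n) → ℝ),
      (∀ i, ContDiff ℝ 2 (w i)) → (∀ i, ContDiff ℝ 2 (v i)) →
      (∀ z, ‖z - y₀‖ < 1 / 2 → ∀ i, 0 < w i z ∧ v i z ≤ A * w i z ∧
        -(C₁ * ((∑ j, v j z) + (∑ j, v j z) ^ (p - 1))) ≤ Δ (v i) z ∧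
        c * w i z ^ (p - 1) ≤ -Δ (w i) z + C₂ * ‖fderiv ℝ (w i) z‖) →
      (∀ z, ‖z - y₀‖ < 1 / 2 → ∀ i, 0 < v i z) →
      (∀ i, ∫ x in Metric.ball y₀ (1 / 2), ‖fderiv ℝ (w i) x‖ ^ 2 ≤ ε) →
      ∑ i, v i y₀ < θ := by
  obtain ⟨q, hq⟩ : ∃ q, q = 2 / (p - 2) := ⟨_, rfl⟩
  have hp2 : 0 < p - 2 := by linarith
  have hq0 : 0 < q := by rw [hq]; positivity
  have hqp : q * (p - 2) = 2 := by rw [hq]; field_simp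
  have hNq : N ≤ q := by rwa [hq, le_div_iff₀ hp2]
  obtain ⟨r, hr, hr2, hr3⟩ : ∃ r > 0, r < 1 / 2 ∧ k * C₁ * 2 ^ q * r ^ 2 ≤ 3 := by
    have h1 : Tendsto (fun r : ℝ => k * C₁ * 2 ^ q * r ^ 2) (𝓝[>] 0) (𝓝 0) := by
      have : Continuous fun r : ℝ => k * C₁ * 2 ^ q * r ^ 2 := by fun_prop
      simpa using (this.tendsto 0).mono_left nhdsWithin_le_nhds
    obtain ⟨r, ⟨h2, h3⟩, h4⟩ := ((eventually_mem_nhdsWithin.and (Ioo_mem_nhdsGT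
      (show (0 : ℝ) < 1 / 2 by norm_num))).and
      (h1.eventually_le_const (show (0 : ℝ) < 3 by norm_num))).exists
    exact ⟨r, h2, h3.2, h4⟩
  obtain ⟨δ, hδ, hδ1, hδ2⟩ : ∃ δ > 0, k * C₁ * 2 ^ (q * (p - 1)) * δ ^ 2 ≤ 3 ∧
      δ ^ q ≤ (r / 2) ^ q * θ := by
    have h1 : Tendsto (fun r : ℝ => k * C₁ * 2 ^ (q * (p - 1)) * r ^ 2) (𝓝[>] 0) (𝓝 0) := by
      have : Continuous fun r : ℝ => k * C₁ * 2 ^ (q * (p - 1)) * r ^ 2 := by fun_prop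
      simpa using (this.tendsto 0).mono_left nhdsWithin_le_nhds
    have h2 : Tendsto (fun r : ℝ => r ^ q) (𝓝[>] 0) (𝓝 0) := by
      have : Continuous fun r : ℝ => r ^ q := continuous_id.rpow_const fun _ => Or.inr hq0.le
      simpa [Real.zero_rpow hq0.ne'] using (this.tendsto 0).mono_left nhdsWithin_le_nhds
    obtain ⟨δ, ⟨h3, h4⟩, h5⟩ := ((eventually_mem_nhdsWithin.and
      (h1.eventually_le_const (show (0 : ℝ) < 3 by norm_num))).and
      (h2.eventually_le_const (show 0 < (r / 2) ^ q * θ by positivity))).exists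
    exact ⟨δ, h3, h4, h5⟩
  obtain ⟨I, hI⟩ : ∃ I, I = ∫ x : E n, bump 2 x := ⟨_, rfl⟩
  have hI0 : 0 < I := hI ▸ integral_bump_pos 2 two_ne_zero
  obtain ⟨t, ht⟩ : ∃ t : ℝ, t = 1 / (4 * A * (k + 1)) := ⟨_, rfl⟩
  have ht0 : 0 < t := by rw [ht]; positivity
  obtain ⟨D, hD⟩ : ∃ D : ℝ, D = A * (k + 1) * t ^ (2 - p) * (4 + C₂) := ⟨_, rfl⟩
  have hD0 : 0 < D := by rw [hD]; positivity
  obtain ⟨η, hη⟩ : ∃ η : ℝ, η = c * δ ^ 2 * δ ^ q * I / 4 := ⟨_, rfl⟩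
  have hη0 : 0 < η := by rw [hη]; positivity
  obtain ⟨ω, hω⟩ : ∃ ω : ℝ, ω = volume.real (Metric.ball (0 : E n) 1) := ⟨_, rfl⟩
  have hω0 : 0 ≤ ω := hω ▸ measureReal_nonneg
  obtain ⟨σ, hσ⟩ : ∃ σ : ℝ, σ = 2 * D * (ω + 1) / η := ⟨_, rfl⟩
  have hσ0 : 0 < σ := by rw [hσ]; positivity
  have hσω : D * (σ⁻¹ * ω) ≤ η / 2 := by
    have h1 : D * (σ⁻¹ * (ω + 1)) = η / 2 := by
      rw [hσ]; field_simp
    rw [← h1]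
    gcongr
    linarith
  refine ⟨η / (4 * D * σ), by positivity, fun y₀ w v hw hv hz hvpos hE => ?_⟩
  have hσε : D * (σ * (η / (4 * D * σ))) = η / 4 := by field_simp
  by_contra! hcon
  have hVc : Continuous fun z => ∑ i, v i z := continuous_finsetSum _ fun i _ => (hv i).continuous
  obtain ⟨y, ρ, hm, hρ, hρr, hmρ, hball⟩ :=
    exists_center_of_le hVc hq0 hr hθ hδ hδ2 hcon
  obtain ⟨m, hm'⟩ : ∃ m, m = ∑ i, v i y := ⟨_, rfl⟩
  simp only [← hm'] at hm hmρ hball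
  have hk0 : (0 : ℝ) ≤ k := k.cast_nonneg
  have hin : ∀ z, ‖z - y‖ < ρ → ‖z - y₀‖ < 1 / 2 := fun z h => (hball z h).1.trans hr2
  have hρm : ρ ^ 2 * m ^ (p - 2) = δ ^ 2 := by
    have h1 := congrArg (fun x : ℝ => x ^ (p - 2)) hmρ
    rw [Real.mul_rpow hm.le (by positivity), ← Real.rpow_mul hρ.le, ← Real.rpow_mul hδ.le, hqp,
      Real.rpow_two, Real.rpow_two] at h1
    linarith
  obtain ⟨K, hK⟩ : ∃ K, K = C₁ * (2 ^ q * m + (2 ^ q * m) ^ (p - 1)) := ⟨_, rfl⟩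
  have hKρ : k * (K * ρ ^ 2) ≤ 6 * m := by
    have h1 : (2 ^ q * m) ^ (p - 1) * ρ ^ 2 = 2 ^ (q * (p - 1)) * δ ^ 2 * m := by
      rw [Real.mul_rpow (by positivity) hm.le, ← Real.rpow_mul zero_le_two, ← hρm,
        show p - 1 = (p - 2) + 1 by ring, Real.rpow_add_one hm.ne']
      ring
    have h2 : k * C₁ * 2 ^ q * ρ ^ 2 ≤ 3 :=
      (mul_le_mul_of_nonneg_left (pow_le_pow_left₀ hρ.le hρr 2) (by positivity)).trans hr3
    have h3 : k * (K * ρ ^ 2) = (k * C₁ * 2 ^ q * ρ ^ 2) * m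
        + (k * C₁ * 2 ^ (q * (p - 1)) * δ ^ 2) * m := by
      rw [hK]
      linear_combination k * C₁ * h1
    rw [h3]
    nlinarith
  have hJ : ∫ x : E n, bump 3 x ≤ I := by
    rw [hI]
    have h_int : ∀ j : ℕ, j ≠ 0 → Integrable (fun x : E n => bump j x) := fun j hj =>
      (continuous_bump j).integrable_of_hasCompactSupport (hasCompactSupport_bump hj)
    refine integral_mono (h_int 3 (by norm_num)) (h_int 2 (by norm_num)) fun x => ?_
    have h1 : bump 3 x = bump 2 x * bump 1 x := by
      simp only [bump]; ring
    simp only [h1]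
    exact mul_le_of_le_one_right (bump_nonneg 2 x) (bump_le_one 1 x)
  have hmem : ∀ x : E n, ‖x‖ < 1 → ‖y + ρ • x - y‖ < ρ := fun x hx => by
    rw [add_sub_cancel_left, norm_smul, Real.norm_eq_abs, abs_of_pos hρ]
    nlinarith [norm_nonneg x]
  have hK0 : 0 ≤ K := by rw [hK]; positivity
  have hN1 : 0 < ρ ^ N := by positivity
  have hindiv : ∀ i, v i y * I ≤ A * (t * m * I + (t * m) ^ (2 - p)
      * ∫ x, bump 2 x * w i (y + ρ • x) ^ (p - 1)) + K * ρ ^ 2 / 12 * I := by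
    intro i
    have hcw : Continuous fun x => w i (y + ρ • x) :=
      (hw i).continuous.comp (continuous_add_smul y ρ)
    have hcv : Continuous fun x => v i (y + ρ • x) :=
      (hv i).continuous.comp (continuous_add_smul y ρ)
    have hcwp : Continuous fun x => w i (y + ρ • x) ^ (p - 1) :=
      hcw.rpow_const fun _ => Or.inr (by linarith)
    have h1 := mul_integral_bump_le (hv i) (K := K) hρ fun z h => by
      have h2 := (hz z (hin z h) i).2.2.1
      have h3 := (hball z h).2
      have h4 : 0 ≤ ∑ j, v j z := Finset.sum_nonneg fun j _ => (hvpos z (hin z h) j).le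
      refine le_trans (neg_le_neg ?_) h2
      rw [hK]
      exact mul_le_mul_of_nonneg_left (add_le_add h3
        (Real.rpow_le_rpow h4 h3 (by linarith))) hC₁
    rw [← hI] at h1
    have h5 : ∫ x, bump 2 x * v i (y + ρ • x) ≤ A * (t * m * I + (t * m) ^ (2 - p)
        * ∫ x, bump 2 x * w i (y + ρ • x) ^ (p - 1)) := by
      rw [hI, ← integral_const_mul, ← integral_const_mul, ← integral_add, ← integral_const_mul]
      · refine integral_mono (integrable_bump_mul two_ne_zero hcv) ?_ fun x => ?_
        · refine Integrable.const_mul (Integrable.add ?_ ?_) A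
          · exact ((continuous_bump 2).integrable_of_hasCompactSupport
              (hasCompactSupport_bump two_ne_zero)).const_mul _
          · exact (integrable_bump_mul two_ne_zero hcwp).const_mul _
        · rcases le_or_gt 1 ‖x‖ with hx | hx
          · simp [bump_eq_zero two_ne_zero hx]
          · have h6 := hz _ (hin _ (hmem x hx)) i
            have h7 := h6.2.1.trans (mul_le_mul_of_nonneg_left
              (le_add_rpow_mul_rpow hp h6.1 (mul_pos ht0 hm)) hA.le)
            have h8 := mul_le_mul_of_nonneg_left h7 (bump_nonneg 2 x)
            refine h8.trans (le_of_eq ?_)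
            ring
      · exact ((continuous_bump 2).integrable_of_hasCompactSupport
          (hasCompactSupport_bump two_ne_zero)).const_mul _
      · exact (integrable_bump_mul two_ne_zero hcwp).const_mul _
    have h6 : K * ρ ^ 2 / 12 * ∫ x : E n, bump 3 x ≤ K * ρ ^ 2 / 12 * I :=
      mul_le_mul_of_nonneg_left hJ (by positivity)
    linarith
  obtain ⟨T, hT⟩ : ∃ T, T = σ * (η / (4 * D * σ)) + σ⁻¹ * ω := ⟨_, rfl⟩
  have henergy : ∀ i, c * ρ ^ 2 * ∫ x, bump 2 x * w i (y + ρ • x) ^ (p - 1)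
      ≤ (4 + C₂) * ρ ^ (-N) * T := by
    intro i
    rw [hT, hω]
    refine integral_bump_mul_rpow_le (hw i) hρ (by linarith) hn (by linarith) hC₂ hσ0
      (fun z h => (hz z (hin z h) i).2.2.2) (le_trans ?_ (hE i))
    refine setIntegral_mono_set ?_ (Eventually.of_forall fun x => by positivity) ?_
    · exact (((hw i).continuous_fderiv (by norm_num)).norm.pow 2).continuousOn.integrableOn_compact
        (isCompact_closedBall y₀ (1 / 2)) |>.mono_set Metric.ball_subset_closedBall
    · refine LE.le.eventuallyLE fun z h => ?_
      rw [Metric.mem_ball, dist_eq_norm] at h ⊢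
      exact hin z h
  obtain ⟨S, hS⟩ : ∃ S, S = ∑ i, ∫ x, bump 2 x * w i (y + ρ • x) ^ (p - 1) := ⟨_, rfl⟩
  have hsum1 : m * I
      ≤ k * A * (t * m * I) + A * (t * m) ^ (2 - p) * S + k * (K * ρ ^ 2) / 12 * I := by
    have := Finset.sum_le_sum fun i (_ : i ∈ Finset.univ) => hindiv i
    rw [← Finset.sum_mul, ← hm', Finset.sum_add_distrib, ← Finset.mul_sum, Finset.sum_add_distrib,
      ← Finset.mul_sum _ _ ((t * m) ^ (2 - p)), ← hS] at this
    simp only [Finset.sum_const, Finset.card_univ, Fintype.card_fin, nsmul_eq_mul] at this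
    linarith
  have hsum2 : c * ρ ^ 2 * S ≤ k * ((4 + C₂) * ρ ^ (-N) * T) := by
    have := Finset.sum_le_sum fun i (_ : i ∈ Finset.univ) => henergy i
    rw [← Finset.mul_sum, ← hS] at this
    simpa only [Finset.sum_const, Finset.card_univ, Fintype.card_fin, nsmul_eq_mul] using this
  have hkt : k * A * t ≤ 1 / 4 := by
    rw [ht, mul_one_div, div_le_div_iff₀ (by positivity) (by norm_num)]
    nlinarith
  have hquarter : m * I / 4 ≤ A * (t * m) ^ (2 - p) * S := by
    have h1 := mul_le_mul_of_nonneg_right hkt (mul_nonneg hm.le hI0.le)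
    have h2 := mul_le_mul_of_nonneg_right hKρ hI0.le
    linarith
  have hT0 : 0 ≤ T := by rw [hT]; positivity
  have hfinal : c * δ ^ 2 * (m * ρ ^ N) * I / 4 ≤ D * T := by
    have h1 : c * δ ^ 2 * (m * ρ ^ N) * I / 4
        = (c * ρ ^ 2 * m ^ (p - 2) * ρ ^ N) * (m * I / 4) := by
      rw [← hρm]; ring
    have h2 : m ^ (p - 2) * (t * m) ^ (2 - p) = t ^ (2 - p) := by
      rw [Real.mul_rpow ht0.le hm.le, mul_left_comm, ← Real.rpow_add hm]
      norm_num
    have h3 : ρ ^ N * ρ ^ (-N) = 1 := by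
      rw [← Real.rpow_add hρ, add_neg_cancel, Real.rpow_zero]
    calc c * δ ^ 2 * (m * ρ ^ N) * I / 4
        ≤ (c * ρ ^ 2 * m ^ (p - 2) * ρ ^ N) * (A * (t * m) ^ (2 - p) * S) := by
          rw [h1]
          exact mul_le_mul_of_nonneg_left hquarter (by positivity)
      _ = (A * t ^ (2 - p) * ρ ^ N) * (c * ρ ^ 2 * S) := by rw [← h2]; ring
      _ ≤ (A * t ^ (2 - p) * ρ ^ N) * (k * ((4 + C₂) * ρ ^ (-N) * T)) :=
          mul_le_mul_of_nonneg_left hsum2 (by positivity)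
      _ = (A * k * t ^ (2 - p) * (4 + C₂) * T) * (ρ ^ N * ρ ^ (-N)) := by ring
      _ ≤ D * T := by
          rw [h3, mul_one, hD]
          gcongr
          linarith
  have hlow : δ ^ q ≤ m * ρ ^ N := by
    rw [← hmρ]
    exact mul_le_mul_of_nonneg_left
      (Real.rpow_le_rpow_of_exponent_ge hρ (by linarith) hNq) hm.le
  have h1 : η ≤ c * δ ^ 2 * (m * ρ ^ N) * I / 4 := by
    rw [hη]
    gcongr
  have h2 : D * T ≤ η / 4 + η / 2 := by
    rw [hT, mul_add, hσε]
    linarith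
  linarith

end Regularity

section HenonSobolev

open InnerProductSpace Laplacian

variable {n k : ℕ} {p : ℝ}

local notation "E" n => EuclideanSpace ℝ (Fin n)

/-- Positive solutions of the Hénon–Sobolev system on the punctured space. -/
structure IsHenonSolution (C : Coupling k p) (a N : ℝ) (u : Fin k → (E n) → ℝ) : Prop where
  contDiffAt : ∀ i, ∀ x ≠ 0, ContDiffAt ℝ 2 (u i) x
  pos : ∀ i, ∀ x ≠ 0, 0 < u i x
  laplacian : ∀ i, ∀ x ≠ 0, Δ (u i) x = 2 * a * (fderiv ℝ (u i) x x) * (‖x‖ ^ 2)⁻¹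
    - ‖x‖ ^ ((N - a) * (p - 2) - 2) * C.f i (fun j => u j x)

theorem norm_gradient (f : (E n) → ℝ) (x : E n) : ‖gradient f x‖ = ‖fderiv ℝ f x‖ :=
  LinearIsometryEquiv.norm_map _ _

namespace IsHenonSolution

variable {C : Coupling k p} {a N : ℝ} {u : Fin k → (E n) → ℝ}

theorem isSolution (hu : IsHenonSolution C a N u) (hn : (n : ℝ) = 2 * N + 2) :
    IsSolution C N (N - a) fun i x => ‖x‖ ^ (-a) * u i x where
  contDiffAt i x hx := (contDiffAt_norm_rpow _ hx).mul (hu.contDiffAt i x hx)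
  pos i x hx := mul_pos (Real.rpow_pos_of_pos (norm_pos_iff.2 hx) _) (hu.pos i x hx)
  laplacian i x hx := by
    have hr := norm_pos_iff.2 hx
    have hgrad : inner ℝ (gradient (fun y : E n => ‖y‖ ^ (-a)) x) (gradient (u i) x)
        = -a * ‖x‖ ^ (-a) * (‖x‖ ^ 2)⁻¹ * fderiv ℝ (u i) x x := by
      rw [real_inner_comm, inner_gradient_right, conj_trivial,
        (hasFDerivAt_norm_rpow_of_ne (-a) hx).fderiv]
      simp only [smul_apply, innerSL_apply_apply, smul_eq_mul, inner_gradient_right, conj_trivial]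
    have hf : C.f i (fun j => ‖x‖ ^ N * (‖x‖ ^ (-a) * u j x))
        = ‖x‖ ^ ((N - a) * (p - 1)) * C.f i fun j => u j x := by
      have h1 : (fun j => ‖x‖ ^ N * (‖x‖ ^ (-a) * u j x)) = fun j => ‖x‖ ^ (N - a) * u j x := by
        funext j
        rw [← mul_assoc, ← Real.rpow_add hr, sub_eq_add_neg]
      rw [h1, C.f_smul (fun j => hu.pos j x hx) (by positivity), ← Real.rpow_mul hr.le]
    have hpow : ‖x‖ ^ (-N) * ‖x‖ ^ ((N - a) * (p - 1))
        = ‖x‖ ^ 2 * (‖x‖ ^ (-a) * ‖x‖ ^ ((N - a) * (p - 2) - 2)) := by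
      rw [← Real.rpow_natCast, ← Real.rpow_add hr, ← Real.rpow_add hr, ← Real.rpow_add hr]
      congr 1
      push_cast
      ring
    rw [laplacian_mul (contDiffAt_norm_rpow _ hx) (hu.contDiffAt i x hx), hu.laplacian i x hx,
      laplacian_norm_rpow _ hx, hgrad, hf, ← mul_assoc (‖x‖ ^ (-N)), hpow, hn]
    field_simp
    ring

theorem comp_smul (hu : IsHenonSolution C a N u) {R : ℝ} (hR : 0 < R) :
    IsHenonSolution C a N fun i x => R ^ (N - a) * u i (R • x) := by
  have hne : ∀ {x : E n}, x ≠ 0 → R • x ≠ 0 := fun hx => smul_ne_zero hR.ne' hx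
  have hcd : ∀ i, ∀ x ≠ 0, ContDiffAt ℝ 2 (fun x => u i (R • x)) x := fun i x hx =>
    (hu.contDiffAt i _ (hne hx)).comp x (contDiff_const_smul R).contDiffAt
  refine ⟨fun i x hx => contDiffAt_const.mul (hcd i x hx),
    fun i x hx => mul_pos (by positivity) (hu.pos i _ (hne hx)), fun i x hx => ?_⟩
  have hr := norm_pos_iff.2 hx
  have h1 : Δ (fun x => R ^ (N - a) * u i (R • x)) x = R ^ (N - a) * (R ^ 2 * Δ (u i) (R • x)) := by
    have h2 := laplacian_comp_similarity (f := u i) (x := x) (LinearIsometryEquiv.refl ℝ (E n)) R 0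
      (by simpa using hu.contDiffAt i _ (hne hx))
    simp only [LinearIsometryEquiv.coe_refl, id_eq, zero_add] at h2
    rw [← h2]
    exact laplacian_smul (f := fun x => u i (R • x)) (R ^ (N - a)) (hcd i x hx)
  have h3 : fderiv ℝ (fun x => R ^ (N - a) * u i (R • x)) x x
      = R ^ (N - a) * fderiv ℝ (u i) (R • x) (R • x) := by
    have h4 : HasFDerivAt (fun x : E n => R • x) (R • ContinuousLinearMap.id ℝ (E n)) x :=
      (hasFDerivAt_id x).const_smul R
    have h5 := ((((hu.contDiffAt i _ (hne hx)).differentiableAt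
      (by norm_num)).hasFDerivAt.comp x h4).const_mul (R ^ (N - a))).fderiv
    refine (congrArg (fun L => L x) h5).trans ?_
    simp
  have h6 : R ^ (N - a) * (R ^ 2 * R ^ ((N - a) * (p - 2) - 2))
      = (R ^ (N - a)) ^ (p - 1) := by
    rw [← Real.rpow_natCast, ← Real.rpow_add hR, ← Real.rpow_add hR, ← Real.rpow_mul hR.le]
    congr 1
    push_cast
    ring
  rw [h1, h3, hu.laplacian i _ (hne hx), C.f_smul (fun j => hu.pos j _ (hne hx)) (by positivity),
    ← h6, norm_smul, Real.norm_eq_abs, abs_of_pos hR, Real.mul_rpow hR.le hr.le]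
  field_simp

end IsHenonSolution

theorem exists_contDiff_eventuallyEq {f : (E n) → ℝ} (hf : ∀ x ≠ 0, ContDiffAt ℝ 2 f x)
    {y : E n} (hy : ‖y‖ = 1) :
    ∃ g, ContDiff ℝ 2 g ∧ ∀ z, ‖z - y‖ < 1 / 2 → g =ᶠ[𝓝 z] f := by
  let χ : ContDiffBump y := ⟨1 / 2, 3 / 4, by norm_num, by norm_num⟩
  refine ⟨fun x => χ x * f x, contDiff_iff_contDiffAt.2 fun x => ?_, fun z hz => ?_⟩
  · rcases eq_or_ne x 0 with rfl | hx
    · have h1 : (fun x => χ x * f x) =ᶠ[𝓝 0] fun _ => 0 := by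
        filter_upwards [Metric.ball_mem_nhds (0 : E n) (show (0 : ℝ) < 1 / 4 by norm_num)]
          with x hx
        have h2 : χ.rOut ≤ dist x y := by
          rw [mem_ball_zero_iff] at hx
          have := norm_sub_norm_le y x
          rw [dist_comm, dist_eq_norm]
          change 3 / 4 ≤ ‖y - x‖
          linarith
        rw [χ.zero_of_le_dist h2, zero_mul]
      exact contDiffAt_const.congr_of_eventuallyEq h1
    · exact χ.contDiff.contDiffAt.mul (hf x hx)
  · have h1 : z ∈ Metric.ball y χ.rIn := by
      rw [Metric.mem_ball, dist_eq_norm]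
      exact hz
    filter_upwards [χ.eventuallyEq_one_of_mem_ball h1] with x hx
    rw [hx, Pi.one_apply, one_mul]

/-- Solutions with small energy near a point of the unit sphere are small at that point. -/
theorem IsHenonSolution.exists_energy_threshold (C : Coupling k p) {a N θ : ℝ}
    (hn : (n : ℝ) = 2 * N + 2) (ha : 0 ≤ a) (haN : a < N) (hp : 2 < p) (hN : N * (p - 2) ≤ 2)
    (hθ : 0 < θ) :
    ∃ ε > 0, ∀ u : Fin k → (E n) → ℝ, IsHenonSolution C a N u → ∀ y : E n, ‖y‖ = 1 →
      (∀ i, ∫ x in Metric.ball y (1 / 2), ‖fderiv ℝ (u i) x‖ ^ 2 ≤ ε) → ∀ i, u i y < θ := by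
  obtain ⟨κ, hκ, hκC⟩ : ∃ κ > 0, ∀ i, κ ≤ C.κ i i := by
    rcases isEmpty_or_nonempty (Fin k) with h | h
    · exact ⟨1, one_pos, fun i => h.elim i⟩
    · obtain ⟨i₀, hi₀⟩ := Finite.exists_min fun i => C.κ i i
      exact ⟨_, C.κ_pos i₀ i₀, hi₀⟩
  have hK : 0 ≤ C.K := by
    rcases isEmpty_or_nonempty (Fin k) with h | ⟨⟨i⟩⟩
    · simp [Coupling.K]
    · exact (C.K_pos i).le
  have hL : 0 ≤ N ^ 2 - (N - a) ^ 2 := by nlinarith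
  obtain ⟨ε, hε, H⟩ := _root_.exists_energy_threshold (n := n) (k := k) (A := 2 ^ a) (c := κ / 4)
    (C₁ := 4 * (N ^ 2 - (N - a) ^ 2) + 4 * C.K) (C₂ := 4 * a) hp hn hN (by positivity)
    (by positivity) (by positivity) (by positivity) hθ
  refine ⟨ε, hε, fun u hu y hy hE i => ?_⟩
  have hv := hu.isSolution hn
  choose w hw hwu using fun i => exists_contDiff_eventuallyEq (hu.contDiffAt i) hy
  choose W hW hWv using fun i => exists_contDiff_eventuallyEq (hv.contDiffAt i) hy
  have hann : ∀ z, ‖z - y‖ < 1 / 2 → 1 / 2 ≤ ‖z‖ ∧ ‖z‖ ≤ 2 := by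
    intro z hz
    have h1 := norm_sub_norm_le y z
    have h2 := norm_sub_norm_le z y
    rw [norm_sub_rev] at h1
    constructor <;> linarith
  have hne : ∀ z, ‖z - y‖ < 1 / 2 → z ≠ 0 := fun z hz =>
    norm_pos_iff.1 (by linarith [(hann z hz).1])
  have hWpos : ∀ z, ‖z - y‖ < 1 / 2 → ∀ i, 0 < W i z := fun z hz i => by
    rw [(hWv i z hz).eq_of_nhds]
    exact hv.pos i z (hne z hz)
  have hy0 : ‖y - y‖ < 1 / 2 := by norm_num
  have hlt := H y w W hw hW (fun z hz i => ?_) hWpos fun i => ?_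
  · have h1 : W i y = u i y := by
      rw [(hWv i y hy0).eq_of_nhds, hy, Real.one_rpow, one_mul]
    rw [← h1]
    exact (Finset.single_le_sum (f := fun i => W i y) (fun j _ => (hWpos y hy0 j).le)
      (Finset.mem_univ i)).trans_lt hlt
  · have hz0 := hne z hz
    obtain ⟨hz1, hz2⟩ := hann z hz
    have hr := norm_pos_iff.2 hz0
    have hwz : ∀ j, w j z = u j z := fun j => (hwu j z hz).eq_of_nhds
    have hWz : ∀ j, W j z = ‖z‖ ^ (-a) * u j z := fun j => (hWv j z hz).eq_of_nhds
    refine ⟨?_, ?_, ?_, ?_⟩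
    · rw [hwz]
      exact hu.pos i z hz0
    · rw [hwz, hWz]
      refine mul_le_mul_of_nonneg_right ?_ (hu.pos i z hz0).le
      have := Real.rpow_le_rpow_of_nonpos (by norm_num) hz1 (neg_nonpos.2 ha)
      rwa [one_div, Real.inv_rpow zero_le_two, Real.rpow_neg zero_le_two, inv_inv] at this
    · rw [(laplacian_congr_nhds (hWv i z hz)).eq_of_nhds]
      have h1 := hv.laplacian i z hz0
      rw [norm_rpow_mul_f_smul C N hr (fun j => hv.pos j z hz0) i] at h1
      simp only [← hWz] at h1
      obtain ⟨V, hV⟩ : ∃ V, V = ∑ j, W j z := ⟨_, rfl⟩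
      have hle : ∀ j, W j z ≤ V := fun j => hV ▸ Finset.single_le_sum
        (f := fun i => W i z) (fun j _ => (hWpos z hz j).le) (Finset.mem_univ j)
      have hV0 : 0 < V := (hWpos z hz i).trans_le (hle i)
      have h2 := C.f_le (V := fun j => W j z) (hWpos z hz) hle i
      have h3 : ‖z‖ ^ (N * (p - 2)) = ‖z‖ ^ 2 * ‖z‖ ^ (N * (p - 2) - 2) := by
        rw [← Real.rpow_natCast, ← Real.rpow_add hr]
        congr 1
        push_cast
        ring
      have h4 : ‖z‖ ^ (N * (p - 2) - 2) ≤ 4 := by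
        have h5 := Real.rpow_le_rpow_of_nonpos (by norm_num) hz1
          (show N * (p - 2) - 2 ≤ 0 by linarith)
        have h6 := Real.rpow_le_rpow_of_exponent_ge (x := 1 / 2) (by norm_num) (by norm_num)
          (show (-2 : ℝ) ≤ N * (p - 2) - 2 by nlinarith)
        have h7 : (1 / 2 : ℝ) ^ (-2 : ℝ) = 4 := by
          rw [Real.rpow_neg (by norm_num), Real.rpow_two]; norm_num
        linarith
      have h5 : (‖z‖ ^ 2)⁻¹ ≤ 4 := by
        rw [inv_le_comm₀ (by positivity) (by norm_num)]
        nlinarith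
      have h6 : Δ (fun x => ‖x‖ ^ (-a) * u i x) z
          = -((‖z‖ ^ 2)⁻¹ * ((N ^ 2 - (N - a) ^ 2) * W i z)
            + ‖z‖ ^ (N * (p - 2) - 2) * C.f i fun j => W j z) := by
        rw [h3] at h1
        have h7 : ‖z‖ ^ 2 ≠ 0 := by positivity
        refine mul_left_cancel₀ h7 (h1.trans ?_)
        field_simp
      rw [h6, neg_le_neg_iff, ← hV]
      have h8 : (‖z‖ ^ 2)⁻¹ * ((N ^ 2 - (N - a) ^ 2) * W i z)
          ≤ 4 * ((N ^ 2 - (N - a) ^ 2) * V) :=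
        mul_le_mul h5 (mul_le_mul_of_nonneg_left (hle i) hL)
          (mul_nonneg hL (hWpos z hz i).le) (by norm_num)
      have h9 : ‖z‖ ^ (N * (p - 2) - 2) * (C.f i fun j => W j z)
          ≤ 4 * (C.K * V ^ (p - 1)) :=
        mul_le_mul h4 h2 (C.f_pos (hWpos z hz) i).le (by norm_num)
      have h10 : 0 ≤ (N ^ 2 - (N - a) ^ 2) * V ^ (p - 1) := by positivity
      have h11 : 0 ≤ C.K * V := by positivity
      nlinarith
    · rw [(laplacian_congr_nhds (hwu i z hz)).eq_of_nhds, (hwu i z hz).fderiv_eq, hwz,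
      hu.laplacian i z hz0]
      have h1 := C.le_f (V := fun j => u j z) (fun j => hu.pos j z hz0) i
      have h2 : 1 / 4 ≤ ‖z‖ ^ ((N - a) * (p - 2) - 2) := by
        have h3 : (N - a) * (p - 2) - 2 ≤ 0 := by nlinarith
        have h4 : (-2 : ℝ) ≤ (N - a) * (p - 2) - 2 := by nlinarith
        have h5 := Real.rpow_le_rpow_of_nonpos hr hz2 h3
        have h6 := Real.rpow_le_rpow_of_exponent_le (one_le_two (α := ℝ)) h4
        have h7 : (2 : ℝ) ^ (-2 : ℝ) = 1 / 4 := by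
          rw [Real.rpow_neg (by norm_num), Real.rpow_two]; norm_num
        rw [h7] at h6
        exact h6.trans h5
      have h3 : |fderiv ℝ (u i) z z * (‖z‖ ^ 2)⁻¹| ≤ 2 * ‖fderiv ℝ (u i) z‖ := by
        rw [abs_mul, abs_of_pos (show 0 < (‖z‖ ^ 2)⁻¹ by positivity), ← div_eq_mul_inv,
          div_le_iff₀ (by positivity)]
        have h4 := (fderiv ℝ (u i) z).le_opNorm z
        rw [Real.norm_eq_abs] at h4
        have h5 : ‖fderiv ℝ (u i) z‖ * ‖z‖ ≤ ‖fderiv ℝ (u i) z‖ * (2 * ‖z‖ ^ 2) :=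
          mul_le_mul_of_nonneg_left (by nlinarith) (norm_nonneg _)
        linarith
      have h4 : κ / 4 * u i z ^ (p - 1)
          ≤ ‖z‖ ^ ((N - a) * (p - 2) - 2) * C.f i fun j => u j z := by
        have h5 : 0 < u i z ^ (p - 1) := Real.rpow_pos_of_pos (hu.pos i z hz0) _
        have h6 : κ * u i z ^ (p - 1) ≤ C.f i fun j => u j z :=
          (mul_le_mul_of_nonneg_right (hκC i) h5.le).trans h1
        have h7 := mul_le_mul h2 h6 (by positivity) (by positivity)
        linarith
      have h5 := mul_le_mul_of_nonneg_left ((le_abs_self _).trans h3) ha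
      linarith
  · refine (le_of_eq ?_).trans (hE i)
    refine setIntegral_congr_fun measurableSet_ball fun z hz => ?_
    rw [Metric.mem_ball, dist_eq_norm] at hz
    simp only [(hwu i z hz).fderiv_eq]

end HenonSobolev

section Decay

open InnerProductSpace Laplacian
open scoped Pointwise

variable {n k : ℕ} {p : ℝ}

local notation "E" n => EuclideanSpace ℝ (Fin n)

namespace IsHenonSolution

variable {C : Coupling k p} {a N : ℝ} {u : Fin k → (E n) → ℝ}

theorem setIntegral_comp_smul_le (hu : IsHenonSolution C a N u) (hn : (n : ℝ) = 2 * N + 2)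
    (ha : 0 ≤ a) (i : Fin k)
    (hE : Integrable fun x : E n => ‖x‖ ^ (-(2 * a)) * ‖fderiv ℝ (u i) x‖ ^ 2) {R : ℝ}
    (hR : 0 < R) {y : E n} (hy : ‖y‖ = 1) :
    ∫ x in Metric.ball y (1 / 2), ‖fderiv ℝ (fun x => R ^ (N - a) * u i (R • x)) x‖ ^ 2
      ≤ 2 ^ (2 * a) * ∫ x in Metric.ball (R • y) (R / 2),
        ‖x‖ ^ (-(2 * a)) * ‖fderiv ℝ (u i) x‖ ^ 2 := by
  have hnorm : ∀ x ∈ Metric.ball y (1 / 2), 1 / 2 < ‖x‖ := by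
    intro x hx
    rw [Metric.mem_ball, dist_eq_norm] at hx
    have := norm_sub_norm_le y x
    rw [norm_sub_rev] at this
    linarith
  have h1 : ∀ x ∈ Metric.ball y (1 / 2), ‖fderiv ℝ (fun x => R ^ (N - a) * u i (R • x)) x‖ ^ 2
      = (R ^ (N - a) * R) ^ 2 * ‖fderiv ℝ (u i) (R • x)‖ ^ 2 := by
    intro x hx
    have hx0 : x ≠ 0 := norm_pos_iff.1 (by linarith [hnorm x hx])
    have h4 : HasFDerivAt (fun x : E n => R • x) (R • ContinuousLinearMap.id ℝ (E n)) x :=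
      (hasFDerivAt_id x).const_smul R
    have h5 : fderiv ℝ (fun x => R ^ (N - a) * u i (R • x)) x
        = R ^ (N - a) • (fderiv ℝ (u i) (R • x)).comp (R • ContinuousLinearMap.id ℝ (E n)) :=
      ((((hu.contDiffAt i _ (smul_ne_zero hR.ne' hx0)).differentiableAt
        (by norm_num)).hasFDerivAt.comp x h4).const_mul (R ^ (N - a))).fderiv
    rw [h5, ContinuousLinearMap.comp_smul, ContinuousLinearMap.comp_id, norm_smul, norm_smul,
      Real.norm_of_nonneg hR.le, Real.norm_of_nonneg (by positivity)]
    ring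
  have h2 : R • Metric.ball y (1 / 2) = Metric.ball (R • y) (R / 2) := by
    rw [smul_ball hR.ne', Real.norm_of_nonneg hR.le, mul_one_div]
  have h3 : (R ^ (N - a) * R) ^ 2 * (R ^ n)⁻¹ = R ^ (-(2 * a)) := by
    rw [← Real.rpow_add_one hR.ne', ← Real.rpow_natCast, ← Real.rpow_natCast, ← Real.rpow_neg hR.le,
      ← Real.rpow_mul hR.le, ← Real.rpow_add hR, hn]
    congr 1
    push_cast
    ring
  rw [setIntegral_congr_fun measurableSet_ball h1, integral_const_mul,
    Measure.setIntegral_comp_smul_of_pos volume (fun x => ‖fderiv ℝ (u i) x‖ ^ 2) _ hR, h2,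
    finrank_euclideanSpace, Fintype.card_fin, smul_eq_mul, ← mul_assoc, h3,
    ← integral_const_mul, ← integral_const_mul]
  refine integral_mono_of_nonneg (Eventually.of_forall fun x => by positivity)
    (hE.restrict.const_mul _) ?_
  refine (ae_restrict_iff' measurableSet_ball).2 (Eventually.of_forall fun x hx => ?_)
  rw [Metric.mem_ball, dist_eq_norm] at hx
  have h4 : ‖R • y‖ = R := by rw [norm_smul, hy, mul_one, Real.norm_of_nonneg hR.le]
  have h5 := norm_sub_norm_le x (R • y)
  have h6 := norm_sub_norm_le (R • y) x
  rw [norm_sub_rev] at h6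
  have h7 : 0 < ‖x‖ := by linarith
  have h8 : R ^ (-(2 * a)) ≤ 2 ^ (2 * a) * ‖x‖ ^ (-(2 * a)) := by
    have h9 := Real.rpow_le_rpow_of_nonpos (show 0 < ‖x‖ / 2 by positivity)
      (show ‖x‖ / 2 ≤ R by linarith) (show -(2 * a) ≤ 0 by linarith)
    rw [Real.div_rpow h7.le zero_le_two, Real.rpow_neg zero_le_two, div_inv_eq_mul] at h9
    exact h9.trans_eq (mul_comm _ _)
  simp only [← mul_assoc]
  exact mul_le_mul_of_nonneg_right h8 (by positivity)

/-- Finite energy forces decay at both ends of the punctured space. -/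
theorem decaysAt (hu : IsHenonSolution C a N u) (hn : (n : ℝ) = 2 * N + 2) (ha : 0 ≤ a)
    (haN : a < N) (hp : 2 < p) (hN : N * (p - 2) ≤ 2)
    (hE : ∀ i, Integrable fun x : E n => ‖x‖ ^ (-(2 * a)) * ‖fderiv ℝ (u i) x‖ ^ 2) {σ : ℝ}
    (hσ : σ = 1 ∨ σ = -1) : DecaysAt N σ fun i x => ‖x‖ ^ (-a) * u i x := by
  intro δ hδ
  obtain ⟨ε, hε, H⟩ := exists_energy_threshold (n := n) C hn ha haN hp hN hδ
  let S : ℝ → Set (E n) := fun t => {x | t ≤ σ * Real.log ‖x‖}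
  have hmeas : ∀ t, MeasurableSet (S t) := fun t =>
    measurableSet_le measurable_const ((Real.measurable_log.comp measurable_norm).const_mul σ)
  have hanti : Antitone S := fun s t hst x (hx : t ≤ σ * Real.log ‖x‖) => hst.trans hx
  have hinter : ⋂ t, S t = ∅ := by
    refine Set.eq_empty_iff_forall_notMem.2 fun x hx => ?_
    have h1 : σ * Real.log ‖x‖ + 1 ≤ σ * Real.log ‖x‖ := Set.mem_iInter.1 hx _
    linarith
  have htend : ∀ i, ∀ᶠ t in atTop,
      2 ^ (2 * a) * ∫ x in S t, ‖x‖ ^ (-(2 * a)) * ‖fderiv ℝ (u i) x‖ ^ 2 ≤ ε := by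
    intro i
    have h1 := (tendsto_setIntegral_of_antitone hmeas hanti
      ⟨0, (hE i).integrableOn⟩).const_mul ((2 : ℝ) ^ (2 * a))
    rw [hinter, setIntegral_empty, mul_zero] at h1
    exact h1.eventually_le_const hε
  obtain ⟨t, ht⟩ := (eventually_all.2 htend).exists
  refine ⟨t + Real.log 2, fun i x hx hlog => ?_⟩
  have hR := norm_pos_iff.2 hx
  have hy : ‖(‖x‖⁻¹ • x)‖ = 1 := norm_smul_inv_norm hx
  have hxy : ‖x‖ • (‖x‖⁻¹ • x) = x := by rw [smul_smul, mul_inv_cancel₀ hR.ne', one_smul]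
  have h1 := H _ (hu.comp_smul hR) _ hy (fun j => ?_) i
  · simp only [hxy] at h1
    rwa [← mul_assoc, ← Real.rpow_add hR, ← sub_eq_add_neg]
  refine (hu.setIntegral_comp_smul_le hn ha j (hE j) hR hy).trans (le_trans ?_ (ht j))
  refine mul_le_mul_of_nonneg_left (setIntegral_mono_set (hE j).integrableOn
    (Eventually.of_forall fun x => by positivity) (LE.le.eventuallyLE fun z hz => ?_))
    (by positivity)
  rw [hxy, Metric.mem_ball, dist_eq_norm] at hz
  change t ≤ σ * Real.log ‖z‖
  have h5 := norm_sub_norm_le z x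
  have h6 := norm_sub_norm_le x z
  rw [norm_sub_rev] at h6
  have h7 : Real.log ‖z‖ ≤ Real.log ‖x‖ + Real.log 2 := by
    rw [← Real.log_mul hR.ne' two_ne_zero]
    exact Real.log_le_log (by linarith) (by linarith)
  have h8 : Real.log ‖x‖ - Real.log 2 ≤ Real.log ‖z‖ := by
    rw [← Real.log_div hR.ne' two_ne_zero]
    exact Real.log_le_log (by positivity) (by linarith)
  rcases hσ with rfl | rfl <;> linarith

end IsHenonSolution

end Decay

section Classification

open InnerProductSpace Laplacian

variable {n k : ℕ} {p : ℝ}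

local notation "E" n => EuclideanSpace ℝ (Fin n)

theorem isHenonSolution_of_wdiv (C : Coupling k p) {a b N : ℝ} {u : Fin k → (E n) → ℝ}
    (hb : (N - a) * (p - 2) - 2 = 2 * a - b * p) (hreg : ∀ i, ContDiffOn ℝ 2 (u i) {0}ᶜ)
    (hpos : ∀ i, ∀ x : E n, x ≠ 0 → 0 < u i x)
    (heq : ∀ i, ∀ x : E n, x ≠ 0 →
      -(wdiv a (u i) x) = ‖x‖ ^ (-(b * p)) * C.f i (fun j => u j x)) :
    IsHenonSolution C a N u := by
  have hcd : ∀ i, ∀ x ≠ 0, ContDiffAt ℝ 2 (u i) x := fun i x hx =>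
    (hreg i).contDiffAt (isOpen_compl_singleton.mem_nhds hx)
  refine ⟨hcd, hpos, fun i x hx => ?_⟩
  have hr := norm_pos_iff.2 hx
  have h1 := heq i x hx
  rw [wdiv, lapl_eq_laplacian (hcd i x hx), inner_gradient_right, conj_trivial] at h1
  have h2 : ‖x‖ ^ (-(b * p)) = ‖x‖ ^ (-(2 * a)) * ‖x‖ ^ ((N - a) * (p - 2) - 2) := by
    rw [← Real.rpow_add hr, hb]
    congr 1
    ring
  rw [h2, ← mul_neg, mul_assoc _ (‖x‖ ^ _)] at h1
  have h3 := mul_left_cancel₀ (Real.rpow_pos_of_pos hr (-(2 * a))).ne' h1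
  rw [div_eq_mul_inv] at h3
  linarith

theorem IsHenonSolution.isDecayingSolution {C : Coupling k p} {a N : ℝ} {u : Fin k → (E n) → ℝ}
    (hu : IsHenonSolution C a N u) (hn : (n : ℝ) = 2 * N + 2) (ha : 0 ≤ a) (haN : a < N)
    (hN : N * (p - 2) ≤ 2) (hstrict : 0 < a ∨ N * (p - 2) < 2)
    (hE : ∀ i, Integrable fun x : E n => ‖x‖ ^ (-(2 * a)) * ‖fderiv ℝ (u i) x‖ ^ 2) (i₀ : Fin k) :
    IsDecayingSolution C N (N - a) fun i x => ‖x‖ ^ (-a) * u i x where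
  toIsSolution := hu.isSolution hn
  dim := hn
  Λ_pos := sub_pos.2 haN
  Λ_le := sub_le_self N ha
  exponent_le := hN
  strict := hstrict.imp_left fun h => sub_lt_self N h
  bounds := (hu.isSolution hn).exists_bounds hn (sub_pos.2 haN)
    (fun _ hσ => hu.decaysAt hn ha haN (C.two_lt i₀) hN hE hσ) i₀

theorem tendsto_neg_log_norm_punctured :
    Tendsto (fun x : E n => -Real.log ‖x‖) (𝓝[≠] 0) atTop :=
  tendsto_neg_atBot_atTop.comp (Real.tendsto_log_nhdsNE_zero.comp
    (tendsto_norm_nhdsNE_zero.mono_right (nhdsWithin_mono 0 fun _ hx => ne_of_gt hx)))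

theorem norm_rpow_sub_mul_eq {a N Λ : ℝ} (hΛ : Λ = N - a) {w : (E n) → ℝ} {φ : ℝ → ℝ}
    (hφ : ∀ x ≠ 0, ‖x‖ ^ N * (‖x‖ ^ (-a) * w x) = φ (Real.log ‖x‖)) {x : E n} (hx : x ≠ 0) :
    ‖x‖ ^ Λ * w x = φ (Real.log ‖x‖) := by
  rw [← hφ x hx, ← mul_assoc, ← Real.rpow_add (norm_pos_iff.2 hx), hΛ, sub_eq_add_neg]

end Classification

theorem stmt {k n : ℕ} (hk : 2 ≤ k) (hn : 3 ≤ n) (a b p : ℝ)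
    (ha0 : 0 ≤ a) (ha : a < ((n:ℝ)-2)/2) (hb0 : 0 < b) (hab : a ≤ b) (hba : b < a + 1)
    (hp : p = 2*(n:ℝ)/((n:ℝ)-2+2*(b-a)))
    (κ α β : Fin k → Fin k → ℝ)
    (hκ : ∀ i j, 0 < κ i j) (hα : ∀ i j, 1 < α i j) (hβ : ∀ i j, 1 < β i j)
    (hαβ : ∀ i j, α i j + β i j = p)
    (u : Fin k → EuclideanSpace ℝ (Fin n) → ℝ)
    (hreg : ∀ i, ContDiffOn ℝ 2 (u i) {0}ᶜ)
    (hpos : ∀ i, ∀ x : EuclideanSpace ℝ (Fin n), x ≠ 0 → 0 < u i x)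
    (heq : ∀ i, ∀ x : EuclideanSpace ℝ (Fin n), x ≠ 0 →
      -(wdiv a (u i) x) = ‖x‖ ^ (-(b*p)) *
        ∑ j, κ i j * u i x ^ (α i j - 1) * u j x ^ (β i j))
    (hE : ∀ i, finiteEnergy a (u i)) :
    ∀ i : Fin k,
      (∀ x y : EuclideanSpace ℝ (Fin n), x ≠ 0 → y ≠ 0 → ‖x‖ = ‖y‖ → u i x = u i y) ∧
      (∃ l : ℝ, 0 < l ∧ Tendsto (u i) (𝓝[≠] (0 : EuclideanSpace ℝ (Fin n))) (𝓝 l)) ∧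
      (∃ L : ℝ, 0 < L ∧
        Tendsto (fun x : EuclideanSpace ℝ (Fin n) => ‖x‖ ^ ((n:ℝ)-2-2*a) * u i x)
          (comap (fun x : EuclideanSpace ℝ (Fin n) => ‖x‖) atTop) (𝓝 L)) ∧
      (∃ τ : ℝ, 0 < τ ∧
        ∀ e : EuclideanSpace ℝ (Fin n), ‖e‖ = 1 →
          ∀ g : ℝ → ℝ,
            g = (fun t => Real.exp (-(((n:ℝ)-2-2*a)/2) * t) *
              (τ ^ (((n:ℝ)-2-2*a)/2) * u i (τ • Real.exp (-t) • e))) →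
            (∀ t : ℝ, g (-t) = g t) ∧ StrictAntiOn g (Set.Ioi 0)) := by
  intro i
  let C : Coupling k p := ⟨κ, α, β, hκ, hα, hβ, hαβ⟩
  obtain ⟨N, hN⟩ : ∃ N : ℝ, N = ((n : ℝ) - 2) / 2 := ⟨_, rfl⟩
  have hdim : (n : ℝ) = 2 * N + 2 := by rw [hN]; ring
  obtain ⟨Λ, hΛ⟩ : ∃ Λ : ℝ, Λ = N - a := ⟨_, rfl⟩
  have hexp : (n : ℝ) - 2 - 2 * a = 2 * Λ := by rw [hΛ, hdim]; ring
  have hexp' : ((n : ℝ) - 2 - 2 * a) / 2 = Λ := by rw [hexp]; ring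
  rw [hexp', hexp]
  have haN : a < N := hN ▸ ha
  have hpN : p * (N + b - a) = 2 * N + 2 := by
    have h1 : (0 : ℝ) < N + b - a := by linarith
    rw [hp, hdim, show 2 * N + 2 - 2 + 2 * (b - a) = 2 * (N + b - a) by ring]
    field_simp
  have hp2 : 2 < p := C.two_lt i
  have hu : IsHenonSolution C a N u :=
    isHenonSolution_of_wdiv C (b := b) (by linear_combination hpN) hreg hpos heq
  have hEf : ∀ i, Integrable fun x : EuclideanSpace ℝ (Fin n) =>
      ‖x‖ ^ (-(2 * a)) * ‖fderiv ℝ (u i) x‖ ^ 2 := fun i => by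
    simpa only [finiteEnergy, norm_gradient] using hE i
  have hv := hu.isDecayingSolution hdim ha0 haN
    (by nlinarith [mul_nonneg (show 0 ≤ p by linarith) (sub_nonneg.2 hab)])
    (ha0.lt_or_eq.imp_right fun h => by
      subst h
      nlinarith [mul_pos (show 0 < p by linarith) hb0]) hEf i
  have : Nontrivial (EuclideanSpace ℝ (Fin n)) := by
    have : NeZero n := ⟨by linarith⟩
    infer_instance
  obtain ⟨e₀, he₀⟩ := exists_norm_eq (EuclideanSpace ℝ (Fin n)) zero_le_one
  obtain ⟨φ, φ', hφ, hvφ⟩ := hv.exists_isProfile he₀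
  have huφ : ∀ x : EuclideanSpace ℝ (Fin n), x ≠ 0 → ‖x‖ ^ Λ * u i x = φ i (Real.log ‖x‖) :=
    fun x hx => norm_rpow_sub_mul_eq hΛ (hvφ i) hx
  refine ⟨fun x y hx hy hxy => ?_, ?_, ?_, ?_⟩
  · have h1 := huφ x hx
    rw [hxy, ← huφ y hy] at h1
    exact mul_left_cancel₀ (Real.rpow_pos_of_pos (norm_pos_iff.2 hy) Λ).ne' h1
  · obtain ⟨L, hL, hlim⟩ := hφ.comp_neg.exists_tendsto i
    refine ⟨L, hL, (hlim.comp tendsto_neg_log_norm_punctured).congr' ?_⟩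
    filter_upwards [self_mem_nhdsWithin] with x hx
    have hr : 0 < ‖x‖ := norm_pos_iff.2 hx
    simp only [Function.comp_apply, neg_neg]
    rw [← huφ x hx, ← hΛ, ← mul_assoc, Real.rpow_def_of_pos hr, ← Real.exp_add,
      show Λ * -Real.log ‖x‖ + Real.log ‖x‖ * Λ = 0 by ring, Real.exp_zero, one_mul]
  · obtain ⟨L, hL, hlim⟩ := hφ.exists_tendsto i
    refine ⟨L, hL, (hlim.comp (Real.tendsto_log_atTop.comp tendsto_comap)).congr' ?_⟩
    filter_upwards [tendsto_comap.eventually (eventually_gt_atTop 0)] with x hr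
    simp only [Function.comp_apply]
    rw [← huφ x (norm_pos_iff.1 hr), ← hΛ, ← mul_assoc, two_mul, Real.rpow_add hr,
      mul_comm Λ, ← Real.rpow_def_of_pos hr]
  · obtain ⟨l, hl⟩ := hφ.exists_axis i
    obtain ⟨hsymm, hanti⟩ := hl i
    refine ⟨Real.exp l, Real.exp_pos l, fun e he g hg => ?_⟩
    have hgφ : ∀ t, g t = φ i (l - t) := by
      intro t
      have h1 : Real.exp l • Real.exp (-t) • e = Real.exp (l - t) • e := by
        rw [smul_smul, ← Real.exp_add, sub_eq_add_neg]
      have h2 : ‖Real.exp (l - t) • e‖ = Real.exp (l - t) := by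
        rw [norm_smul, he, mul_one, Real.norm_of_nonneg (Real.exp_pos _).le]
      have h3 := huφ (Real.exp (l - t) • e)
        (norm_pos_iff.1 (by rw [h2]; exact Real.exp_pos _))
      rw [h2, Real.log_exp, ← Real.exp_mul] at h3
      rw [← h3, hg]
      simp only
      rw [h1, ← Real.exp_mul, ← mul_assoc, ← Real.exp_add]
      congr 2
      ring
    have heven : ∀ t, φ i (l - t) = φ i (l + t) := fun t => by
      rw [← hsymm (l + t)]
      congr 1
      ring
    refine ⟨fun t => ?_, fun s hs t _ hst => ?_⟩
    · rw [hgφ, hgφ, heven, sub_eq_add_neg]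
    · have hs0 : 0 < s := hs
      rw [hgφ, hgφ, heven, heven]
      exact hanti (Set.mem_Ici.2 (by linarith)) (Set.mem_Ici.2 (by linarith)) (by linarith)
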